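/- Let K be a quadratic field and let c ∈ K. Then there do not exist α, β ∈ K such that α has preperiodic type 1₂ under f_c and β has exact period 3 under f_c. -/

import Mathlib

/-- The quadratic map `z ↦ z ^ 2 + c`. -/
def fc {K : Type*} [Field K] (c : K) : K → K := fun z => z ^ 2 + c

/-- `α` has exact period `m` under `fc c`. -/
def HasExactPeriod {K : Type*} [Field K] (c : K) (m : ℕ) (α : K) : Prop :=
  (fc c)^[m] α = α ∧ ∀ j : ℕ, 1 ≤ j → j < m → (fc c)^[j] α ≠ α

/-- `α` has preperiodic type `m_n` under `fc c`: preperiod exactly `n`, eventual period `m`. -/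
def HasPreperiodicType {K : Type*} [Field K] (c : K) (m n : ℕ) (α : K) : Prop :=
  HasExactPeriod c m ((fc c)^[n] α) ∧ (fc c)^[n + m - 1] α ≠ (fc c)^[n - 1] α

/-- A uniformizer `l` with residue field `𝔽₃`, normalised by `l ^ 3 = 3 * (l ^ 2 - 1)`. -/
structure IsCubicUniformizer {R : Type*} [CommRing R] (l : R) : Prop where
  rel : l ^ 3 = 3 * (l ^ 2 - 1)
  res : ∀ x : R, l ∣ x ∨ l ∣ x - 1 ∨ l ∣ x + 1
  ne_zero : l ≠ 0
  not_dvd_one : ¬ l ∣ 1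
  exists_not_pow_dvd : ∀ x : R, x ≠ 0 → ∃ n : ℕ, ¬ l ^ n ∣ x

namespace IsCubicUniformizer

variable {R : Type*} [CommRing R] {l : R}

theorem three_eq (h : IsCubicUniformizer l) : (3 : R) = l ^ 3 * (-1 + 3 * l - l ^ 2) := by
  linear_combination (l ^ 2 + 1) * h.rel

theorem pow_three_dvd_three (h : IsCubicUniformizer l) : l ^ 3 ∣ 3 :=
  ⟨_, h.three_eq⟩

theorem dvd_three (h : IsCubicUniformizer l) : l ∣ 3 :=
  (dvd_pow_self l three_ne_zero).trans h.pow_three_dvd_three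

theorem res_mul (h : IsCubicUniformizer l) {z : R} (hz : ¬ l ∣ z) (σ : R) :
    l ∣ σ ∨ l ∣ σ - z ∨ l ∣ σ + z := by
  rcases h.res σ with k | k | k
  · exact .inl k
  all_goals
    rcases (h.res z).resolve_left hz with k' | k'
  · right; left; convert dvd_sub k k' using 1; ring
  · right; right; convert dvd_add k k' using 1; ring
  · right; right; convert dvd_add k k' using 1; ring
  · right; left; convert dvd_sub k k' using 1; ring

theorem digit (h : IsCubicUniformizer l) (x : R) :
    ∃ (e : ℤ) (d : R), (e = 0 ∨ e = 1 ∨ e = -1) ∧ x = e + l * d := by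
  rcases h.res x with ⟨d, hd⟩ | ⟨d, hd⟩ | ⟨d, hd⟩
  · exact ⟨0, d, by simp, by simp [hd]⟩
  · exact ⟨1, d, by simp, by simp [← hd]⟩
  · exact ⟨-1, d, by simp, by simp [← hd]⟩

theorem three_dvd_of_dvd_intCast (h : IsCubicUniformizer l) {n : ℤ} (hn : l ∣ (n : R)) :
    (3 : ℤ) ∣ n := by
  by_contra hc
  have h1 : n % 3 = 1 ∨ n % 3 = 2 := by omega
  have h2 : (n : R) = 3 * ((n / 3 : ℤ) : R) + ((n % 3 : ℤ) : R) := by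
    conv_lhs => rw [← Int.mul_ediv_add_emod n 3]
    push_cast
    rfl
  have h3 : l ∣ ((n % 3 : ℤ) : R) := by
    rw [h2] at hn
    exact (dvd_add_right (h.dvd_three.mul_right _)).1 hn
  rcases h1 with h1 | h1 <;> rw [h1] at h3
  · exact h.not_dvd_one (by simpa using h3)
  · apply h.not_dvd_one
    have := dvd_sub h.dvd_three h3
    norm_num at this
    simpa using this

theorem pow_three_dvd_intCast (h : IsCubicUniformizer l) {n : ℤ} (hn : (3 : ℤ) ∣ n) :
    l ^ 3 ∣ (n : R) := by
  obtain ⟨k, rfl⟩ := hn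
  push_cast
  exact h.pow_three_dvd_three.mul_right _

theorem prime_dvd (h : IsCubicUniformizer l) {x y : R} (hxy : l ∣ x * y) : l ∣ x ∨ l ∣ y := by
  obtain ⟨e, d, he, rfl⟩ := h.digit x
  obtain ⟨f, g, hf, rfl⟩ := h.digit y
  have h1 : l ∣ ((e * f : ℤ) : R) := by
    have : ((e * f : ℤ) : R) = (e + l * d) * (f + l * g) - l * (e * g + d * f + l * d * g) := by
      push_cast; ring
    rw [this]
    exact dvd_sub hxy (dvd_mul_right _ _)
  have h2 := h.three_dvd_of_dvd_intCast h1
  rcases he with rfl | rfl | rfl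
  · left; simp
  all_goals
    rcases hf with rfl | rfl | rfl
    · right; simp
    · norm_num at h2
    · norm_num at h2

theorem prime_dvd_pow (h : IsCubicUniformizer l) {x : R} {n : ℕ} (hx : l ∣ x ^ n) : l ∣ x := by
  induction n with
  | zero => exact absurd (by simpa using hx) h.not_dvd_one
  | succ n ih => rw [pow_succ] at hx; exact (h.prime_dvd hx).elim ih id

theorem pow_dvd_of_pow_dvd_mul [IsDomain R] (h : IsCubicUniformizer l) {n : ℕ} {u x : R} (hu : ¬ l ∣ u)
    (hx : l ^ n ∣ u * x) : l ^ n ∣ x := by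
  induction n generalizing x with
  | zero => simp
  | succ n ih =>
    have h1 : l ∣ u * x := (dvd_pow_self l n.succ_ne_zero).trans hx
    obtain ⟨y, rfl⟩ := (h.prime_dvd h1).resolve_left hu
    rw [pow_succ', mul_left_comm] at hx
    rw [pow_succ']
    exact mul_dvd_mul_left _ (ih ((mul_dvd_mul_iff_left h.ne_zero).1 hx))

/-- Any nonzero triple is `l` to a power times an `l`-primitive triple. -/
theorem exists_primitive (h : IsCubicUniformizer l) {x y z : R}
    (hne : ¬ (x = 0 ∧ y = 0 ∧ z = 0)) :
    ∃ (n : ℕ) (x' y' z' : R), x = l ^ n * x' ∧ y = l ^ n * y' ∧ z = l ^ n * z' ∧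
      ¬ (l ∣ x' ∧ l ∣ y' ∧ l ∣ z') := by
  classical
  have hex : ∃ n : ℕ, ¬ (l ^ n ∣ x ∧ l ^ n ∣ y ∧ l ^ n ∣ z) := by
    by_contra! hall
    refine hne ⟨?_, ?_, ?_⟩ <;> by_contra h0
    · obtain ⟨n, hn⟩ := h.exists_not_pow_dvd _ h0
      exact hn (hall n).1
    · obtain ⟨n, hn⟩ := h.exists_not_pow_dvd _ h0
      exact hn (hall n).2.1
    · obtain ⟨n, hn⟩ := h.exists_not_pow_dvd _ h0
      exact hn (hall n).2.2
  have hspec := Nat.find_spec hex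
  have hmin := fun m => Nat.find_min hex (m := m)
  set n := Nat.find hex
  match n with
  | 0 => exact absurd (by simp) hspec
  | m + 1 =>
    have := hmin m (Nat.lt_succ_self m)
    push Not at this
    obtain ⟨⟨x', rfl⟩, ⟨y', rfl⟩, ⟨z', rfl⟩⟩ := this
    refine ⟨m, x', y', z', rfl, rfl, rfl, fun ⟨a, b, c⟩ => hspec ?_⟩
    rw [pow_succ]
    exact ⟨mul_dvd_mul_left _ a, mul_dvd_mul_left _ b, mul_dvd_mul_left _ c⟩

theorem cube_digit {e : ℤ} (he : e = 0 ∨ e = 1 ∨ e = -1) : (e : R) ^ 3 = e := by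
  rcases he with rfl | rfl | rfl <;> norm_num

theorem pow_three_dvd_cube_sub (h : IsCubicUniformizer l) {e : ℤ}
    (he : e = 0 ∨ e = 1 ∨ e = -1) (d : R) : l ^ 3 ∣ ((e : R) + l * d) ^ 3 - e := by
  refine ⟨(-1 + 3 * l - l ^ 2) * (e ^ 2 * l * d + e * l ^ 2 * d ^ 2) + d ^ 3, ?_⟩
  linear_combination cube_digit (R := R) he + (e ^ 2 * l * d + e * l ^ 2 * d ^ 2) * h.three_eq

theorem cube_expand (h : IsCubicUniformizer l) {e : ℤ}
    (he : e = 0 ∨ e = 1 ∨ e = -1) (d : R) :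
    ∃ q : R, (1 + l * (e + l * d)) ^ 3 = 1 + (l ^ 3 - l ^ 4) * e + l ^ 5 * q := by
  set ε : R := -1 + 3 * l - l ^ 2 with hε
  refine ⟨(3 - l) * e + ε * d + ε * (e + l * d) ^ 2 + l * ε * (e ^ 2 * l * d + e * l ^ 2 * d ^ 2)
    + l * d ^ 3, ?_⟩
  have h3 : (3 : R) = l ^ 3 * ε := h.three_eq
  linear_combination (l * (e + l * d) + l ^ 2 * (e + l * d) ^ 2 +
    l ^ 3 * (e ^ 2 * l * d + e * l ^ 2 * d ^ 2)) * h3 + l ^ 3 * cube_digit (R := R) he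
    + l ^ 4 * e * hε

end IsCubicUniformizer

namespace IsCubicUniformizer

variable {R : Type*} [CommRing R] [IsDomain R] {l : R}

/-- The part of `unit_congr` where all three coordinates are units. -/
theorem unit_congr_of_units (h : IsCubicUniformizer l) {r₁ r₂ κ X Y Z : R}
    (hκ : κ ^ 3 = r₁ * r₂) (h₁ : l ∣ r₁ - 1) (h₂ : l ∣ r₂ - 1)
    (hE : r₁ * X ^ 3 + r₂ * Y ^ 3 + 2 * Z ^ 3 + 3 * κ * X * Y * Z = 0)
    (hX : l ∣ X - 1) (hY : l ∣ Y - 1) (hZ : l ∣ Z + 1) : l ^ 3 ∣ r₁ - 1 := by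
  have h3 := h.three_eq
  obtain ⟨m, hm⟩ : l ∣ κ - 1 := by
    have h0 : l ∣ κ ^ 3 - 1 := by
      have : κ ^ 3 - 1 = (r₁ - 1) * r₂ + (r₂ - 1) := by rw [hκ]; ring
      rw [this]; exact dvd_add (h₁.mul_right _) h₂
    apply h.prime_dvd_pow (n := 3)
    have : (κ - 1) ^ 3 = κ ^ 3 - 1 - 3 * (κ ^ 2 - κ) := by ring
    rw [this]; exact dvd_sub h0 (h.dvd_three.mul_right _)
  obtain ⟨x, hx⟩ := hX
  obtain ⟨y, hy⟩ := hY
  obtain ⟨z, hz⟩ := hZ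
  obtain ⟨w, hw⟩ := h₁
  obtain ⟨w', hw'⟩ := h₂
  obtain ⟨a, a', ha, rfl⟩ := h.digit m
  obtain ⟨b, b', hb, rfl⟩ := h.digit x
  obtain ⟨c, c', hc, rfl⟩ := h.digit y
  obtain ⟨d, d', hd, hz'⟩ := h.digit (-z)
  obtain rfl : κ = 1 + l * (a + l * a') := by linear_combination hm
  obtain rfl : X = 1 + l * (b + l * b') := by linear_combination hx
  obtain rfl : Y = 1 + l * (c + l * c') := by linear_combination hy
  obtain rfl : Z = -(1 + l * (d + l * d')) := by linear_combination hz - l * hz'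
  obtain ⟨qa, hqa⟩ := h.cube_expand ha a'
  obtain ⟨qb, hqb⟩ := h.cube_expand hb b'
  obtain ⟨qc, hqc⟩ := h.cube_expand hc c'
  obtain ⟨qd, hqd⟩ := h.cube_expand hd d'
  obtain rfl : r₁ = 1 + l * w := by linear_combination hw
  obtain rfl : r₂ = 1 + l * w' := by linear_combination hw'
  have hE' : (1 + l * w) * (1 + (l ^ 3 - l ^ 4) * b + l ^ 5 * qb)
      + (1 + l * w') * (1 + (l ^ 3 - l ^ 4) * c + l ^ 5 * qc)
      - 2 * (1 + (l ^ 3 - l ^ 4) * d + l ^ 5 * qd)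
      - 3 * ((1 + l * (a + l * a')) * (1 + l * (b + l * b')) * (1 + l * (c + l * c'))
        * (1 + l * (d + l * d'))) = 0 := by
    rw [← hqb, ← hqc, ← hqd]; linear_combination hE
  rw [hqa] at hκ
  have key : l ^ 3 ∣ l ^ 2 * w ^ 2 := by
    have e1 : l ^ 3 ∣ (1 + l * w) * (1 + l * w') - 1 := by
      rw [← hκ]; exact ⟨(1 - l) * a + l ^ 2 * qa, by ring⟩
    have e2 : l ^ 3 ∣ (1 + l * w) + (1 + l * w') - 2 := by
      have e3 : l ^ 3 ∣ 3 * ((1 + l * (a + l * a')) * (1 + l * (b + l * b')) * (1 + l * (c + l * c'))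
        * (1 + l * (d + l * d'))) := h.pow_three_dvd_three.mul_right _
      have e4 : (1 + l * w) + (1 + l * w') - 2 = 3 * ((1 + l * (a + l * a')) *
        (1 + l * (b + l * b')) * (1 + l * (c + l * c')) * (1 + l * (d + l * d')))
        - l ^ 3 * ((1 + l * w) * ((1 - l) * b + l ^ 2 * qb) + (1 + l * w') * ((1 - l) * c + l ^ 2 * qc)
          - 2 * ((1 - l) * d + l ^ 2 * qd)) := by
        linear_combination hE'
      rw [e4]; exact dvd_sub e3 (dvd_mul_right _ _)
    have e5 : l ^ 2 * w ^ 2 = (1 + l * w) * ((1 + l * w) + (1 + l * w') - 2)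
      - ((1 + l * w) * (1 + l * w') - 1) := by ring
    rw [e5]; exact dvd_sub (e2.mul_left _) e1
  have hlw : l ∣ w := by
    rw [pow_succ, mul_dvd_mul_iff_left (pow_ne_zero _ h.ne_zero)] at key
    exact h.prime_dvd_pow key
  obtain ⟨k, rfl⟩ := hlw
  have hlw' : l ∣ w' := by
    have e1 : l * w' = l * (l * (-k * (1 + l * w') + l * ((1 - l) * a + l ^ 2 * qa))) := by
      linear_combination -hκ
    exact ⟨_, mul_left_cancel₀ h.ne_zero e1⟩
  obtain ⟨k', rfl⟩ := hlw'
  have hsum : k + k' = l * ((1 - l) * a + l ^ 2 * qa) - l ^ 2 * (k * k') := by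
    apply mul_left_cancel₀ (pow_ne_zero 2 h.ne_zero)
    linear_combination -hκ
  set U := ((1 + l * (a + l * a')) * (1 + l * (b + l * b')) * (1 + l * (c + l * c'))
        * (1 + l * (d + l * d'))) with hU
  obtain ⟨V, hV⟩ : ∃ V, U = 1 + l * (a + b + c + d) + l ^ 2 * V := by
    refine ⟨a' + b' + c' + d' + (a + l * a') * (b + l * b') + (a + l * a') * (c + l * c')
      + (a + l * a') * (d + l * d') + (b + l * b') * (c + l * c') + (b + l * b') * (d + l * d')
      + (c + l * c') * (d + l * d') + l * ((a + l * a') * (b + l * b') * (c + l * c')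
      + (a + l * a') * (b + l * b') * (d + l * d') + (a + l * a') * (c + l * c') * (d + l * d')
      + (b + l * b') * (c + l * c') * (d + l * d'))
      + l ^ 2 * ((a + l * a') * (b + l * b') * (c + l * c') * (d + l * d')), ?_⟩
    rw [hU]; ring
  clear_value U
  rw [hV] at hE'
  obtain ⟨Q, hQ⟩ : ∃ Q, ((1 + a + b + c + d : ℤ) : R) = l * (k * k') + l ^ 2 * Q := by
    refine ⟨-(k * (1 - l) * b + k' * (1 - l) * c + qa + (1 + l ^ 2 * k) * qb
      + (1 + l ^ 2 * k') * qc - 2 * qd - l * (-1 + 3 * l - l ^ 2) * (1 - l) * d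
      - l ^ 2 * (-1 + 3 * l - l ^ 2) * (1 + l * (a + b + c + d)) + (1 + l * (a + b + c + d))
      - (-1 + 3 * l - l ^ 2) * V), ?_⟩
    push_cast
    apply mul_left_cancel₀ (pow_ne_zero 3 h.ne_zero)
    linear_combination hE' - l ^ 2 * hsum + ((l ^ 3 - l ^ 4) * d +
      (1 + l * (a + b + c + d) + l ^ 2 * V) + l ^ 4 * (1 + l * (a + b + c + d))) * h3
  have hd1 : l ∣ ((1 + a + b + c + d : ℤ) : R) := by
    rw [hQ]; exact ⟨k * k' + l * Q, by ring⟩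
  obtain ⟨S, hS⟩ := h.pow_three_dvd_intCast (h.three_dvd_of_dvd_intCast hd1)
  have hkk : l ∣ k * k' := by
    refine ⟨l * S - Q, mul_left_cancel₀ h.ne_zero ?_⟩
    linear_combination hS - hQ
  have hk : l ∣ k := by
    rcases h.prime_dvd hkk with hk | hk
    · exact hk
    · have : k = l * ((1 - l) * a + l ^ 2 * qa) - l ^ 2 * (k * k') - k' := by
        linear_combination hsum
      rw [this]
      exact dvd_sub (dvd_sub (dvd_mul_right _ _) ⟨l * (k * k'), by ring⟩) hk
  obtain ⟨j, rfl⟩ := hk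
  exact ⟨j, by ring⟩

end IsCubicUniformizer

namespace IsCubicUniformizer

variable {R : Type*} [CommRing R] [IsDomain R] {l : R}

theorem digit_cases {a b c : ℤ} (ha : a = 0 ∨ a = 1 ∨ a = -1) (hb : b = 0 ∨ b = 1 ∨ b = -1)
    (hc : c = 0 ∨ c = 1 ∨ c = -1) (hmod : (3 : ℤ) ∣ a + b + 2 * c) :
    (a = 0 ∧ b = 0 ∧ c = 0) ∨ (a = 1 ∧ b = -1 ∧ c = 0) ∨ (a = -1 ∧ b = 1 ∧ c = 0) ∨
    (a = 1 ∧ b = 0 ∧ c = 1) ∨ (a = -1 ∧ b = 0 ∧ c = -1) ∨ (a = 0 ∧ b = 1 ∧ c = 1) ∨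
    (a = 0 ∧ b = -1 ∧ c = -1) ∨ (a = 1 ∧ b = 1 ∧ c = -1) ∨ (a = -1 ∧ b = -1 ∧ c = 1) := by
  rcases ha with rfl | rfl | rfl <;> rcases hb with rfl | rfl | rfl <;>
    rcases hc with rfl | rfl | rfl <;> first
    | decide
    | exact absurd hmod (by decide)

theorem unit_congr_aux (h : IsCubicUniformizer l) {r₁ r₂ κ X Y Z : R}
    (hκ : κ ^ 3 = r₁ * r₂) (h₁ : l ∣ r₁ - 1) (h₂ : l ∣ r₂ - 1)
    (hE : r₁ * X ^ 3 + r₂ * Y ^ 3 + 2 * Z ^ 3 + 3 * κ * X * Y * Z = 0)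
    (hprim : ¬ (l ∣ X ∧ l ∣ Y ∧ l ∣ Z)) : l ^ 3 ∣ r₁ - 1 := by
  have hll : l ∣ l ^ 3 := dvd_pow_self l three_ne_zero
  have hr : l ^ 3 ∣ r₁ * r₂ - 1 := by
    have h0 : l ∣ κ ^ 3 - 1 := by
      have : κ ^ 3 - 1 = (r₁ - 1) * r₂ + (r₂ - 1) := by rw [hκ]; ring
      rw [this]; exact dvd_add (h₁.mul_right _) h₂
    obtain ⟨e, d, he, rfl⟩ := h.digit κ
    have h1 := h.pow_three_dvd_cube_sub he d
    have h2 : l ∣ ((e - 1 : ℤ) : R) := by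
      have := dvd_sub h0 (hll.trans h1)
      push_cast
      convert this using 1; ring
    have h3 := h.three_dvd_of_dvd_intCast h2
    have : e = 1 := by omega
    subst this
    rw [← hκ]; simpa using h1
  obtain ⟨a, x, ha, rfl⟩ := h.digit X
  obtain ⟨b, y, hb, rfl⟩ := h.digit Y
  obtain ⟨c, z, hc, rfl⟩ := h.digit Z
  have key : l ^ 3 ∣ r₁ * a + r₂ * b + 2 * c := by
    have := dvd_add (dvd_add (dvd_add ((h.pow_three_dvd_cube_sub ha x).mul_left r₁)
      ((h.pow_three_dvd_cube_sub hb y).mul_left r₂))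
      ((h.pow_three_dvd_cube_sub hc z).mul_left 2))
      (h.pow_three_dvd_three.mul_right (κ * (a + l * x) * (b + l * y) * (c + l * z)))
    rw [← dvd_neg]
    convert this using 1
    linear_combination -hE
  have hmod : (3 : ℤ) ∣ a + b + 2 * c := by
    apply h.three_dvd_of_dvd_intCast
    have := dvd_sub (dvd_sub (hll.trans key) (h₁.mul_right (a : R))) (h₂.mul_right (b : R))
    push_cast
    convert this using 1; ring
  have hsub : l ^ 3 ∣ r₁ - r₂ → l ^ 3 ∣ r₁ - 1 := by
    intro hd
    apply h.pow_dvd_of_pow_dvd_mul (u := r₁ + 1)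
    · intro hd'
      have := dvd_sub hd' h₁
      apply h.not_dvd_one
      have := dvd_sub h.dvd_three this
      convert this using 1; ring
    · have := dvd_add (hd.mul_left r₁) hr
      convert this using 1; ring
  have h2nd : l ^ 3 ∣ r₂ - 1 → l ^ 3 ∣ r₁ - 1 := by
    intro hd
    have := dvd_sub hr (hd.mul_left r₁)
    convert this using 1; ring
  have h3 := h.pow_three_dvd_three
  have hcases := digit_cases ha hb hc hmod
  rcases hcases with ⟨rfl, rfl, rfl⟩ | ⟨rfl, rfl, rfl⟩ | ⟨rfl, rfl, rfl⟩ | ⟨rfl, rfl, rfl⟩ |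
    ⟨rfl, rfl, rfl⟩ | ⟨rfl, rfl, rfl⟩ | ⟨rfl, rfl, rfl⟩ | ⟨rfl, rfl, rfl⟩ | ⟨rfl, rfl, rfl⟩
  · exact absurd (by simp) hprim
  · apply hsub; convert key using 1; push_cast; ring
  · apply hsub; rw [← dvd_neg]; convert key using 1; push_cast; ring
  · have := dvd_sub key h3
    convert this using 1; push_cast; ring
  · have := dvd_add key h3
    rw [← dvd_neg]
    convert this using 1; push_cast; ring
  · apply h2nd
    have := dvd_sub key h3
    convert this using 1; push_cast; ring
  · apply h2nd
    have := dvd_add key h3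
    rw [← dvd_neg]
    convert this using 1; push_cast; ring
  · exact h.unit_congr_of_units hκ h₁ h₂ hE (by simp) (by simp) (by simp)
  · refine h.unit_congr_of_units (X := -(((-1 : ℤ) : R) + l * x)) (Y := -(((-1 : ℤ) : R) + l * y))
      (Z := -(((1 : ℤ) : R) + l * z)) hκ h₁ h₂ ?_ ?_ ?_ ?_
    · linear_combination -hE
    · exact ⟨-x, by push_cast; ring⟩
    · exact ⟨-y, by push_cast; ring⟩
    · exact ⟨-z, by push_cast; ring⟩

/-- The coefficients of a solvable diagonal-plus-product cubic are `±1` modulo `l ^ 3`. -/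
theorem unit_congr (h : IsCubicUniformizer l) {r₁ r₂ κ X Y Z : R}
    (hκ : κ ^ 3 = r₁ * r₂) (h₁ : ¬ l ∣ r₁) (h₂ : ¬ l ∣ r₂)
    (hE : r₁ * X ^ 3 + r₂ * Y ^ 3 + 2 * Z ^ 3 + 3 * κ * X * Y * Z = 0)
    (hprim : ¬ (l ∣ X ∧ l ∣ Y ∧ l ∣ Z)) : l ^ 3 ∣ r₁ - 1 ∨ l ^ 3 ∣ r₁ + 1 := by
  have hneg : ∀ r : R, l ^ 3 ∣ -r - 1 ↔ l ^ 3 ∣ r + 1 := fun r => by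
    rw [← dvd_neg]; ring_nf
  have hneg1 : ∀ r : R, l ∣ -r - 1 ↔ l ∣ r + 1 := fun r => by
    rw [← dvd_neg]; ring_nf
  rcases (h.res r₁).resolve_left h₁ with k₁ | k₁ <;> rcases (h.res r₂).resolve_left h₂ with k₂ | k₂
  · exact .inl (h.unit_congr_aux hκ k₁ k₂ hE hprim)
  · refine .inl (h.unit_congr_aux (r₂ := -r₂) (κ := -κ) (Y := -Y) (X := X) (Z := Z) ?_ k₁
      ((hneg1 _).2 k₂) ?_ (by simpa using hprim))
    · linear_combination -hκ
    · linear_combination hE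
  · refine .inr ((hneg _).1 (h.unit_congr_aux (r₂ := r₂) (κ := -κ) (Y := Y) (X := -X) (Z := Z) ?_
      ((hneg1 _).2 k₁) k₂ ?_ (by simpa using hprim)))
    · linear_combination -hκ
    · linear_combination hE
  · refine .inr ((hneg _).1 (h.unit_congr_aux (r₂ := -r₂) (κ := κ) (Y := -Y) (X := -X) (Z := Z) ?_
      ((hneg1 _).2 k₁) ((hneg1 _).2 k₂) ?_ (by simpa using hprim)))
    · linear_combination hκ
    · linear_combination hE

theorem eq_one_of_cube_eq_one (h : IsCubicUniformizer l) {κ : R} (hκ : κ ^ 3 = 1) : κ = 1 := by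
  by_contra hne
  have hq : κ ^ 2 + κ + 1 = 0 := by
    apply mul_left_cancel₀ (sub_ne_zero.2 hne)
    linear_combination hκ
  obtain ⟨d, hd⟩ : l ∣ κ - 1 := by
    apply h.prime_dvd_pow (n := 3)
    have : (κ - 1) ^ 3 = 3 * (κ - κ ^ 2) := by linear_combination hκ
    rw [this]; exact h.dvd_three.mul_right _
  obtain rfl : κ = 1 + l * d := by linear_combination hd
  have h3 := h.three_eq
  obtain ⟨f, rfl⟩ : l ∣ d := by
    apply h.prime_dvd_pow (n := 2)
    refine ⟨-(-1 + 3 * l - l ^ 2) * (1 + l * d), ?_⟩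
    apply mul_left_cancel₀ (pow_ne_zero 2 h.ne_zero)
    linear_combination hq - (1 + l * d) * h3
  apply h.not_dvd_one
  refine ⟨3 - l + f ^ 2 + (-1 + 3 * l - l ^ 2) * l * f, ?_⟩
  apply mul_left_cancel₀ (pow_ne_zero 3 h.ne_zero)
  linear_combination (1 + l ^ 2 * f) * h3 - hq

/-- A primitive point of `x³ + y³ + 2z³ + 3xyz = 0` reduces to `±(1, -1, 0)` or `±(1, 1, -1)`. -/
theorem not_type_mixed (h : IsCubicUniformizer l) {x y z : R}
    (hE : x ^ 3 + y ^ 3 + 2 * z ^ 3 + 3 * x * y * z = 0)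
    (hx : l ∣ x - 1) (hy : l ∣ y) (hz : l ∣ z - 1) : False := by
  have h3 := h.three_eq
  obtain ⟨x', hx⟩ := hx
  obtain ⟨y', rfl⟩ := hy
  obtain ⟨z', hz⟩ := hz
  obtain ⟨a, a', ha, rfl⟩ := h.digit x'
  obtain ⟨b, b', hb, rfl⟩ := h.digit y'
  obtain ⟨c, c', hc, rfl⟩ := h.digit z'
  obtain rfl : x = 1 + l * (a + l * a') := by linear_combination hx
  obtain rfl : z = 1 + l * (c + l * c') := by linear_combination hz
  obtain ⟨qa, hqa⟩ := h.cube_expand ha a'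
  obtain ⟨qc, hqc⟩ := h.cube_expand hc c'
  obtain ⟨qb, hqb⟩ := h.pow_three_dvd_cube_sub hb b'
  obtain ⟨Q, hQ⟩ : ∃ Q, ((a + b + 2 * c - 1 : ℤ) : R) =
      l * ((a + b + 2 * c : ℤ) : R) + l ^ 2 * Q := by
    set ε : R := -1 + 3 * l - l ^ 2 with hε
    set V := a + l * a' + (c + l * c') + l * (a + l * a') * (c + l * c')
    refine ⟨-(qa + l * qb + 2 * qc + ε * (b' + (b + l * b') * V) + (3 - l) * b
      + l ^ 2 * ε - 1), ?_⟩
    push_cast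
    apply mul_left_cancel₀ (pow_ne_zero 3 h.ne_zero)
    linear_combination hE - hqa - l ^ 3 * hqb - 2 * hqc + (-1 - l ^ 4) * h3
      + (-l * (b + l * b') * (1 + l * V)) * h3
  have hd : (3 : ℤ) ∣ a + b + 2 * c - 1 := by
    apply h.three_dvd_of_dvd_intCast
    rw [hQ]; exact ⟨((a + b + 2 * c : ℤ) : R) + l * Q, by ring⟩
  obtain ⟨S, hS⟩ := h.pow_three_dvd_intCast hd
  have hd' : (3 : ℤ) ∣ a + b + 2 * c := by
    apply h.three_dvd_of_dvd_intCast
    refine ⟨l * S - Q, mul_left_cancel₀ h.ne_zero ?_⟩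
    linear_combination hS - hQ
  omega

end IsCubicUniformizer

namespace IsCubicUniformizer

variable {R : Type*} [CommRing R] {l : R}

theorem not_dvd_eps (h : IsCubicUniformizer l) : ¬ l ∣ -1 + 3 * l - l ^ 2 := fun hd => by
  apply h.not_dvd_one
  have := dvd_sub (dvd_mul_right l (3 - l)) hd
  convert this using 1; ring

variable [IsDomain R]

theorem type_cases (h : IsCubicUniformizer l) {x y z : R}
    (hE : x ^ 3 + y ^ 3 + 2 * z ^ 3 + 3 * x * y * z = 0)
    (hprim : ¬ (l ∣ x ∧ l ∣ y ∧ l ∣ z)) :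
    (l ∣ z ∧ ¬ l ∣ x ∧ l ∣ x + y) ∨ (l ∣ x + z ∧ l ∣ y + z ∧ ¬ l ∣ z) := by
  have hll : l ∣ l ^ 3 := dvd_pow_self l three_ne_zero
  obtain ⟨a, x', ha, hx⟩ := h.digit x
  obtain ⟨b, y', hb, hy⟩ := h.digit y
  obtain ⟨c, z', hc, hz⟩ := h.digit z
  have hmod : (3 : ℤ) ∣ a + b + 2 * c := by
    apply h.three_dvd_of_dvd_intCast
    have h1 := hll.trans (h.pow_three_dvd_cube_sub ha x')
    have h2 := hll.trans (h.pow_three_dvd_cube_sub hb y')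
    have h3 := (hll.trans (h.pow_three_dvd_cube_sub hc z')).mul_left 2
    have h4 := h.dvd_three.mul_right (x * y * z)
    rw [← dvd_neg]
    convert dvd_add (dvd_add (dvd_add h1 h2) h3) h4 using 1
    push_cast
    rw [← hx, ← hy, ← hz]
    linear_combination -hE
  have hnd : ∀ {e : ℤ} {d w : R}, w = e + l * d → (e = 1 ∨ e = -1) → ¬ l ∣ w := by
    rintro e d w rfl he hd
    have := h.three_dvd_of_dvd_intCast ((dvd_add_left (dvd_mul_right l d)).1 hd)
    omega
  have hE' : (-x) ^ 3 + (-y) ^ 3 + 2 * (-z) ^ 3 + 3 * (-x) * (-y) * (-z) = 0 := by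
    linear_combination -hE
  have hEs : y ^ 3 + x ^ 3 + 2 * z ^ 3 + 3 * y * x * z = 0 := by linear_combination hE
  have hEs' : (-y) ^ 3 + (-x) ^ 3 + 2 * (-z) ^ 3 + 3 * (-y) * (-x) * (-z) = 0 := by
    linear_combination -hE
  rcases digit_cases ha hb hc hmod with ⟨rfl, rfl, rfl⟩ | ⟨rfl, rfl, rfl⟩ | ⟨rfl, rfl, rfl⟩ |
    ⟨rfl, rfl, rfl⟩ | ⟨rfl, rfl, rfl⟩ | ⟨rfl, rfl, rfl⟩ | ⟨rfl, rfl, rfl⟩ | ⟨rfl, rfl, rfl⟩ |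
    ⟨rfl, rfl, rfl⟩
  · exact absurd ⟨⟨x', by simpa using hx⟩, ⟨y', by simpa using hy⟩, ⟨z', by simpa using hz⟩⟩ hprim
  · refine .inl ⟨⟨z', by simpa using hz⟩, hnd hx (.inl rfl), ⟨x' + y', ?_⟩⟩
    rw [hx, hy]; push_cast; ring
  · refine .inl ⟨⟨z', by simpa using hz⟩, hnd hx (.inr rfl), ⟨x' + y', ?_⟩⟩
    rw [hx, hy]; push_cast; ring
  · exact (h.not_type_mixed hE ⟨x', by simp [hx]⟩ ⟨y', by simpa using hy⟩ ⟨z', by simp [hz]⟩).elim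
  · exact (h.not_type_mixed hE' ⟨-x', by simp [hx]⟩ ⟨-y', by simpa using hy⟩
      ⟨-z', by simp [hz]⟩).elim
  · exact (h.not_type_mixed hEs ⟨y', by simp [hy]⟩ ⟨x', by simpa using hx⟩ ⟨z', by simp [hz]⟩).elim
  · exact (h.not_type_mixed hEs' ⟨-y', by simp [hy]⟩ ⟨-x', by simpa using hx⟩
      ⟨-z', by simp [hz]⟩).elim
  · refine .inr ⟨⟨x' + z', ?_⟩, ⟨y' + z', ?_⟩, hnd hz (.inr rfl)⟩
    · rw [hx, hz]; push_cast; ring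
    · rw [hy, hz]; push_cast; ring
  · refine .inr ⟨⟨x' + z', ?_⟩, ⟨y' + z', ?_⟩, hnd hz (.inl rfl)⟩
    · rw [hx, hz]; push_cast; ring
    · rw [hy, hz]; push_cast; ring

theorem eq_zero_of_parity (h : IsCubicUniformizer l) {w w' β γ : R} (hw : ¬ l ∣ w) (hw' : ¬ l ∣ w')
    (heq : w * (β + γ) ^ 2 = 3 * β * γ * w') : β = 0 ∧ γ = 0 := by
  have hε := h.not_dvd_eps
  have key : ∀ n : ℕ, ∀ β γ : R, w * (β + γ) ^ 2 = 3 * β * γ * w' → l ^ n ∣ β ∧ l ^ n ∣ γ := by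
    intro n
    induction n with
    | zero => simp
    | succ n ih =>
      intro β γ heq
      have h3 := h.three_eq
      obtain ⟨δ, hδ⟩ : l ∣ β + γ := by
        apply h.prime_dvd_pow (n := 2)
        apply (h.prime_dvd (x := w) _).resolve_left hw
        rw [heq]
        exact ((h.dvd_three.mul_right _).mul_right _).mul_right _
      rw [hδ] at heq
      have e1 : w * δ ^ 2 = l * ((-1 + 3 * l - l ^ 2) * β * γ * w') := by
        apply mul_left_cancel₀ (pow_ne_zero 2 h.ne_zero)
        linear_combination heq + β * γ * w' * h3
      obtain ⟨η, rfl⟩ : l ∣ δ := by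
        apply h.prime_dvd_pow (n := 2)
        exact (h.prime_dvd (x := w) ⟨_, e1⟩).resolve_left hw
      have e2 : l * (w * η ^ 2) = (-1 + 3 * l - l ^ 2) * w' * (β * γ) := by
        apply mul_left_cancel₀ h.ne_zero
        linear_combination e1
      have e3 : l ∣ β * γ := by
        refine (h.prime_dvd (x := (-1 + 3 * l - l ^ 2) * w') ⟨_, e2.symm⟩).resolve_left ?_
        exact fun hd => (h.prime_dvd hd).elim hε hw'
      have e4 : l ∣ β + γ := ⟨_, hδ⟩
      have e5 : l ∣ β ∧ l ∣ γ := by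
        rcases h.prime_dvd e3 with e | e
        · exact ⟨e, (dvd_add_right e).1 e4⟩
        · exact ⟨(dvd_add_left e).1 e4, e⟩
      obtain ⟨⟨β, rfl⟩, ⟨γ, rfl⟩⟩ := e5
      have hδ' : β + γ = l * η := by
        apply mul_left_cancel₀ h.ne_zero
        linear_combination hδ
      have := ih β γ (by
        rw [hδ']
        linear_combination l * e2 - β * γ * w' * h3)
      rw [pow_succ']
      exact ⟨mul_dvd_mul_left _ this.1, mul_dvd_mul_left _ this.2⟩
  constructor <;> by_contra h0 <;> obtain ⟨n, hn⟩ := h.exists_not_pow_dvd _ h0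
  · exact hn (key n β γ heq).1
  · exact hn (key n β γ heq).2

theorem three_ne_zero' (h : IsCubicUniformizer l) : (3 : R) ≠ 0 := fun h0 => by
  have := h.three_eq
  rw [h0] at this
  rcases mul_eq_zero.1 this.symm with h1 | h1
  · exact pow_ne_zero 3 h.ne_zero h1
  · apply h.not_dvd_one
    exact ⟨-l, by linear_combination -h1⟩

/-- The two-step descent map never sends a point reducing to `(1, 1, -1)` to one reducing to
`(1, -1, 0)`. -/
theorem typeII_image (h : IsCubicUniformizer l) {x z x₁ y₁ z₁ a b c : R}
    (ha : a = x₁ ^ 3) (hb : b = y₁ ^ 3) (hc : c = 2 * z₁ ^ 3)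
    (hx₁ : l ∣ x₁ + z₁) (hy₁ : l ∣ y₁ + z₁) (hz₁ : ¬ l ∣ z₁)
    (hx : ¬ l ∣ x) (hz : l ∣ z)
    (hcross : x * (x₁ * y₁ * z₁ * (a ^ 2 + b ^ 2 + c ^ 2 - a * b - b * c - c * a)) =
      z * (a ^ 2 * b + b ^ 2 * c + c ^ 2 * a - 3 * a * b * c)) :
    a ^ 2 * b + b ^ 2 * c + c ^ 2 * a - 3 * a * b * c = 0 := by
  have h3ne := h.three_ne_zero'
  have cube : ∀ u v : R, l ∣ u + v → ∃ k, u ^ 3 = -v ^ 3 + 3 * k := by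
    rintro u v ⟨d, hd⟩
    obtain rfl : u = -v + l * d := by linear_combination hd
    exact ⟨v ^ 2 * l * d - v * l ^ 2 * d ^ 2 + (l ^ 2 - 1) * d ^ 3,
      by linear_combination d ^ 3 * h.rel⟩
  obtain ⟨k, hk⟩ := cube _ _ hx₁
  obtain ⟨k', hk'⟩ := cube _ _ hy₁
  obtain ⟨β, hβ⟩ : ∃ β, b = a + 3 * β := ⟨k' - k, by rw [ha, hb, hk, hk']; ring⟩
  obtain ⟨γ, hγ⟩ : ∃ γ, c = a + 3 * γ := ⟨z₁ ^ 3 - k, by rw [ha, hc, hk]; ring⟩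
  have hp : ¬ l ∣ x₁ * y₁ * z₁ := fun hd => by
    rcases h.prime_dvd hd with hd | hd
    · rcases h.prime_dvd hd with hd | hd
      · exact hz₁ ((dvd_add_right hd).1 hx₁)
      · exact hz₁ ((dvd_add_right hd).1 hy₁)
    · exact hz₁ hd
  set p := x₁ * y₁ * z₁ with hpdef
  have hw : ¬ l ∣ x * p - z * a := fun hd => by
    have := (dvd_sub_left (hz.mul_right a)).1 hd
    exact (h.prime_dvd this).elim hx hp
  have hw' : ¬ l ∣ x * p - z * a + z * β := fun hd =>
    hw ((dvd_add_left (hz.mul_right β)).1 hd)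
  have heq : (x * p - z * a) * (β + γ) ^ 2 = 3 * β * γ * (x * p - z * a + z * β) := by
    rw [hβ, hγ] at hcross
    apply mul_left_cancel₀ (pow_ne_zero 2 h3ne)
    linear_combination hcross
  obtain ⟨rfl, rfl⟩ := h.eq_zero_of_parity hw hw' heq
  rw [hβ, hγ]; ring

/-- The descent map on `x³ + y³ + 2z³ + 3xyz = 0`: every point off `z = 0` is an image. -/
def HasDescent (R : Type*) [CommRing R] : Prop :=
  ∀ x y z : R, x ^ 3 + y ^ 3 + 2 * z ^ 3 + 3 * x * y * z = 0 → z ≠ 0 →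
    ∃ x₁ y₁ z₁ a b c s s' : R, a = x₁ ^ 3 ∧ b = y₁ ^ 3 ∧ c = 2 * z₁ ^ 3 ∧
      a + b + c + 3 * x₁ * y₁ * z₁ = 0 ∧ z₁ ≠ 0 ∧ s ≠ 0 ∧
      s * x = s' * (a ^ 2 * b + b ^ 2 * c + c ^ 2 * a - 3 * a * b * c) ∧
      s * z = s' * (x₁ * y₁ * z₁ * (a ^ 2 + b ^ 2 + c ^ 2 - a * b - b * c - c * a))

theorem typeO_z_eq_zero (h : IsCubicUniformizer l) (hD : HasDescent R) {x y z : R}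
    (hE : x ^ 3 + y ^ 3 + 2 * z ^ 3 + 3 * x * y * z = 0) (hz : l ∣ z) (hx : ¬ l ∣ x) : z = 0 := by
  have key : ∀ (n : ℕ) (x y z : R), x ^ 3 + y ^ 3 + 2 * z ^ 3 + 3 * x * y * z = 0 → l ∣ z →
      ¬ l ∣ x → l ^ n ∣ z := by
    intro n
    induction n with
    | zero => simp
    | succ n ih =>
      intro x y z hE hz hx
      by_cases hz0 : z = 0
      · simp [hz0]
      obtain ⟨x₁, y₁, z₁, a, b, c, s, s', ha, hb, hc, hE₁, hz₁, hs, hsx, hsz⟩ := hD x y z hE hz0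
      obtain ⟨m, x₂, y₂, z₂, rfl, rfl, rfl, hprim⟩ :=
        h.exists_primitive (x := x₁) (y := y₁) (z := z₁) (fun hh => hz₁ hh.2.2)
      have hlm : l ^ m ≠ 0 := pow_ne_zero _ h.ne_zero
      obtain ⟨a', ha'⟩ : ∃ a', a' = x₂ ^ 3 := ⟨_, rfl⟩
      obtain ⟨b', hb'⟩ : ∃ b', b' = y₂ ^ 3 := ⟨_, rfl⟩
      obtain ⟨c', hc'⟩ : ∃ c', c' = 2 * z₂ ^ 3 := ⟨_, rfl⟩
      obtain rfl : a = (l ^ m) ^ 3 * a' := by rw [ha, ha']; ring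
      obtain rfl : b = (l ^ m) ^ 3 * b' := by rw [hb, hb']; ring
      obtain rfl : c = (l ^ m) ^ 3 * c' := by rw [hc, hc']; ring
      have hE₂ : a' + b' + c' + 3 * x₂ * y₂ * z₂ = 0 := by
        apply mul_left_cancel₀ (pow_ne_zero 3 hlm)
        linear_combination hE₁
      set t := s' * (l ^ m) ^ 9 with ht
      have hsx' : s * x = t * (a' ^ 2 * b' + b' ^ 2 * c' + c' ^ 2 * a' - 3 * a' * b' * c') := by
        rw [hsx, ht]; ring
      have hsz' : s * z = t * (x₂ * y₂ * z₂ *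
          (a' ^ 2 + b' ^ 2 + c' ^ 2 - a' * b' - b' * c' - c' * a')) := by
        rw [hsz, ht]; ring
      have hx0 : x ≠ 0 := by rintro rfl; simp at hx
      have hsx0 : s * x ≠ 0 := mul_ne_zero hs hx0
      have ht0 : t ≠ 0 := by
        intro h0; rw [h0, zero_mul] at hsx'; exact hsx0 hsx'
      have hcross : x * (x₂ * y₂ * z₂ * (a' ^ 2 + b' ^ 2 + c' ^ 2 - a' * b' - b' * c' - c' * a')) =
          z * (a' ^ 2 * b' + b' ^ 2 * c' + c' ^ 2 * a' - 3 * a' * b' * c') := by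
        apply mul_left_cancel₀ ht0
        linear_combination z * hsx' - x * hsz'
      have hX0 : a' ^ 2 * b' + b' ^ 2 * c' + c' ^ 2 * a' - 3 * a' * b' * c' ≠ 0 := by
        intro h0; rw [h0, mul_zero] at hsx'; exact hsx0 hsx'
      have hE₃ : x₂ ^ 3 + y₂ ^ 3 + 2 * z₂ ^ 3 + 3 * x₂ * y₂ * z₂ = 0 := by
        rw [← ha', ← hb', ← hc', hE₂]
      rcases h.type_cases hE₃ hprim with ⟨t1, t2, t3⟩ | ⟨t1, t2, t3⟩
      · obtain ⟨z₃, hz₃⟩ := ih x₂ y₂ z₂ hE₃ t1 t2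
        have hlc : l ∣ c' := by rw [hc']; exact (dvd_pow t1 three_ne_zero).mul_left _
        have hy₂ : ¬ l ∣ y₂ := fun hd => t2 ((dvd_add_left hd).1 t3)
        have hab : l ∣ a' + b' := by
          rw [ha', hb']
          have : x₂ ^ 3 + y₂ ^ 3 = (x₂ + y₂) * (x₂ ^ 2 - x₂ * y₂ + y₂ ^ 2) := by ring
          rw [this]; exact t3.mul_right _
        obtain ⟨q, hq⟩ : l ∣ a' ^ 2 + b' ^ 2 + c' ^ 2 - a' * b' - b' * c' - c' * a' := by
          have : a' ^ 2 + b' ^ 2 + c' ^ 2 - a' * b' - b' * c' - c' * a' =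
            (a' + b') * (a' + b') + c' * (c' - b' - a') - 3 * (a' * b') := by ring
          rw [this]
          exact dvd_sub (dvd_add (hab.mul_right _) (hlc.mul_right _)) (h.dvd_three.mul_right _)
        apply h.pow_dvd_of_pow_dvd_mul (u := a' ^ 2 * b' + b' ^ 2 * c' + c' ^ 2 * a' - 3 * a' * b' * c')
        · intro hd
          have e1 : a' ^ 2 * b' = (a' ^ 2 * b' + b' ^ 2 * c' + c' ^ 2 * a' - 3 * a' * b' * c')
            - c' * (b' ^ 2 + c' * a' - 3 * a' * b') := by ring
          have e2 : l ∣ a' ^ 2 * b' := by rw [e1]; exact dvd_sub hd (hlc.mul_right _)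
          rcases h.prime_dvd e2 with e | e
          · rw [ha'] at e; exact t2 (h.prime_dvd_pow (h.prime_dvd_pow e))
          · rw [hb'] at e; exact hy₂ (h.prime_dvd_pow e)
        · rw [hq, hz₃] at hcross
          refine ⟨x * (x₂ * y₂ * z₃ * q), ?_⟩
          rw [mul_comm, ← hcross]; ring
      · exact absurd (h.typeII_image ha' hb' hc' t1 t2 t3 hx hz hcross) hX0
  by_contra h0
  obtain ⟨n, hn⟩ := h.exists_not_pow_dvd _ h0
  exact hn (key n x y z hE hz hx)

end IsCubicUniformizer

namespace IsCubicUniformizer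

variable {R : Type*} [CommRing R] [IsDomain R] {l : R}

theorem cube_inj (h : IsCubicUniformizer l) {u v : R} (hv : ¬ l ∣ v) (huv : u ^ 3 = v ^ 3) :
    u = v := by
  by_contra hne
  have hq : u ^ 2 + u * v + v ^ 2 = 0 := by
    apply mul_left_cancel₀ (sub_ne_zero.2 hne)
    linear_combination huv
  obtain ⟨d, hd⟩ : l ∣ u - v := by
    apply h.prime_dvd_pow (n := 3)
    have : (u - v) ^ 3 = 3 * (u * v ^ 2 - u ^ 2 * v) := by linear_combination huv
    rw [this]; exact h.dvd_three.mul_right _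
  obtain rfl : u = v + l * d := by linear_combination hd
  have h3 := h.three_eq
  obtain ⟨f, rfl⟩ : l ∣ d := by
    apply h.prime_dvd_pow (n := 2)
    refine ⟨-(-1 + 3 * l - l ^ 2) * (v ^ 2 + l * d * v), ?_⟩
    apply mul_left_cancel₀ (pow_ne_zero 2 h.ne_zero)
    linear_combination hq - (v ^ 2 + l * d * v) * h3
  apply hv
  apply h.prime_dvd_pow (n := 2)
  refine ⟨(3 - l) * v ^ 2 + f ^ 2 + (-1 + 3 * l - l ^ 2) * l * f * v, ?_⟩
  apply mul_left_cancel₀ (pow_ne_zero 3 h.ne_zero)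
  linear_combination (v ^ 2 + l ^ 2 * f * v) * h3 - hq

/-- A point in the same residue disc as the torsion point `(1, 1 - l, -1)` equals it. -/
theorem eq_torsion (h : IsCubicUniformizer l) (hD : HasDescent R) {x y z : R}
    (hE : x ^ 3 + y ^ 3 + 2 * z ^ 3 + 3 * x * y * z = 0) (hz : ¬ l ∣ z)
    (hx : l ^ 2 ∣ x + z) (hxy : l ^ 3 ∣ x + y + 2 * z - l * z) : x = -z ∧ y = (l - 1) * z := by
  obtain ⟨X, hX⟩ := hx
  obtain ⟨s, hs⟩ := hxy
  have h3 := h.three_eq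
  set ε : R := -1 + 3 * l - l ^ 2 with hε
  have hεu : ε * (l ^ 2 - 1) = 1 := by rw [hε]; linear_combination -l * h.rel
  obtain rfl : x = -z + l ^ 2 * X := by linear_combination hX
  obtain ⟨Y, hY⟩ : ∃ Y, Y = l * s - X := ⟨_, rfl⟩
  obtain rfl : y = -z + l * z + l ^ 2 * Y := by linear_combination hs - l ^ 2 * hY
  have hsig : X + Y = l * s := by linear_combination hY
  have hcurve : (z + l ^ 2 * (s - ε * z)) * ((z + l ^ 2 * s) ^ 2 - 3 * l * X * (z + l * Y))
      + ε * z ^ 3 = 0 := by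
    have h0 : (l * X + (z + l * Y) - l ^ 2 * ε * z) *
        ((l * X + (z + l * Y)) ^ 2 - 3 * (l * X) * (z + l * Y)) + ε * z ^ 3 = 0 := by
      apply mul_left_cancel₀ (pow_ne_zero 3 h.ne_zero)
      linear_combination hE - (-z * l ^ 2 * ((l * X + (z + l * Y)) ^ 2 -
        3 * (l * X) * (z + l * Y)) + z ^ 3) * h3
    have h1 : l * X + (z + l * Y) = z + l ^ 2 * s := by linear_combination l * hsig
    rw [h1] at h0
    linear_combination h0
  have hXs : l ∣ X + 2 * s := by
    have e1 : ε * z ^ 2 * (X + 2 * s) = l * (ε * z ^ 2 * s + l ^ 2 * ε * z * s ^ 2 - ε * X * Y * z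
        + l * (s - ε * z) * s ^ 2 - l * (s - ε * z) * ε * X * (z + l * Y)) := by
      apply mul_left_cancel₀ (pow_ne_zero 4 h.ne_zero)
      linear_combination -hcurve - z ^ 3 * hεu + (l ^ 2 * z ^ 2 * s + l ^ 4 * z * s ^ 2
        - (z + l ^ 2 * (s - ε * z)) * l * X * (z + l * Y)) * h3
    rcases h.prime_dvd ⟨_, e1⟩ with e | e
    · exact ((h.prime_dvd e).elim h.not_dvd_eps (fun e => hz (h.prime_dvd_pow e))).elim
    · exact e
  -- the third point on the line through `(x, y, z)` and `(-θ, 1, -1)`, divided by `l ^ 4`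
  set β := ε * z + l * s - 3 * X + l * X with hβ
  set ρ := z * (2 * s + X) + l ^ 2 * s ^ 2 - 3 * X * Y - l ^ 2 * ε * z * X - l * X ^ 2 with hρ
  have hβu : ¬ l ∣ β := fun hd => by
    have : ε * z = β - l * (s + X) + 3 * X := by rw [hβ]; ring
    have h1 : l ∣ ε * z := by
      rw [this]; exact dvd_add (dvd_sub hd (dvd_mul_right _ _)) (h.dvd_three.mul_right _)
    exact (h.prime_dvd h1).elim h.not_dvd_eps hz
  have hρl : l ∣ ρ := by
    have : ρ = (X + 2 * s) * z + l * (l * s ^ 2 - l * ε * z * X - X ^ 2) - 3 * (X * Y) := by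
      rw [hρ]; ring
    rw [this]
    exact dvd_sub (dvd_add (hXs.mul_right _) (dvd_mul_right _ _)) (h.dvd_three.mul_right _)
  have hB : ((l - 1) ^ 2 - 1) * (-z + l ^ 2 * X) + l * (-z + l * z + l ^ 2 * Y) + (3 - l) * z
      = l ^ 3 * β := by
    rw [hβ]; linear_combination l ^ 3 * hsig + z * h3
  have hA : -(l - 1) * ((-z + l ^ 2 * X) ^ 2 + (-z + l * z + l ^ 2 * Y) * z)
      + ((-z + l * z + l ^ 2 * Y) ^ 2 + (-z + l ^ 2 * X) * z)
      - (2 * z ^ 2 + (-z + l ^ 2 * X) * (-z + l * z + l ^ 2 * Y)) = l ^ 4 * ρ - l ^ 3 * β * z := by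
    rw [hρ, hβ]
    linear_combination (l ^ 3 * z + l ^ 4 * (X + Y + l * s)) * hsig - (z ^ 2 + l ^ 3 * X * z) * h3
  have hR : (β * (-z + l * X) + (l - 1) * ρ) ^ 3 + (β * (z + l * Y) - ρ) ^ 3 + 2 * ρ ^ 3
      + 3 * (β * (-z + l * X) + (l - 1) * ρ) * (β * (z + l * Y) - ρ) * ρ = 0 := by
    have hcol : ∀ x y z θ B A : R, θ ^ 3 = 3 * θ - 1 →
        x ^ 3 + y ^ 3 + 2 * z ^ 3 + 3 * x * y * z = 0 →
        (θ ^ 2 - 1) * x + (1 + θ) * y + (2 - θ) * z = B →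
        -θ * (x ^ 2 + y * z) + (y ^ 2 + x * z) - (2 * z ^ 2 + x * y) = A →
        (B * x + θ * A) ^ 3 + (B * y - A) ^ 3 + 2 * (B * z + A) ^ 3
          + 3 * (B * x + θ * A) * (B * y - A) * (B * z + A) = 0 := by
      intro x y z θ B A hθ hE hB hA
      linear_combination B ^ 3 * hE + A ^ 3 * hθ - 3 * B ^ 2 * A * hA + 3 * B * A ^ 2 * hB
    have := hcol (-z + l ^ 2 * X) (-z + l * z + l ^ 2 * Y) z (l - 1) (l ^ 3 * β)
      (l ^ 4 * ρ - l ^ 3 * β * z) (by linear_combination h.rel) hE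
      (by linear_combination hB) (by linear_combination hA)
    clear_value β ρ
    have e₁ : l ^ 3 * β * (-z + l ^ 2 * X) + (l - 1) * (l ^ 4 * ρ - l ^ 3 * β * z) =
        l ^ 4 * (β * (-z + l * X) + (l - 1) * ρ) := by ring
    have e₂ : l ^ 3 * β * (-z + l * z + l ^ 2 * Y) - (l ^ 4 * ρ - l ^ 3 * β * z) =
        l ^ 4 * (β * (z + l * Y) - ρ) := by ring
    have e₃ : l ^ 3 * β * z + (l ^ 4 * ρ - l ^ 3 * β * z) = l ^ 4 * ρ := by ring
    rw [e₁, e₂, e₃] at this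
    generalize β * (-z + l * X) + (l - 1) * ρ = x' at this ⊢
    generalize β * (z + l * Y) - ρ = y' at this ⊢
    apply mul_left_cancel₀ (pow_ne_zero 12 h.ne_zero)
    linear_combination this
  have hfirst : ¬ l ∣ β * (-z + l * X) + (l - 1) * ρ := fun hd => by
    have h1 := (dvd_add_left (hρl.mul_left _)).1 hd
    rcases h.prime_dvd h1 with e | e
    · exact hβu e
    · exact hz (by simpa using (dvd_add_left (dvd_mul_right l X)).1 e)
  have hρ0 : ρ = 0 := h.typeO_z_eq_zero hD hR hρl hfirst
  have hβ0 : β ≠ 0 := by rintro h0; simp [h0] at hβu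
  have hzl : ¬ l ∣ -(z + l * Y) := fun hd => by
    rw [dvd_neg] at hd
    exact hz ((dvd_add_left (dvd_mul_right l Y)).1 hd)
  have hcub : -z + l * X = -(z + l * Y) := by
    apply h.cube_inj hzl
    apply mul_left_cancel₀ (pow_ne_zero 3 hβ0)
    rw [hρ0] at hR
    linear_combination hR
  have hXY : Y = -X := by
    apply mul_left_cancel₀ h.ne_zero
    linear_combination hcub
  have hs0 : s = 0 := by
    apply mul_left_cancel₀ h.ne_zero
    rw [← hsig, hXY]; ring
  have hX0 : X = 0 := by
    rw [hρ0, hs0, hXY] at hρ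
    have h1 : X * (z + l * (l ^ 2 * ε * X - l * ε * z - X) ) = 0 := by
      linear_combination -hρ - X ^ 2 * h3
    refine (mul_eq_zero.1 h1).resolve_right fun h2 => hz ?_
    have : z = -(l * (l ^ 2 * ε * X - l * ε * z - X)) := by linear_combination h2
    rw [this, dvd_neg]; exact dvd_mul_right _ _
  rw [hXY, hX0]
  constructor <;> ring

/-- Replacing `l` by a conjugate. -/
theorem of_unit_mul (h : IsCubicUniformizer l) {v w : R} (hvw : v * w = 1)
    (hrel : (l * v) ^ 3 = 3 * ((l * v) ^ 2 - 1)) : IsCubicUniformizer (l * v) := by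
  have hu : IsUnit v := IsUnit.of_mul_eq_one _ hvw
  refine ⟨hrel, fun x => ?_, mul_ne_zero h.ne_zero hu.ne_zero, ?_, fun x hx => ?_⟩
  · simpa [hu.mul_right_dvd] using h.res x
  · simpa [hu.mul_right_dvd] using h.not_dvd_one
  · obtain ⟨n, hn⟩ := h.exists_not_pow_dvd x hx
    exact ⟨n, by rwa [mul_pow, (hu.pow n).mul_right_dvd]⟩

theorem typeII_aux (h : IsCubicUniformizer l) (hD : HasDescent R) {x y z σ X : R}
    (hE : x ^ 3 + y ^ 3 + 2 * z ^ 3 + 3 * x * y * z = 0) (hz : ¬ l ∣ z)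
    (hx : x = -z + l * X) (hX : l ∣ X) (hσ : x + y + 2 * z = l * z + l ^ 2 * σ) :
    x = -z ∧ (y = (l - 1) * z ∨ y = (l ^ 2 - 2 * l - 1) * z ∨ y = (2 + l - l ^ 2) * z) := by
  have h3 := h.three_eq
  set ε : R := -1 + 3 * l - l ^ 2 with hε
  have hx2 : l ^ 2 ∣ x + z := by
    obtain ⟨X, rfl⟩ := hX
    exact ⟨X, by rw [hx]; ring⟩
  rcases h.res_mul hz σ with ⟨τ, hτ⟩ | ⟨τ, hτ⟩ | ⟨τ, hτ⟩
  · obtain ⟨e1, e2⟩ := h.eq_torsion hD hE hz hx2 ⟨τ, by rw [hσ, hτ]; ring⟩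
    exact ⟨e1, .inl e2⟩
  · have hv : (l - 2) * ((l + 1) * (l - 2)) = 1 := by linear_combination h.rel
    have hu : IsUnit (l - 2) := IsUnit.of_mul_eq_one _ hv
    have h' := h.of_unit_mul hv (by
      linear_combination (l ^ 3 - 3 * l ^ 2 + 1) * h.rel)
    obtain ⟨e1, e2⟩ := h'.eq_torsion hD hE (by rwa [hu.mul_right_dvd])
      (by rwa [mul_pow, (hu.pow 2).mul_right_dvd]) (by
        rw [mul_pow, (hu.pow 3).mul_right_dvd]
        exact ⟨τ + l * ε * z, by linear_combination hσ + l ^ 2 * hτ + l * z * h3⟩)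
    exact ⟨e1, .inr (.inl (by rw [e2]; ring))⟩
  · have hv : (1 - l + l ^ 2 * ε) * (-(l - 2) * (l ^ 2 - 1)) = 1 := by
      rw [hε]; linear_combination (l ^ 4 - 2 * l ^ 3 + l - 1) * h.rel
    have hu : IsUnit (1 - l + l ^ 2 * ε) := IsUnit.of_mul_eq_one _ hv
    have hl4 : l * (1 - l + l ^ 2 * ε) = 3 + l - l ^ 2 := by linear_combination -h3
    have h' := h.of_unit_mul hv (by
      rw [hl4]
      linear_combination (-l ^ 3 + 3 * l + 1) * h.rel)
    obtain ⟨e1, e2⟩ := h'.eq_torsion hD hE (by rwa [hu.mul_right_dvd])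
      (by rwa [mul_pow, (hu.pow 2).mul_right_dvd]) (by
        rw [mul_pow, (hu.pow 3).mul_right_dvd, hl4]
        exact ⟨τ - ε * z, by linear_combination hσ + l ^ 2 * hτ - z * h3⟩)
    rw [hl4] at e2
    exact ⟨e1, .inr (.inr (by rw [e2]; ring))⟩

end IsCubicUniformizer

namespace IsCubicUniformizer

variable {R : Type*} [CommRing R] [IsDomain R] {l : R}

/-- `θ` is one of the three conjugates of `l - 1`. -/
def IsConj (l θ : R) : Prop :=
  θ = l - 1 ∨ θ = l ^ 2 - 2 * l - 1 ∨ θ = 2 + l - l ^ 2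

theorem typeII_cases (h : IsCubicUniformizer l) (hD : HasDescent R) {x y z : R}
    (hE : x ^ 3 + y ^ 3 + 2 * z ^ 3 + 3 * x * y * z = 0) (hx : l ∣ x + z) (hy : l ∣ y + z)
    (hz : ¬ l ∣ z) :
    (x = -z ∧ ∃ θ, IsConj l θ ∧ y = θ * z) ∨ (y = -z ∧ ∃ θ, IsConj l θ ∧ x = θ * z) := by
  obtain ⟨X, hX⟩ := hx
  obtain ⟨Y, hY⟩ := hy
  have hx : x = -z + l * X := by linear_combination hX
  have hy : y = -z + l * Y := by linear_combination hY
  have h3 := h.three_eq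
  obtain ⟨ε, hε⟩ : ∃ ε : R, ε = -1 + 3 * l - l ^ 2 := ⟨_, rfl⟩
  have hεl : ¬ l ∣ ε := hε ▸ h.not_dvd_eps
  rw [← hε] at h3
  have hεu : ε * (l ^ 2 - 1) = 1 := by rw [hε]; linear_combination -l * h.rel
  have hG : (X + Y - l ^ 2 * ε * z) * ((X + Y) ^ 2 - 3 * (X * Y)) + ε * z ^ 3 = 0 := by
    apply mul_left_cancel₀ (pow_ne_zero 3 h.ne_zero)
    rw [hx, hy] at hE
    linear_combination hE - (-z * l ^ 2 * ((X + Y) ^ 2 - 3 * (X * Y)) + z ^ 3) * h3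
  obtain ⟨m, hm⟩ := h.dvd_three
  obtain ⟨σ, hσ⟩ : l ∣ X + Y - z := by
    apply h.prime_dvd_pow (n := 3)
    refine ⟨m * (X * Y * (X + Y)) + l * ε * z * ((X + Y) ^ 2 - 3 * (X * Y)) - (3 - l) * z ^ 3
      - m * ((X + Y) ^ 2 * z) + m * ((X + Y) * z ^ 2), ?_⟩
    linear_combination hG + (X * Y * (X + Y) - (X + Y) ^ 2 * z + (X + Y) * z ^ 2) * hm - z ^ 3 * hε
  have hS : X + Y = z + l * σ := by linear_combination hσ
  have hF : σ ^ 3 + 2 * z ^ 2 * σ + ε ^ 2 * (X * Y * z) = l * (-ε * z ^ 2 * σ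
      + 2 * l * ε * z ^ 2 * σ - l * ε * z * σ ^ 2 * (1 - l) - z * σ ^ 2 + ε * (X * Y) * σ) := by
    apply mul_left_cancel₀ (pow_ne_zero 3 h.ne_zero)
    rw [hS] at hG
    generalize X * Y = P at hG ⊢
    linear_combination hG + z * ((z + l * σ) ^ 2 - 3 * P) * hεu
      + (2 * l * σ * z ^ 2 + l ^ 2 * σ ^ 2 * z) * hε + (-l * σ * z ^ 2 + 2 * l ^ 2 * σ * z ^ 2
      - l ^ 2 * σ ^ 2 * z * (1 - l) + l * σ * P - z * ε * P) * h3
  have hXY : l ∣ X ∨ l ∣ Y := by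
    have h1 : l ∣ σ ^ 3 + 2 * z ^ 2 * σ := by
      have : σ ^ 3 + 2 * z ^ 2 * σ = σ * (σ - z) * (σ + z) + 3 * (z ^ 2 * σ) := by ring
      rw [this]
      refine dvd_add ?_ (h.dvd_three.mul_right _)
      rcases h.res_mul hz σ with k | k | k
      · exact (k.mul_right _).mul_right _
      · exact (k.mul_left _).mul_right _
      · exact k.mul_left _
    have h2 := (dvd_add_right h1).1 ⟨_, hF⟩
    rcases h.prime_dvd h2 with k | k
    · exact absurd (h.prime_dvd_pow k) hεl
    · exact h.prime_dvd ((h.prime_dvd k).resolve_right hz)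
  have hsum : x + y + 2 * z = l * z + l ^ 2 * σ := by
    rw [hx, hy]; linear_combination l * hS
  have key : ∀ y : R, (y = (l - 1) * z ∨ y = (l ^ 2 - 2 * l - 1) * z ∨ y = (2 + l - l ^ 2) * z) →
      ∃ θ, IsConj l θ ∧ y = θ * z := by
    rintro y (k | k | k)
    exacts [⟨_, .inl rfl, k⟩, ⟨_, .inr (.inl rfl), k⟩, ⟨_, .inr (.inr rfl), k⟩]
  rcases hXY with hd | hd
  · obtain ⟨e1, e2⟩ := h.typeII_aux hD hE hz hx hd hsum
    exact .inl ⟨e1, key _ e2⟩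
  · obtain ⟨e1, e2⟩ := h.typeII_aux hD (x := y) (y := x) (σ := σ) (by linear_combination hE) hz hy hd
      (by linear_combination hsum)
    exact .inr ⟨e1, key _ e2⟩

theorem classify (h : IsCubicUniformizer l) (hD : HasDescent R) {x y z : R}
    (hE : x ^ 3 + y ^ 3 + 2 * z ^ 3 + 3 * x * y * z = 0) :
    (z = 0 ∧ x = -y) ∨ (x = -z ∧ ∃ θ, IsConj l θ ∧ y = θ * z) ∨
      (y = -z ∧ ∃ θ, IsConj l θ ∧ x = θ * z) := by
  by_cases hne : x = 0 ∧ y = 0 ∧ z = 0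
  · exact .inl ⟨hne.2.2, by rw [hne.1, hne.2.1, neg_zero]⟩
  obtain ⟨n, x, y, z, rfl, rfl, rfl, hprim⟩ := h.exists_primitive hne
  have hE' : x ^ 3 + y ^ 3 + 2 * z ^ 3 + 3 * x * y * z = 0 := by
    apply mul_left_cancel₀ (pow_ne_zero 3 (pow_ne_zero n h.ne_zero))
    linear_combination hE
  rcases h.type_cases hE' hprim with ⟨hz, hx, hxy⟩ | ⟨hx, hy, hz⟩
  · have hz0 := h.typeO_z_eq_zero hD hE' hz hx
    have hy : ¬ l ∣ -y := fun hy => hx ((dvd_add_left ((dvd_neg).1 hy)).1 hxy)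
    have : x = -y := h.cube_inj hy (by rw [hz0] at hE'; linear_combination hE')
    left
    rw [hz0, this]
    constructor <;> ring
  · right
    rcases h.typeII_cases hD hE' hx hy hz with ⟨k, θ, hθ, k'⟩ | ⟨k, θ, hθ, k'⟩
    · exact .inl ⟨by rw [k]; ring, θ, hθ, by rw [k']; ring⟩
    · exact .inr ⟨by rw [k]; ring, θ, hθ, by rw [k']; ring⟩

end IsCubicUniformizer

namespace IsCubicUniformizer

variable {R : Type*} [CommRing R] [IsDomain R] {l : R}

theorem dvd_coeffs (h : IsCubicUniformizer l) {a b c : ℤ} {q : R}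
    (hd : l ^ 3 ∣ a + b * l + c * l ^ 2 + l ^ 3 * q) : 3 ∣ a ∧ 3 ∣ b ∧ 3 ∣ c := by
  have hl := h.ne_zero
  obtain ⟨k, hk⟩ := hd
  have ha : (3 : ℤ) ∣ a := h.three_dvd_of_dvd_intCast ⟨l ^ 2 * k - b - c * l - l ^ 2 * q,
    by linear_combination hk⟩
  obtain ⟨a', ha'⟩ := h.pow_three_dvd_intCast ha
  have hb : (3 : ℤ) ∣ b := h.three_dvd_of_dvd_intCast ⟨l * k - l * a' - c - l * q, by
    apply mul_left_cancel₀ hl; linear_combination hk - ha'⟩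
  obtain ⟨b', hb'⟩ := h.pow_three_dvd_intCast hb
  refine ⟨ha, hb, h.three_dvd_of_dvd_intCast ⟨k - a' - l * b' - q, ?_⟩⟩
  apply mul_left_cancel₀ (pow_ne_zero 2 hl)
  linear_combination -ha' - l * hb' + hk

/-- The units `l - 1` and `l ^ 2 - 2 * l - 1` are independent modulo cubes. -/
theorem unit_exponents (h : IsCubicUniformizer l) {i j : ℕ} (hi : i < 3) (hj : j < 3)
    (hd : l ^ 3 ∣ (l - 1) ^ i * (l ^ 2 - 2 * l - 1) ^ j - 1 ∨
      l ^ 3 ∣ (l - 1) ^ i * (l ^ 2 - 2 * l - 1) ^ j + 1) : i = 0 ∧ j = 0 := by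
  obtain ⟨s, hs⟩ : ∃ s : ℤ, l ^ 3 ∣ (l - 1) ^ i * (l ^ 2 - 2 * l - 1) ^ j - s := by
    rcases hd with k | k
    · exact ⟨1, by simpa using k⟩
    · exact ⟨-1, by simpa using k⟩
  have key : ∀ (a b c : ℤ) (q : R), (l - 1) ^ i * (l ^ 2 - 2 * l - 1) ^ j =
      a + b * l + c * l ^ 2 + l ^ 3 * q → 3 ∣ a - s ∧ 3 ∣ b ∧ 3 ∣ c := fun a b c q e =>
    h.dvd_coeffs (q := q) (by
      push_cast; convert hs using 1; rw [e]; ring)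
  interval_cases i <;> interval_cases j
  · simp
  · obtain ⟨h0, h1, h2⟩ := key (-1) (-2) (1) (0) (by ring)
    omega
  · obtain ⟨h0, h1, h2⟩ := key (1) (4) (2) ((-4) + 1 * l ^ 1) (by ring)
    omega
  · obtain ⟨h0, h1, h2⟩ := key (-1) (1) (0) (0) (by ring)
    omega
  · obtain ⟨h0, h1, h2⟩ := key (1) (1) (-3) ((1)) (by ring)
    omega
  · obtain ⟨h0, h1, h2⟩ := key (-1) (-3) (2) ((6) + -5 * l ^ 1 + 1 * l ^ 2) (by ring)
    omega
  · obtain ⟨h0, h1, h2⟩ := key (1) (-2) (1) (0) (by ring)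
    omega
  · obtain ⟨h0, h1, h2⟩ := key (-1) (0) (4) ((-4) + 1 * l ^ 1) (by ring)
    omega
  · obtain ⟨h0, h1, h2⟩ := key (1) (2) (-5) ((-4) + 11 * l ^ 1 + -6 * l ^ 2 + 1 * l ^ 3) (by ring)
    omega

/-- The twisted norm form with a nontrivial root of unity is anisotropic. -/
theorem twisted_eq_zero (h : IsCubicUniformizer l) {A B H : R}
    (hEq : 3 * H ^ 3 - 3 * H * (A ^ 2 + (l - 1) * A * B + B ^ 2) = A ^ 3 * (l - 1)
      + 3 * A ^ 2 * B * (l ^ 2 - 2 * l - 1) - 3 * A * B ^ 2 + B ^ 3 * (2 + l - l ^ 2)) :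
    A = 0 ∧ B = 0 ∧ H = 0 := by
  by_contra hne
  obtain ⟨n, A, B, H, rfl, rfl, rfl, hprim⟩ := h.exists_primitive hne
  have hl := h.ne_zero
  replace hEq : 3 * H ^ 3 - 3 * H * (A ^ 2 + (l - 1) * A * B + B ^ 2) = A ^ 3 * (l - 1)
      + 3 * A ^ 2 * B * (l ^ 2 - 2 * l - 1) - 3 * A * B ^ 2 + B ^ 3 * (2 + l - l ^ 2) := by
    apply mul_left_cancel₀ (pow_ne_zero 3 (pow_ne_zero n hl))
    linear_combination hEq
  clear hne
  have h3 := h.three_eq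
  obtain ⟨ε, hε⟩ : ∃ ε : R, ε = -1 + 3 * l - l ^ 2 := ⟨_, rfl⟩
  rw [← hε] at h3
  have cube : ∀ x : R, ∃ (e : ℤ) (d p : R), (e = 0 ∨ e = 1 ∨ e = -1) ∧ x = e + l * d ∧
      x ^ 3 = e + l ^ 3 * p := fun x => by
    obtain ⟨e, d, he, rfl⟩ := h.digit x
    obtain ⟨p, hp⟩ := h.pow_three_dvd_cube_sub he d
    exact ⟨e, d, p, he, rfl, by linear_combination hp⟩
  have hAB : l ∣ A ∧ l ∣ B := by
    obtain ⟨e, A', p, he, hA, hA3⟩ := cube A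
    obtain ⟨f, B', q, hf, hB, hB3⟩ := cube B
    obtain ⟨k1, k2, k3⟩ := h.dvd_coeffs (a := -e + 2 * f) (b := e + f) (c := -f) (q := 0) (l := l) (by
      refine ⟨ε * (H ^ 3 - H * (A ^ 2 + (l - 1) * A * B + B ^ 2)
        - A ^ 2 * B * (l ^ 2 - 2 * l - 1) + A * B ^ 2) - p * (l - 1) - q * (2 + l - l ^ 2), ?_⟩
      push_cast
      linear_combination -hEq - (l - 1) * hA3 - (2 + l - l ^ 2) * hB3 + (H ^ 3
        - H * (A ^ 2 + (l - 1) * A * B + B ^ 2)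
        - A ^ 2 * B * (l ^ 2 - 2 * l - 1) + A * B ^ 2) * h3)
    have he0 : e = 0 := by omega
    have hf0 : f = 0 := by omega
    rw [hA, hB, he0, hf0]
    simp
  obtain ⟨⟨A, rfl⟩, ⟨B, rfl⟩⟩ := hAB
  refine hprim ⟨dvd_mul_right _ _, dvd_mul_right _ _, ?_⟩
  obtain ⟨e, A', p, he, hA, hA3⟩ := cube A
  obtain ⟨f, B', q, hf, hB, hB3⟩ := cube B
  obtain ⟨g, H', r, hg, hH, hH3⟩ := cube H
  have hEq2 : ε * H ^ 3 - ε * H * l ^ 2 * (A ^ 2 + (l - 1) * A * B + B ^ 2) = A ^ 3 * (l - 1)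
      + B ^ 3 * (2 + l - l ^ 2) + l ^ 3 * ε * (A ^ 2 * B * (l ^ 2 - 2 * l - 1) - A * B ^ 2) := by
    apply mul_left_cancel₀ (pow_ne_zero 3 hl)
    linear_combination hEq + (- H ^ 3 + H * l ^ 2 * (A ^ 2 + (l - 1) * A * B + B ^ 2) + l ^ 3 *
      (A ^ 2 * B * (l ^ 2 - 2 * l - 1) - A * B ^ 2)) * h3
  have hd : l ^ 2 ∣ ((e - 2 * f - g : ℤ) : R) + l * ((-e - f : ℤ) : R) := by
    refine ⟨-(l * ε) * g * l + g - f + l * (p * (l - 1) + q * (2 + l - l ^ 2) - ε * r)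
      + ε * H * (A ^ 2 + (l - 1) * A * B + B ^ 2)
      + l * ε * (A ^ 2 * B * (l ^ 2 - 2 * l - 1) - A * B ^ 2), ?_⟩
    push_cast
    linear_combination hEq2 + (l - 1) * hA3 + (2 + l - l ^ 2) * hB3 - ε * hH3 - g * hε - l * g * h3
  obtain ⟨k, hk⟩ := hd
  obtain ⟨-, k1, k2⟩ := h.dvd_coeffs (a := 0) (b := e - 2 * f - g) (c := -e - f) (q := 0) (l := l)
    ⟨k, by rw [Int.cast_zero]; linear_combination l * hk⟩
  have hg0 : g = 0 := by omega
  rw [hH, hg0]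
  simp

end IsCubicUniformizer

section PrincipalIdealDomain

variable {O : Type*} [CommRing O] [IsDomain O] [IsPrincipalIdealRing O]

theorem exists_gcd_three {x y z : O} (hne : ¬ (x = 0 ∧ y = 0 ∧ z = 0)) :
    ∃ d x' y' z' p q r : O, d ≠ 0 ∧ x = d * x' ∧ y = d * y' ∧ z = d * z' ∧
      d = p * x + q * y + r * z ∧ p * x' + q * y' + r * z' = 1 := by
  obtain ⟨d, hd⟩ := (IsPrincipalIdealRing.principal (Ideal.span {x, y, z})).principal
  have hmem : ∀ w ∈ ({x, y, z} : Set O), d ∣ w := fun w hw => by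
    rw [← Ideal.mem_span_singleton, ← Ideal.submodule_span_eq, ← hd]
    exact Ideal.subset_span hw
  have hd' : d ∈ Ideal.span {x, y, z} := by
    rw [hd]; exact Submodule.mem_span_singleton_self d
  obtain ⟨p, q, r, hpqr⟩ := Submodule.mem_span_triple.1 hd'
  obtain ⟨x', hx⟩ := hmem x (by simp)
  obtain ⟨y', hy⟩ := hmem y (by simp)
  obtain ⟨z', hz⟩ := hmem z (by simp)
  simp only [smul_eq_mul] at hpqr
  have hd0 : d ≠ 0 := by
    rintro rfl
    exact hne ⟨by simpa using hx, by simpa using hy, by simpa using hz⟩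
  refine ⟨d, x', y', z', p, q, r, hd0, hx, hy, hz, hpqr.symm, ?_⟩
  apply mul_left_cancel₀ hd0
  linear_combination hpqr - p * hx - q * hy - r * hz

/-- `(a, b, c)` is a multiple of a triple of the shape `(u x³, v y³, 2 z³)` with units `u`, `v`. -/
def IsCubeTriple (a b c : O) : Prop :=
  ∃ (g x y z : O) (u v : Oˣ), a = g * u * x ^ 3 ∧ b = g * v * y ^ 3 ∧ c = 2 * g * z ^ 3

theorem isCubeTriple_of_even (h2 : Prime (2 : O)) {g a b c : O} {s : O}
    (hab : IsCoprime a b) (hac : IsCoprime a c) (hbc : IsCoprime b c)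
    (hs : 2 * s ^ 3 = -(a * b * c)) (hc : 2 ∣ c) : IsCubeTriple (g * a) (g * b) (g * c) := by
  obtain ⟨c, rfl⟩ := hc
  have hs' : (-s) ^ 3 = a * b * c := by
    apply mul_left_cancel₀ h2.ne_zero; linear_combination -hs
  have hac' := hac.of_mul_right_right
  have hbc' := hbc.of_mul_right_right
  obtain ⟨x, u, hu⟩ := exists_associated_pow_of_mul_eq_pow' (k := 3) (a := a) (b := b * c) (c := -s)
    (hab.mul_right hac') (by rw [hs']; ring)
  obtain ⟨y, v, hv⟩ := exists_associated_pow_of_mul_eq_pow' (k := 3) (a := b) (b := a * c) (c := -s)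
    (hab.symm.mul_right hbc') (by rw [hs']; ring)
  obtain ⟨z, w, hw⟩ := exists_associated_pow_of_mul_eq_pow' (k := 3) (a := c) (b := a * b) (c := -s)
    (hac'.symm.mul_right hbc'.symm) (by rw [hs']; ring)
  have hww : (w : O) * (w⁻¹ : Oˣ) = 1 := by simp
  refine ⟨g * w, x, y, z, u * w⁻¹, v * w⁻¹, ?_, ?_, ?_⟩
  · rw [← hu]; push_cast; linear_combination (-g * x ^ 3 * u) * hww
  · rw [← hv]; push_cast; linear_combination (-g * y ^ 3 * v) * hww
  · rw [← hw]; ring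

theorem isCubeTriple_of_cubic (h2 : Prime (2 : O)) (h3 : (3 : O) ≠ 0) {a b c : O}
    (habc : a * b * c ≠ 0) (hE : 2 * (a + b + c) ^ 3 + 27 * (a * b * c) = 0) :
    IsCubeTriple a b c ∨ IsCubeTriple b c a ∨ IsCubeTriple c a b := by
  obtain ⟨d, a, b, c, p, q, r, hd, rfl, rfl, rfl, -, hone⟩ := exists_gcd_three (x := a) (y := b)
    (z := c) (fun h => habc (by rw [h.1]; ring))
  have ha : a ≠ 0 := by rintro rfl; simp at habc
  have hb : b ≠ 0 := by rintro rfl; simp at habc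
  replace hE : 2 * (a + b + c) ^ 3 + 27 * (a * b * c) = 0 := by
    apply mul_left_cancel₀ (pow_ne_zero 3 hd); linear_combination hE
  obtain ⟨s, hs⟩ : 3 ∣ a + b + c := by
    rw [← IsIntegrallyClosed.pow_dvd_pow_iff three_ne_zero]
    exact ⟨(a + b + c) ^ 3 + 13 * (a * b * c), by linear_combination -13 * hE⟩
  have hprod : 2 * s ^ 3 = -(a * b * c) := by
    apply mul_left_cancel₀ (pow_ne_zero 3 h3)
    rw [hs] at hE
    linear_combination hE
  clear hE
  have cop : ∀ x y z p q r : O, x ≠ 0 → x + y + z = 3 * s → 2 * s ^ 3 = -(x * y * z) →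
      p * x + q * y + r * z = 1 → IsCoprime x y := by
    intro x y z p q r hx hsum hmul hone
    refine isCoprime_of_prime_dvd (fun h => hx h.1) fun w hw hwx hwy => ?_
    have hws : w ∣ s → False := fun hws => by
      have hwz : w ∣ z := by
        have : z = 3 * s - x - y := by linear_combination hsum
        rw [this]
        exact dvd_sub (dvd_sub (hws.mul_left _) hwx) hwy
      apply hw.not_isUnit
      rw [isUnit_iff_dvd_one, ← hone]
      exact dvd_add (dvd_add (hwx.mul_left _) (hwy.mul_left _)) (hwz.mul_left _)
    have h1 : w ∣ 2 * s ^ 3 := by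
      rw [hmul, dvd_neg]; exact (hwx.mul_right _).mul_right _
    rcases hw.dvd_or_dvd h1 with h | h
    · have hass : Associated w 2 := hw.associated_of_dvd h2 h
      obtain ⟨x', rfl⟩ := hass.dvd_iff_dvd_left.1 hwx
      obtain ⟨y', rfl⟩ := hass.dvd_iff_dvd_left.1 hwy
      apply hws
      rw [hass.dvd_iff_dvd_left]
      apply h2.dvd_of_dvd_pow (n := 3)
      refine ⟨-(x' * y' * z), mul_left_cancel₀ h2.ne_zero ?_⟩
      linear_combination hmul
    · exact hws (hw.dvd_of_dvd_pow h)
  have hab := cop a b c p q r ha hs hprod hone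
  have hac := cop a c b p r q ha (by linear_combination hs) (by linear_combination hprod)
    (by linear_combination hone)
  have hbc := cop b c a q r p hb (by linear_combination hs) (by linear_combination hprod)
    (by linear_combination hone)
  have h2d : 2 ∣ a * b * c := ⟨-s ^ 3, by linear_combination hprod⟩
  rcases h2.dvd_or_dvd h2d with h | h
  · rcases h2.dvd_or_dvd h with h | h
    · exact .inr (.inl (isCubeTriple_of_even h2 (s := s) hbc hab.symm hac.symm
        (by linear_combination hprod) h))
    · exact .inr (.inr (isCubeTriple_of_even h2 (s := s) hac.symm hbc.symm hab
        (by linear_combination hprod) h))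
  · exact .inl (isCubeTriple_of_even h2 hab hac hbc hprod h)

end PrincipalIdealDomain

/-- The properties of the ring of integers of the ninth cyclotomic field, with complex conjugation
`σ` and primitive ninth root of unity `ζ`, that are used in the descent. -/
structure NonagonRing {O : Type*} [CommRing O] (σ : O →+* O) (ζ : O) : Prop where
  conj_conj : ∀ x, σ (σ x) = x
  cyclotomic : ζ ^ 6 + ζ ^ 3 + 1 = 0
  mul_conj : ζ * σ ζ = 1
  exists_rep : ∀ x, ∃ a : Fin 6 → ℤ, x = ∑ i, (a i : O) * ζ ^ (i : ℕ)
  prime_one_sub : Prime (1 - ζ)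
  prime_two : Prime (2 : O)
  unit_eq : ∀ u : Oˣ, ∃ (k i j : ℕ) (μ : O), i < 3 ∧ j < 3 ∧
    (u : O) = ζ ^ k * ((ζ + σ ζ) ^ i * ((ζ + σ ζ) ^ 2 - 2) ^ j) * μ ^ 3

/-- The subring of elements fixed by `σ`. -/
abbrev realSubring {O : Type*} [CommRing O] (σ : O →+* O) : Subring O :=
  RingHom.eqLocus σ (RingHom.id O)

namespace NonagonRing

variable {O : Type*} [CommRing O] {σ : O →+* O} {ζ : O}

theorem mem_real {x : O} : x ∈ realSubring σ ↔ σ x = x := Iff.rfl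

theorem conj_coe (x : realSubring σ) : σ x = x := x.2

theorem coe_two : ((2 : realSubring σ) : O) = 2 := rfl

theorem coe_three : ((3 : realSubring σ) : O) = 3 := rfl

theorem add_conj_mem (h : NonagonRing σ ζ) (x : O) : x + σ x ∈ realSubring σ := by
  rw [mem_real, map_add, h.conj_conj, add_comm]

theorem mul_conj_mem (h : NonagonRing σ ζ) (x : O) : x * σ x ∈ realSubring σ := by
  rw [mem_real, map_mul, h.conj_conj, mul_comm]

theorem cube_add_conj_cube (h : NonagonRing σ ζ) : ζ ^ 3 + σ ζ ^ 3 = -1 := by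
  linear_combination (σ ζ) ^ 3 * h.cyclotomic - (ζ ^ 3 + 1) *
    ((ζ * σ ζ) ^ 2 + ζ * σ ζ + 1) * h.mul_conj

theorem pow_nine (h : NonagonRing σ ζ) : ζ ^ 9 = 1 := by
  linear_combination (ζ ^ 3 - 1) * h.cyclotomic

/-- The real uniformizer `ζ + ζ⁻¹ + 1`. -/
def uniformizer (h : NonagonRing σ ζ) : realSubring σ := ⟨ζ + σ ζ, h.add_conj_mem ζ⟩ + 1

theorem coe_uniformizer (h : NonagonRing σ ζ) : (h.uniformizer : O) = ζ + σ ζ + 1 := rfl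

theorem uniformizer_rel (h : NonagonRing σ ζ) :
    h.uniformizer ^ 3 = 3 * (h.uniformizer ^ 2 - 1) := by
  apply Subtype.ext
  push_cast
  rw [coe_uniformizer, coe_three]
  linear_combination h.cube_add_conj_cube + 3 * (ζ + σ ζ) * h.mul_conj

/-- `ζ² = θ ζ - 1`. -/
theorem zeta_sq (h : NonagonRing σ ζ) : ζ ^ 2 = (ζ + σ ζ) * ζ - 1 := by
  linear_combination -h.mul_conj

theorem exists_real_rep (h : NonagonRing σ ζ) (x : O) :
    ∃ A B : realSubring σ, x = A + B * ζ := by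
  obtain ⟨θ, hθ⟩ : ∃ θ : realSubring σ, (θ : O) = ζ + σ ζ := ⟨⟨_, h.add_conj_mem ζ⟩, rfl⟩
  have h2 : ζ ^ 2 = θ * ζ - 1 := by rw [hθ]; exact h.zeta_sq
  have hmul : ∀ y : O, (∃ A B : realSubring σ, y = A + B * ζ) →
      ∃ A B : realSubring σ, y * ζ = A + B * ζ := by
    rintro y ⟨A, B, rfl⟩
    exact ⟨-B, A + B * θ, by push_cast; linear_combination B * h2⟩
  have hpow : ∀ n : ℕ, ∃ A B : realSubring σ, ζ ^ n = A + B * ζ := by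
    intro n
    induction n with
    | zero => exact ⟨1, 0, by simp⟩
    | succ n ih => rw [pow_succ]; exact hmul _ ih
  choose A B hAB using hpow
  obtain ⟨a, rfl⟩ := h.exists_rep x
  refine ⟨∑ i : Fin 6, (a i : realSubring σ) * A i, ∑ i : Fin 6, (a i : realSubring σ) * B i, ?_⟩
  push_cast
  rw [Finset.sum_mul, ← Finset.sum_add_distrib]
  refine Finset.sum_congr rfl fun i _ => ?_
  rw [hAB]; ring

theorem exists_int_congr (h : NonagonRing σ ζ) (x : O) : ∃ n : ℤ, 1 - ζ ∣ x - n := by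
  obtain ⟨a, rfl⟩ := h.exists_rep x
  refine ⟨∑ i, a i, ?_⟩
  push_cast
  rw [← Finset.sum_sub_distrib]
  refine Finset.dvd_sum fun i _ => ?_
  have : (1 - ζ) ∣ 1 - ζ ^ (i : ℕ) := by simpa using sub_dvd_pow_sub_pow 1 ζ (i : ℕ)
  obtain ⟨k, hk⟩ := this
  exact ⟨-a i * k, by linear_combination -a i * hk⟩

theorem isUnit_zeta (h : NonagonRing σ ζ) : IsUnit ζ := .of_mul_eq_one _ h.mul_conj

theorem uniformizer_rel' (h : NonagonRing σ ζ) :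
    (h.uniformizer : O) ^ 3 = 3 * ((h.uniformizer : O) ^ 2 - 1) :=
  congrArg Subtype.val h.uniformizer_rel

theorem one_sub_sq' (h : NonagonRing σ ζ) : (1 - ζ) ^ 2 = -ζ * (3 - h.uniformizer) := by
  rw [coe_uniformizer]; linear_combination -h.mul_conj

theorem three_eq_pow (h : NonagonRing σ ζ) : ∃ u : O, IsUnit u ∧ (3 : O) = u * (1 - ζ) ^ 6 := by
  have hrel := h.uniformizer_rel'
  have hsq := h.one_sub_sq'
  generalize (h.uniformizer : O) = l at *
  refine ⟨-ζ ^ 6 * (l ^ 2 - 1) ^ 2, ((h.isUnit_zeta.pow 6).neg).mul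
    (IsUnit.pow 2 (.of_mul_eq_one (-1 + 3 * l - l ^ 2) (by linear_combination -l * hrel))), ?_⟩
  have e : (1 - ζ) ^ 6 = (-ζ * (3 - l)) ^ 3 := by rw [← hsq]; ring
  rw [e]
  linear_combination (l ^ 4 - 6 * l ^ 3 + 7 * l ^ 2 + 9 * l - 8) * hrel
    - (l ^ 2 - 1) ^ 2 * (3 - l) ^ 3 * h.pow_nine

theorem one_sub_dvd_three (h : NonagonRing σ ζ) : 1 - ζ ∣ 3 := by
  obtain ⟨u, -, hu⟩ := h.three_eq_pow
  exact ⟨u * (1 - ζ) ^ 5, by linear_combination hu⟩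

theorem uniformizer_dvd_sq (h : NonagonRing σ ζ) : (h.uniformizer : O) ∣ (1 - ζ) ^ 2 := by
  have hrel := h.uniformizer_rel'
  rw [h.one_sub_sq']
  generalize (h.uniformizer : O) = l at *
  exact ⟨-ζ * (-1 + 3 * l - l ^ 2), by linear_combination -ζ * hrel⟩

theorem one_sub_dvd_uniformizer (h : NonagonRing σ ζ) : 1 - ζ ∣ h.uniformizer := by
  have hsq := h.one_sub_sq'
  obtain ⟨k, hk⟩ := h.one_sub_dvd_three
  generalize (h.uniformizer : O) = l at *
  exact ⟨k + σ ζ * (1 - ζ), by linear_combination hk - σ ζ * hsq + (3 - l) * h.mul_conj⟩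

variable [IsDomain O]

theorem uniformizer_ne_zero (h : NonagonRing σ ζ) : (h.uniformizer : O) ≠ 0 := fun h0 => by
  have h1 := h.uniformizer_rel'
  have h2 := h.one_sub_sq'
  rw [h0] at h1 h2
  have h3 : (1 - ζ) ^ 2 = 0 := by linear_combination h2 - ζ * h1
  exact h.prime_one_sub.ne_zero (pow_eq_zero_iff two_ne_zero |>.1 h3)

theorem mem_real_of_mul (x : O) {y : O} (hx : σ x = x) (hx0 : x ≠ 0) (hxy : σ (x * y) = x * y) :
    σ y = y := by
  rw [map_mul, hx] at hxy
  exact mul_left_cancel₀ hx0 hxy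

theorem coe_dvd_coe {x y : realSubring σ} : (x : O) ∣ y ↔ x ∣ y := by
  constructor
  · rintro ⟨z, hz⟩
    by_cases hx : (x : O) = 0
    · rw [hx, zero_mul] at hz
      rw [Subtype.ext (a1 := x) (a2 := 0) hx, Subtype.ext (a1 := y) (a2 := 0) hz]
    · exact ⟨⟨z, mem_real_of_mul _ x.2 hx (by rw [← hz]; exact y.2)⟩, Subtype.ext hz⟩
  · rintro ⟨z, rfl⟩
    exact ⟨z, rfl⟩

/-- A real element of the prime above three is divisible by the real uniformizer. -/
theorem uniformizer_dvd (h : NonagonRing σ ζ) {w : realSubring σ} (hw : 1 - ζ ∣ (w : O)) :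
    h.uniformizer ∣ w := by
  obtain ⟨y, hy⟩ := hw
  have hΛ := h.prime_one_sub.ne_zero
  have hmc := h.mul_conj
  have hσy : σ y = -ζ * y := by
    apply mul_left_cancel₀ hΛ
    have h1 : (1 - σ ζ) * σ y = w := by
      rw [← conj_coe w, hy]; simp
    linear_combination (-ζ) * h1 - ζ * hy - (σ y) * hmc
  obtain ⟨n, t, ht⟩ := h.exists_int_congr y
  have h2 : 1 - ζ ∣ y := by
    have h1 : σ y - n = (1 - σ ζ) * σ t := by
      have := congrArg σ ht
      simpa using this
    have h3 : 1 - ζ ∣ 2 * y := by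
      refine ⟨t + σ ζ * σ t + y, ?_⟩
      linear_combination ht - h1 + hσy + (σ t) * hmc
    obtain ⟨k, hk⟩ := h3
    obtain ⟨m, hm⟩ := h.one_sub_dvd_three
    exact ⟨m * y - k, by linear_combination y * hm - hk⟩
  obtain ⟨y, rfl⟩ := h2
  rw [← coe_dvd_coe, hy]
  exact h.uniformizer_dvd_sq.trans ⟨y, by ring⟩

theorem isCubicUniformizer [IsPrincipalIdealRing O] (h : NonagonRing σ ζ) :
    IsCubicUniformizer h.uniformizer where
  rel := h.uniformizer_rel
  res x := by
    obtain ⟨n, hn⟩ := h.exists_int_congr x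
    have key : ∀ m : ℤ, (3 : ℤ) ∣ n - m → h.uniformizer ∣ x - m := by
      rintro m ⟨k, hk⟩
      apply h.uniformizer_dvd
      have : (((x - m : realSubring σ)) : O) = (x - n) + 3 * k := by
        have := congrArg (Int.cast : ℤ → O) hk
        push_cast at this ⊢
        linear_combination this
      rw [this]
      exact dvd_add hn (h.one_sub_dvd_three.mul_right _)
    have h3 : (3 : ℤ) ∣ n - 0 ∨ (3 : ℤ) ∣ n - 1 ∨ (3 : ℤ) ∣ n - (-1) := by omega
    rcases h3 with h3 | h3 | h3
    · exact .inl (by simpa using key 0 h3)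
    · exact .inr (.inl (by simpa using key 1 h3))
    · exact .inr (.inr (by simpa using key (-1) h3))
  ne_zero h0 := h.uniformizer_ne_zero (by rw [h0]; rfl)
  not_dvd_one hd := h.prime_one_sub.not_isUnit <| isUnit_iff_dvd_one.2 <|
    h.one_sub_dvd_uniformizer.trans (coe_dvd_coe.2 hd)
  exists_not_pow_dvd x hx := by
    have hx0 : (x : O) ≠ 0 := fun h0 => hx (Subtype.ext h0)
    have hu : ¬ IsUnit (h.uniformizer : O) := fun hu =>
      h.prime_one_sub.not_isUnit (isUnit_of_dvd_unit h.one_sub_dvd_uniformizer hu)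
    obtain ⟨n, hn⟩ := FiniteMultiplicity.of_not_isUnit hu hx0
    exact ⟨n + 1, fun hd => hn (by simpa using coe_dvd_coe.2 hd)⟩

end NonagonRing

namespace NonagonRing

variable {O : Type*} [CommRing O] {σ : O →+* O} {ζ : O}

/-- The real unit `θ ^ i * (θ ^ 2 - 2) ^ j`. -/
def realUnit (h : NonagonRing σ ζ) (i j : ℕ) : realSubring σ :=
  (h.uniformizer - 1) ^ i * (h.uniformizer ^ 2 - 2 * h.uniformizer - 1) ^ j

theorem coe_realUnit (h : NonagonRing σ ζ) (i j : ℕ) :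
    (h.realUnit i j : O) = (ζ + σ ζ) ^ i * ((ζ + σ ζ) ^ 2 - 2) ^ j := by
  rw [realUnit]
  push_cast
  rw [coe_uniformizer, coe_two]
  ring

variable [IsDomain O]

theorem exists_real_norm (h : NonagonRing σ ζ) {g x z : O} (u : Oˣ) {a c : realSubring σ}
    (hc0 : c ≠ 0) (ha : (a : O) = g * u * x ^ 3) (hc : (c : O) = 2 * g * z ^ 3) :
    ∃ (i j : ℕ) (m N : realSubring σ), i < 3 ∧ j < 3 ∧
      c * m = 2 * a * (⟨_, h.mul_conj_mem z⟩ : realSubring σ) ^ 3 ∧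
      m ^ 2 = h.realUnit i j ^ 2 * N ^ 3 := by
  obtain ⟨k, i, j, μ, hi, hj, hu⟩ := h.unit_eq u
  rw [← h.coe_realUnit] at hu
  have hc0' : (c : O) ≠ 0 := fun h0 => hc0 (Subtype.ext h0)
  have hcm : (c : O) * (u * x ^ 3 * σ z ^ 3) = 2 * a * (z * σ z) ^ 3 := by
    rw [ha, hc]; ring
  have hm : σ (u * x ^ 3 * σ z ^ 3) = u * x ^ 3 * σ z ^ 3 := by
    refine mem_real_of_mul (c : O) c.2 hc0' ?_
    rw [hcm]
    simp only [map_mul, map_pow, h.conj_conj, map_ofNat, conj_coe]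
    ring
  refine ⟨i, j, ⟨_, hm⟩, ⟨_, h.mul_conj_mem μ⟩ * ⟨_, h.mul_conj_mem x⟩ * ⟨_, h.mul_conj_mem z⟩,
    hi, hj, Subtype.ext hcm, Subtype.ext ?_⟩
  have hζ : ζ ^ k * σ ζ ^ k = 1 := by rw [← mul_pow, h.mul_conj, one_pow]
  have e : (u * x ^ 3 * σ z ^ 3) ^ 2 = (u * x ^ 3 * σ z ^ 3) * σ (u * x ^ 3 * σ z ^ 3) := by
    rw [hm]; ring
  push_cast
  rw [e, hu]
  simp only [map_mul, map_pow, h.conj_conj, conj_coe]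
  linear_combination ((h.realUnit i j : O) ^ 2 * ((μ * σ μ) * (x * σ x) * (z * σ z)) ^ 3) * hζ

variable [IsPrincipalIdealRing O]

theorem pow_three_dvd (x y : realSubring σ) (hd : x ^ 3 ∣ y ^ 3) : x ∣ y := by
  rw [← coe_dvd_coe] at hd ⊢
  push_cast at hd
  exact (IsIntegrallyClosed.pow_dvd_pow_iff three_ne_zero).1 hd

theorem not_dvd_realUnit (h : NonagonRing σ ζ) (i j : ℕ) : ¬ h.uniformizer ∣ h.realUnit i j := by
  have hl := h.isCubicUniformizer
  generalize hl0 : h.uniformizer = l at *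
  intro hd
  rw [realUnit, hl0] at hd
  have key : ∀ x : realSubring σ, l ∣ l * x - 1 → False := fun x hx =>
    hl.not_dvd_one (by simpa using dvd_sub (dvd_mul_right l x) hx)
  rcases hl.prime_dvd hd with k | k
  · exact key 1 (by simpa using hl.prime_dvd_pow k)
  · exact key (l - 2) (by convert hl.prime_dvd_pow k using 1; ring)

/-- A solution of the cubic with unit coefficients already has trivial coefficients. -/
theorem realUnit_eq_one (h : NonagonRing σ ζ) {i₁ j₁ i₂ j₂ : ℕ} (hi₁ : i₁ < 3) (hj₁ : j₁ < 3)
    (hi₂ : i₂ < 3) (hj₂ : j₂ < 3) {X Y Z κ : realSubring σ}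
    (hκ : κ ^ 3 = h.realUnit i₁ j₁ * h.realUnit i₂ j₂) (hZ : Z ≠ 0)
    (hE : h.realUnit i₁ j₁ * X ^ 3 + h.realUnit i₂ j₂ * Y ^ 3 + 2 * Z ^ 3
      + 3 * κ * X * Y * Z = 0) :
    h.realUnit i₁ j₁ = 1 ∧ h.realUnit i₂ j₂ = 1 ∧ κ = 1 := by
  have hl := h.isCubicUniformizer
  obtain ⟨n, X, Y, Z, rfl, rfl, rfl, hprim⟩ := hl.exists_primitive (x := X) (y := Y) (z := Z)
    fun h0 => hZ h0.2.2
  replace hE : h.realUnit i₁ j₁ * X ^ 3 + h.realUnit i₂ j₂ * Y ^ 3 + 2 * Z ^ 3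
      + 3 * κ * X * Y * Z = 0 := by
    apply mul_left_cancel₀ (pow_ne_zero 3 (pow_ne_zero n hl.ne_zero))
    linear_combination hE
  obtain ⟨e₁, e₂⟩ := hl.unit_exponents hi₁ hj₁
    (hl.unit_congr hκ (h.not_dvd_realUnit _ _) (h.not_dvd_realUnit _ _) hE hprim)
  obtain ⟨e₃, e₄⟩ := hl.unit_exponents hi₂ hj₂
    (hl.unit_congr (r₁ := h.realUnit i₂ j₂) (r₂ := h.realUnit i₁ j₁) (κ := κ) (X := Y) (Y := X)
      (Z := Z) (by rw [hκ, mul_comm]) (h.not_dvd_realUnit _ _)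
      (h.not_dvd_realUnit _ _) (by linear_combination hE) (fun k => hprim ⟨k.2.1, k.1, k.2.2⟩))
  subst e₁ e₂ e₃ e₄
  have h1 : h.realUnit 0 0 = 1 := by simp [realUnit]
  exact ⟨h1, h1, hl.eq_one_of_cube_eq_one (by rw [hκ, h1, one_mul])⟩

theorem exists_real_cubes (h : NonagonRing σ ζ) {a b c : realSubring σ} (habc : a * b * c ≠ 0)
    (hE : 2 * (a + b + c) ^ 3 + 27 * (a * b * c) = 0) (hT : IsCubeTriple (a : O) b c) :
    ∃ K K' x y z : realSubring σ, K ≠ 0 ∧ K' ≠ 0 ∧ K * a = K' * x ^ 3 ∧ K * b = K' * y ^ 3 ∧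
      K * c = K' * (2 * z ^ 3) ∧ x ^ 3 + y ^ 3 + 2 * z ^ 3 + 3 * x * y * z = 0 ∧ z ≠ 0 := by
  obtain ⟨g, x, y, z, u, v, ha, hb, hc⟩ := hT
  have ha0 : a ≠ 0 := by rintro rfl; simp at habc
  have hb0 : b ≠ 0 := by rintro rfl; simp at habc
  have hc0 : c ≠ 0 := by rintro rfl; simp at habc
  have h20 : (2 : realSubring σ) ≠ 0 := fun h0 => h.prime_two.ne_zero (congrArg Subtype.val h0)
  have h30 : (3 : realSubring σ) ≠ 0 := h.isCubicUniformizer.three_ne_zero'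
  obtain ⟨i₁, j₁, m₁, N₁, hi₁, hj₁, hm₁, hN₁⟩ := h.exists_real_norm u hc0 ha hc
  obtain ⟨i₂, j₂, m₂, N₂, hi₂, hj₂, hm₂, hN₂⟩ := h.exists_real_norm v hc0 hb hc
  have hZ0 : (⟨_, h.mul_conj_mem z⟩ : realSubring σ) ≠ 0 := fun h0 => by
    have h1 : z * σ z = 0 := congrArg Subtype.val h0
    have hz : z = 0 := by
      rcases mul_eq_zero.1 h1 with k | k
      · exact k
      · rw [← h.conj_conj z, k, map_zero]
    rw [hz] at hc
    exact hc0 (Subtype.ext (by rw [hc]; simp))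
  generalize (⟨_, h.mul_conj_mem z⟩ : realSubring σ) = Z at *
  have hm₁0 : m₁ ≠ 0 := by
    rintro rfl
    rw [mul_zero] at hm₁
    exact mul_ne_zero (mul_ne_zero h20 ha0) (pow_ne_zero 3 hZ0) hm₁.symm
  have hm₂0 : m₂ ≠ 0 := by
    rintro rfl
    rw [mul_zero] at hm₂
    exact mul_ne_zero (mul_ne_zero h20 hb0) (pow_ne_zero 3 hZ0) hm₂.symm
  obtain ⟨X, hX⟩ : ∃ X, X = h.realUnit i₁ j₁ * N₁ ^ 2 * m₂ := ⟨_, rfl⟩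
  obtain ⟨Y, hY⟩ : ∃ Y, Y = h.realUnit i₂ j₂ * N₂ ^ 2 * m₁ := ⟨_, rfl⟩
  have hX3 : h.realUnit i₁ j₁ * X ^ 3 = m₁ ^ 4 * m₂ ^ 3 := by
    have : m₁ ^ 4 = (m₁ ^ 2) ^ 2 := by ring
    rw [this, hN₁, hX]; ring
  have hY3 : h.realUnit i₂ j₂ * Y ^ 3 = m₂ ^ 4 * m₁ ^ 3 := by
    have : m₂ ^ 4 = (m₂ ^ 2) ^ 2 := by ring
    rw [this, hN₂, hY]; ring
  have hZ' : Z * m₁ * m₂ ≠ 0 := mul_ne_zero (mul_ne_zero hZ0 hm₁0) hm₂0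
  have hX0 : X ≠ 0 := by
    rintro rfl
    have : m₁ ^ 4 * m₂ ^ 3 = 0 := by rw [← hX3]; ring
    exact mul_ne_zero (pow_ne_zero 4 hm₁0) (pow_ne_zero 3 hm₂0) this
  have hY0 : Y ≠ 0 := by
    rintro rfl
    have : m₂ ^ 4 * m₁ ^ 3 = 0 := by rw [← hY3]; ring
    exact mul_ne_zero (pow_ne_zero 4 hm₂0) (pow_ne_zero 3 hm₁0) this
  obtain ⟨K, hK⟩ : ∃ K, K = 2 * Z ^ 3 * (m₁ ^ 3 * m₂ ^ 3) := ⟨_, rfl⟩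
  have hK0 : K ≠ 0 := by
    rw [hK]
    exact mul_ne_zero (mul_ne_zero h20 (pow_ne_zero 3 hZ0))
      (mul_ne_zero (pow_ne_zero 3 hm₁0) (pow_ne_zero 3 hm₂0))
  have hKa : K * a = c * (h.realUnit i₁ j₁ * X ^ 3) := by
    rw [hX3, hK]; linear_combination -(m₁ ^ 3 * m₂ ^ 3) * hm₁
  have hKb : K * b = c * (h.realUnit i₂ j₂ * Y ^ 3) := by
    rw [hY3, hK]; linear_combination -(m₁ ^ 3 * m₂ ^ 3) * hm₂
  have hKc : K * c = c * (2 * (Z * m₁ * m₂) ^ 3) := by rw [hK]; ring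
  clear hX hY hX3 hY3 hm₁ hm₂ hK
  generalize Z * m₁ * m₂ = W at *
  have hsum : (h.realUnit i₁ j₁ * X ^ 3 + h.realUnit i₂ j₂ * Y ^ 3 + 2 * W ^ 3) ^ 3 =
      (-3 * (X * Y * W)) ^ 3 * (h.realUnit i₁ j₁ * h.realUnit i₂ j₂) := by
    apply mul_left_cancel₀ h20
    apply mul_left_cancel₀ (pow_ne_zero 3 hc0)
    have e1 : c * (h.realUnit i₁ j₁ * X ^ 3 + h.realUnit i₂ j₂ * Y ^ 3 + 2 * W ^ 3) =
        K * (a + b + c) := by linear_combination -hKa - hKb - hKc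
    have e2 : (c * (h.realUnit i₁ j₁ * X ^ 3)) * (c * (h.realUnit i₂ j₂ * Y ^ 3)) *
        (c * (2 * W ^ 3)) = K ^ 3 * (a * b * c) := by rw [← hKa, ← hKb, ← hKc]; ring
    have e3 := congrArg (fun t => t ^ 3) e1
    beta_reduce at e3
    linear_combination 2 * e3 + 27 * e2 + K ^ 3 * hE
  obtain ⟨κ, hκ⟩ := pow_three_dvd _ _ ⟨_, hsum⟩
  have hκ3 : κ ^ 3 = h.realUnit i₁ j₁ * h.realUnit i₂ j₂ := by
    rw [hκ, mul_pow] at hsum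
    refine mul_left_cancel₀ (pow_ne_zero 3 (mul_ne_zero (neg_ne_zero.2 h30) ?_)) hsum
    exact mul_ne_zero (mul_ne_zero hX0 hY0) hZ'
  have hE' : h.realUnit i₁ j₁ * X ^ 3 + h.realUnit i₂ j₂ * Y ^ 3 + 2 * W ^ 3
      + 3 * κ * X * Y * W = 0 := by linear_combination hκ
  obtain ⟨r1, r2, rfl⟩ := h.realUnit_eq_one hi₁ hj₁ hi₂ hj₂ hκ3 hZ' hE'
  rw [r1] at hKa hE'
  rw [r2] at hKb hE'
  exact ⟨K, c, X, Y, W, hK0, hc0, by rw [hKa, one_mul], by rw [hKb, one_mul], hKc,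
    by linear_combination hE', hZ'⟩

end NonagonRing

theorem eq_of_prime_pow_mul_eq {O : Type*} [CommRing O] [IsDomain O] {p A B : O} (hp : Prime p)
    {a b : ℕ} (hA : ¬ p ∣ A) (hB : ¬ p ∣ B) (hAB : p ^ a * A = p ^ b * B) : A = B := by
  have key : ∀ {a b : ℕ} {A B : O}, ¬ p ∣ B → p ^ a * A = p ^ b * B → a ≤ b := by
    intro a b A B hB hAB
    by_contra! hlt
    obtain ⟨c, rfl⟩ := Nat.exists_eq_add_of_lt hlt
    apply hB
    refine ⟨p ^ c * A, mul_left_cancel₀ (pow_ne_zero b hp.ne_zero) ?_⟩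
    rw [← hAB]; ring
  obtain rfl := le_antisymm (key hB hAB) (key hA hAB.symm)
  exact mul_left_cancel₀ (pow_ne_zero a hp.ne_zero) hAB

namespace NonagonRing

variable {O : Type*} [CommRing O] {σ : O →+* O} {ζ : O}

variable [IsDomain O] [IsPrincipalIdealRing O]

theorem isCoprime_forms (h : NonagonRing σ ζ) {x y z p q r α β t M M' : O} {j j' : ℕ}
    (hone : p * x + q * y + r * z = 1) (ht : (α - β) * t = 3)
    (hM : x + α * y - α ^ 2 * z = (1 - ζ) ^ j * M) (hM' : x + β * y - β ^ 2 * z = (1 - ζ) ^ j' * M')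
    (hΛM : ¬ 1 - ζ ∣ M) (hz : ∀ w, Prime w → w ∣ M → w ∣ z) : IsCoprime M M' := by
  refine isCoprime_of_prime_dvd (fun h0 => hΛM (by rw [h0.1]; exact dvd_zero _))
    fun w hw hwM hwM' => ?_
  have hwz := hz w hw hwM
  have h1 : w ∣ x + α * y - α ^ 2 * z := by rw [hM]; exact hwM.mul_left _
  have h2 : w ∣ x + β * y - β ^ 2 * z := by rw [hM']; exact hwM'.mul_left _
  have h3 : w ∣ 3 * y := by
    have e : 3 * y = t * ((x + α * y - α ^ 2 * z) - (x + β * y - β ^ 2 * z)) +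
      z * (3 * (α + β)) := by linear_combination (-y + z * (α + β)) * ht
    rw [e]
    exact dvd_add ((dvd_sub h1 h2).mul_left _) (hwz.mul_right _)
  have hy : w ∣ y := by
    refine (hw.dvd_or_dvd h3).resolve_left fun h3 => ?_
    obtain ⟨u, hu, hu3⟩ := h.three_eq_pow
    rw [hu3, hu.dvd_mul_left] at h3
    exact hΛM ((hw.associated_of_dvd h.prime_one_sub (hw.dvd_of_dvd_pow h3)).dvd_iff_dvd_left.1 hwM)
  have hx : w ∣ x := by
    have e : x = (x + α * y - α ^ 2 * z) - y * α + z * α ^ 2 := by ring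
    rw [e]
    exact dvd_add (dvd_sub h1 (hy.mul_right _)) (hwz.mul_right _)
  apply hw.not_isUnit
  rw [isUnit_iff_dvd_one, ← hone]
  exact dvd_add (dvd_add (hx.mul_left _) (hy.mul_left _)) (hwz.mul_left _)

theorem form_eq_cube (h : NonagonRing σ ζ) {x y z p q r : O}
    (hE : x ^ 3 + y ^ 3 + 2 * z ^ 3 + 3 * x * y * z = 0) (hz : z ≠ 0)
    (hone : p * x + q * y + r * z = 1) :
    ∃ (u : Oˣ) (j : ℕ) (g : O), x + ζ ^ 3 * y - (ζ ^ 3) ^ 2 * z = u * (1 - ζ) ^ j * g ^ 3 := by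
  have hω : (ζ ^ 3) ^ 2 + ζ ^ 3 + 1 = 0 := by linear_combination h.cyclotomic
  generalize ζ ^ 3 = ω at *
  obtain ⟨u, hu, hu3⟩ := h.three_eq_pow
  have h30 : (3 : O) ≠ 0 := by
    rw [hu3]; exact mul_ne_zero hu.ne_zero (pow_ne_zero 6 h.prime_one_sub.ne_zero)
  have hprod : (x + 1 * y - 1 ^ 2 * z) * (x + ω * y - ω ^ 2 * z) *
      (x + ω ^ 2 * y - (ω ^ 2) ^ 2 * z) = -3 * z ^ 3 := by
    have h4 : (ω ^ 2) ^ 2 = ω := by linear_combination (ω ^ 2 - ω) * hω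
    have h2 : ω ^ 2 = -1 - ω := by linear_combination hω
    rw [h4, h2]
    linear_combination hE - (x + y - z) * (y + z) ^ 2 * hω
  have hne : (x + 1 * y - 1 ^ 2 * z) * (x + ω * y - ω ^ 2 * z) *
      (x + ω ^ 2 * y - (ω ^ 2) ^ 2 * z) ≠ 0 := by
    rw [hprod]; exact mul_ne_zero (neg_ne_zero.2 h30) (pow_ne_zero 3 hz)
  have fac : ∀ t : O, t ≠ 0 → ∃ (n : ℕ) (s : O), t = (1 - ζ) ^ n * s ∧ ¬ 1 - ζ ∣ s := fun t ht => by
    obtain ⟨s, hs⟩ := (FiniteMultiplicity.of_prime_left h.prime_one_sub ht).exists_eq_pow_mul_and_not_dvd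
    exact ⟨_, s, hs⟩
  obtain ⟨j₀, M₀, hM₀, hd₀⟩ := fac _ (left_ne_zero_of_mul (left_ne_zero_of_mul hne))
  obtain ⟨j₁, M₁, hM₁, hd₁⟩ := fac _ (right_ne_zero_of_mul (left_ne_zero_of_mul hne))
  obtain ⟨j₂, M₂, hM₂, hd₂⟩ := fac _ (right_ne_zero_of_mul hne)
  obtain ⟨j, z', hz', hd⟩ := fac z hz
  have hp := h.prime_one_sub
  have hmul : M₁ * (M₀ * M₂) = -u * z' ^ 3 := by
    refine eq_of_prime_pow_mul_eq hp (a := j₀ + j₁ + j₂) (b := 6 + 3 * j) ?_ ?_ ?_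
    · exact fun k => (hp.dvd_or_dvd k).elim hd₁ fun k => (hp.dvd_or_dvd k).elim hd₀ hd₂
    · rw [hu.neg.dvd_mul_left]; exact fun k => hd (hp.dvd_of_dvd_pow k)
    · rw [hM₀, hM₁, hM₂] at hprod
      rw [hz'] at hprod
      linear_combination hprod - ((1 - ζ) ^ j * z') ^ 3 * hu3
  have hwz : ∀ w, Prime w → w ∣ M₁ → w ∣ z := fun w hw hwM => by
    have : w ∣ -u * z' ^ 3 := by rw [← hmul]; exact hwM.mul_right _
    rw [hu.neg.dvd_mul_left] at this
    rw [hz']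
    exact (hw.dvd_of_dvd_pow this).mul_left _
  have hc₀ : IsCoprime M₁ M₀ := h.isCoprime_forms hone (t := -(2 + ω))
    (by linear_combination -hω) hM₁ hM₀ hd₁ hwz
  have hc₂ : IsCoprime M₁ M₂ := h.isCoprime_forms hone (t := ω ^ 2 * (2 + ω))
    (by linear_combination (-ω ^ 3 + 3 * ω - 3) * hω) hM₁ hM₂ hd₁ hwz
  obtain ⟨u, rfl⟩ := hu
  obtain ⟨g, v, hv⟩ := exists_associated_pow_of_associated_pow_mul (c := z') (k := 3)
    (hc₀.mul_right hc₂) ⟨-u, by rw [hmul]; push_cast; ring⟩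
  exact ⟨v, j₁, g, by rw [hM₁, ← hv]; ring⟩

end NonagonRing

namespace NonagonRing

variable {O : Type*} [CommRing O] {σ : O →+* O} {ζ : O}

variable [IsDomain O]

theorem three_sub_uniformizer_ne_zero (h : NonagonRing σ ζ) : 3 - h.uniformizer ≠ 0 := fun h0 => by
  have h1 := h.one_sub_sq'
  have h2 : (3 : O) - h.uniformizer = 0 := congrArg Subtype.val h0
  rw [h2, mul_zero] at h1
  exact h.prime_one_sub.ne_zero (pow_eq_zero_iff two_ne_zero |>.1 h1)

variable [IsPrincipalIdealRing O]

theorem exists_real_mul_form (h : NonagonRing σ ζ) {x y z : realSubring σ}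
    (hE : x ^ 3 + y ^ 3 + 2 * z ^ 3 + 3 * x * y * z = 0) (hz : z ≠ 0) :
    ∃ (ρ : realSubring σ) (g : O) (k : ℕ), ρ ≠ 0 ∧
      ρ * (x + ζ ^ 3 * y - (ζ ^ 3) ^ 2 * z : O) = ζ ^ k * g ^ 3 := by
  have hz0 : (z : O) ≠ 0 := fun h0 => hz (Subtype.ext h0)
  obtain ⟨D, x', y', z', p, q, r, hD, hx, hy, hz', hbez, hone⟩ :=
    exists_gcd_three (x := (x : O)) (y := y) (z := z) fun h0 => hz0 h0.2.2
  have hE' : x' ^ 3 + y' ^ 3 + 2 * z' ^ 3 + 3 * x' * y' * z' = 0 := by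
    have e := congrArg Subtype.val hE
    push_cast at e
    rw [coe_two, coe_three, hx, hy, hz'] at e
    refine (mul_eq_zero.1 (?_ : D ^ 3 * _ = 0)).resolve_left (pow_ne_zero 3 hD)
    linear_combination e
  obtain ⟨u, j, g, hg⟩ := h.form_eq_cube hE' (fun h0 => hz0 (by rw [hz', h0, mul_zero])) hone
  obtain ⟨v, hv⟩ : ∃ v, σ D = D * v := by
    refine ⟨σ p * x' + σ q * y' + σ r * z', ?_⟩
    have e := congrArg σ hbez
    rw [map_add, map_add, map_mul, map_mul, map_mul, conj_coe, conj_coe, conj_coe] at e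
    rw [e, hx, hy, hz']; ring
  have hvv : v * σ v = 1 := by
    have e := h.conj_conj D
    rw [hv, map_mul, hv] at e
    exact mul_left_cancel₀ hD (by linear_combination e)
  obtain ⟨k, i, j', μ, -, -, hμ⟩ := h.unit_eq
    (u * Units.mkOfMulEqOne v _ hvv * (-Units.mkOfMulEqOne (σ ζ) ζ (by rw [mul_comm, h.mul_conj])) ^ j)
  rw [← h.coe_realUnit] at hμ
  push_cast at hμ
  rw [Units.val_mkOfMulEqOne, Units.val_mkOfMulEqOne] at hμ
  have hr : h.realUnit i j' ≠ 0 := fun h0 => h.not_dvd_realUnit i j' (h0 ▸ dvd_zero _)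
  have hDD : (⟨D * σ D, h.mul_conj_mem D⟩ : realSubring σ) ≠ 0 := fun h0 => by
    have e : D * σ D = 0 := congrArg Subtype.val h0
    rw [hv] at e
    have hv0 : v ≠ 0 := left_ne_zero_of_mul (hvv.trans_ne one_ne_zero)
    exact mul_ne_zero hD (mul_ne_zero hD hv0) e
  refine ⟨⟨D * σ D, h.mul_conj_mem D⟩ * (3 - h.uniformizer) ^ j * h.realUnit i j' ^ 2,
    h.realUnit i j' * μ * D * (1 - ζ) ^ j * g, k,
    mul_ne_zero (mul_ne_zero hDD (pow_ne_zero _ h.three_sub_uniformizer_ne_zero))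
      (pow_ne_zero _ hr), ?_⟩
  have h3 : (3 : O) - h.uniformizer = -σ ζ * (1 - ζ) ^ 2 := by
    rw [h.one_sub_sq']; linear_combination (h.uniformizer - 3 : O) * h.mul_conj
  push_cast
  rw [coe_three, h3, hv, hx, hy, hz', mul_pow (-σ ζ)]
  generalize (h.realUnit i j' : O) = R at *
  generalize (-σ ζ) ^ j = Q at *
  rw [← pow_mul, mul_comm 2 j, pow_mul]
  generalize (1 - ζ) ^ j = P at *
  linear_combination D ^ 3 * v * Q * P ^ 2 * R ^ 2 * hg + D ^ 3 * R ^ 2 * P ^ 3 * g ^ 3 * hμ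

end NonagonRing

namespace NonagonRing

variable {O : Type*} [CommRing O] {σ : O →+* O} {ζ : O}

variable [IsDomain O] [IsPrincipalIdealRing O]

theorem eq_zero_of_twisted (h : NonagonRing σ ζ) {w : O} {H : realSubring σ}
    (hw : 3 * (H : O) ^ 3 - 3 * H * (w * σ w) - (ζ * w ^ 3 + σ (ζ * w ^ 3)) = 0) : H = 0 := by
  obtain ⟨A, B, rfl⟩ := h.exists_real_rep w
  refine (h.isCubicUniformizer.twisted_eq_zero (A := A) (B := B) (H := H) (Subtype.ext ?_)).2.2
  push_cast
  rw [coe_uniformizer, coe_two, coe_three]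
  simp only [map_mul, map_pow, map_add, conj_coe] at hw
  have h1 := h.mul_conj
  have h3 := h.cube_add_conj_cube
  generalize σ ζ = ξ at *
  linear_combination hw + (3 * H * B ^ 2 - 6 * A ^ 2 * B + B ^ 3 * (2 - ζ ^ 2 - ξ ^ 2)) * h1 +
    (3 * A * B ^ 2 + B ^ 3 * (ζ + ξ)) * h3

theorem descent_of_isCubeTriple (h : NonagonRing σ ζ) {a b c H s x z : realSubring σ} (hH : H ≠ 0)
    (hs : s ≠ 0) (hsum : a + b + c = -3 * H) (hprod : a * b * c = 2 * H ^ 3)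
    (hx : s * x = a ^ 2 * b + b ^ 2 * c + c ^ 2 * a - 3 * a * b * c)
    (hz : s * z = H * (a ^ 2 + b ^ 2 + c ^ 2 - a * b - b * c - c * a))
    (hT : IsCubeTriple (a : O) b c) :
    ∃ x₁ y₁ z₁ a b c s s' : realSubring σ, a = x₁ ^ 3 ∧ b = y₁ ^ 3 ∧ c = 2 * z₁ ^ 3 ∧
      a + b + c + 3 * x₁ * y₁ * z₁ = 0 ∧ z₁ ≠ 0 ∧ s ≠ 0 ∧
      s * x = s' * (a ^ 2 * b + b ^ 2 * c + c ^ 2 * a - 3 * a * b * c) ∧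
      s * z = s' * (x₁ * y₁ * z₁ * (a ^ 2 + b ^ 2 + c ^ 2 - a * b - b * c - c * a)) := by
  have h20 : (2 : realSubring σ) ≠ 0 := fun h0 => h.prime_two.ne_zero (congrArg Subtype.val h0)
  have h30 := h.isCubicUniformizer.three_ne_zero'
  obtain ⟨K, K', x₁, y₁, z₁, hK, hK', ha, hb, hc, hE, hz₁⟩ := h.exists_real_cubes
    (by rw [hprod]; exact mul_ne_zero h20 (pow_ne_zero 3 hH))
    (by rw [hsum, hprod]; ring) hT
  have hKH : K * H = K' * (x₁ * y₁ * z₁) := mul_left_cancel₀ h30 (by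
    linear_combination -ha - hb - hc + K * hsum - K' * hE)
  refine ⟨x₁, y₁, z₁, _, _, _, K ^ 3 * s, K' ^ 3, rfl, rfl, rfl, by linear_combination hE, hz₁,
    mul_ne_zero (pow_ne_zero 3 hK) hs, ?_, ?_⟩
  · calc K ^ 3 * s * x = (K * a) ^ 2 * (K * b) + (K * b) ^ 2 * (K * c) + (K * c) ^ 2 * (K * a)
          - 3 * (K * a) * (K * b) * (K * c) := by linear_combination K ^ 3 * hx
      _ = _ := by rw [ha, hb, hc]; ring
  · calc K ^ 3 * s * z = (K * H) * ((K * a) ^ 2 + (K * b) ^ 2 + (K * c) ^ 2 - (K * a) * (K * b)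
          - (K * b) * (K * c) - (K * c) * (K * a)) := by linear_combination K ^ 3 * hz
      _ = _ := by rw [ha, hb, hc, hKH]; ring

theorem descended_cubic {R : Type*} [CommRing R] {ω x y z M : R} (hω : ω ^ 2 + ω + 1 = 0)
    (hE : x ^ 3 + y ^ 3 + 2 * z ^ 3 + 3 * x * y * z = 0)
    (hM : (x + ω * y - ω ^ 2 * z) * (x + ω ^ 2 * y - (ω ^ 2) ^ 2 * z) = M) :
    3 * z ^ 3 - 3 * z * M
      - (M * ω * (x + ω * y - ω ^ 2 * z) + M * ω ^ 2 * (x + ω ^ 2 * y - (ω ^ 2) ^ 2 * z)) = 0 := by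
  have h2 : ω ^ 2 = -1 - ω := by linear_combination hω
  have h4 : (ω ^ 2) ^ 2 = ω := by linear_combination (ω ^ 2 - ω) * hω
  have hM' : M = x ^ 2 + y ^ 2 + z ^ 2 - x * y + x * z + y * z := by
    rw [← hM, h4, h2]; linear_combination -(y + z) ^ 2 * hω
  rw [h4, h2, hM']
  linear_combination hE - 2 * (x ^ 2 + y ^ 2 + z ^ 2 - x * y + x * z + y * z) * (y + z) * hω

theorem hasDescent (h : NonagonRing σ ζ) : IsCubicUniformizer.HasDescent (realSubring σ) := by
  intro x y z hE hz
  obtain ⟨ρ, g, k, hρ, hg⟩ := h.exists_real_mul_form hE hz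
  have hωσ : σ ζ ^ 3 = (ζ ^ 3) ^ 2 := by linear_combination h.cube_add_conj_cube - h.cyclotomic
  have hω : (ζ ^ 3) ^ 2 + ζ ^ 3 + 1 = 0 := by linear_combination h.cyclotomic
  have h2 : (ζ ^ 3) ^ 2 = -1 - ζ ^ 3 := by linear_combination hω
  have h4 : ((ζ ^ 3) ^ 2) ^ 2 = ζ ^ 3 := by linear_combination ((ζ ^ 3) ^ 2 - ζ ^ 3) * hω
  have hE' : (ρ * x : O) ^ 3 + (ρ * y) ^ 3 + 2 * (ρ * z) ^ 3 + 3 * (ρ * x) * (ρ * y) * (ρ * z) = 0 := by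
    have e : (x : O) ^ 3 + y ^ 3 + 2 * z ^ 3 + 3 * x * y * z = 0 := congrArg Subtype.val hE
    linear_combination ρ ^ 3 * e
  have hg' := congrArg σ hg
  simp only [map_mul, map_pow, map_add, map_sub, conj_coe] at hg'
  rw [hωσ] at hg'
  have hL₁ : (ρ * x + ζ ^ 3 * (ρ * y) - (ζ ^ 3) ^ 2 * (ρ * z) : O) = ζ ^ k * g ^ 3 := by
    linear_combination hg
  have hL₂ : (ρ * x + (ζ ^ 3) ^ 2 * (ρ * y) - ((ζ ^ 3) ^ 2) ^ 2 * (ρ * z) : O) =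
      σ ζ ^ k * σ g ^ 3 := by
    linear_combination hg'
  have hζk : ζ ^ k * σ ζ ^ k = 1 := by rw [← mul_pow, h.mul_conj, one_pow]
  have key := descended_cubic (M := (g * σ g) ^ 3) hω hE' (by
    rw [hL₁, hL₂]; linear_combination (g * σ g) ^ 3 * hζk)
  have hH : ρ * z ≠ 0 := mul_ne_zero hρ hz
  rw [hL₁, hL₂] at key
  obtain ⟨q, k₀, hk₀, rfl⟩ : ∃ q k₀, k₀ < 3 ∧ k = 3 * q + k₀ :=
    ⟨k / 3, k % 3, Nat.mod_lt _ (by norm_num), (Nat.div_add_mod k 3).symm⟩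
  obtain ⟨W, hWdef⟩ : ∃ W, W = ζ ^ (q + 1) * (g * σ g) * g := ⟨_, rfl⟩
  have hσW : σ W = σ ζ ^ (q + 1) * (g * σ g) * σ g := by
    rw [hWdef]; simp only [map_mul, map_pow, h.conj_conj]; ring
  have hζq : ζ ^ (q + 1) * σ ζ ^ (q + 1) = 1 := by rw [← mul_pow, h.mul_conj, one_pow]
  have hWW : W * σ W = (g * σ g) ^ 3 := by
    rw [hσW, hWdef]; linear_combination (g * σ g) ^ 3 * hζq
  have hW₁ : ζ ^ k₀ * W ^ 3 = (g * σ g) ^ 3 * ζ ^ 3 * (ζ ^ (3 * q + k₀) * g ^ 3) := by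
    rw [hWdef]; ring
  have hW₂ : σ ζ ^ k₀ * σ W ^ 3 =
      (g * σ g) ^ 3 * (ζ ^ 3) ^ 2 * (σ ζ ^ (3 * q + k₀) * σ g ^ 3) := by
    rw [hσW, ← hωσ]; ring
  rw [← hW₁, ← hW₂, ← hWW] at key
  interval_cases k₀
  · have hg0 : g ≠ 0 := by
      rintro rfl
      have h0 : W = 0 := by rw [hWdef, mul_zero]
      simp only [h0, map_zero, mul_zero, sub_zero, add_zero, ne_eq, OfNat.ofNat_ne_zero,
        not_false_eq_true, zero_pow] at key
      have h3 : (3 : realSubring σ) * (ρ * z) ^ 3 = 0 := Subtype.ext key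
      exact mul_ne_zero h.isCubicUniformizer.three_ne_zero' (pow_ne_zero 3 hH) h3
    have hN : (⟨g * σ g, h.mul_conj_mem g⟩ : realSubring σ) ≠ 0 := fun h0 =>
      mul_ne_zero hg0 (fun h1 => hg0 (by rw [← h.conj_conj g, h1, map_zero])) (congrArg Subtype.val h0)
    obtain ⟨a, ha⟩ : ∃ a : realSubring σ, (a : O) = -(ρ * z) + (W + σ W) :=
      ⟨-(ρ * z) + ⟨_, h.add_conj_mem W⟩, rfl⟩
    obtain ⟨b, hb⟩ : ∃ b : realSubring σ, (b : O) = -(ρ * z) + ((ζ ^ 3) ^ 2 * W + ζ ^ 3 * σ W) :=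
      ⟨-(ρ * z) + ⟨_, h.add_conj_mem ((ζ ^ 3) ^ 2 * W)⟩, by
        push_cast; rw [map_mul, ← hωσ, map_pow, h.conj_conj]⟩
    obtain ⟨c, hc⟩ : ∃ c : realSubring σ, (c : O) = -(ρ * z) + (ζ ^ 3 * W + (ζ ^ 3) ^ 2 * σ W) :=
      ⟨-(ρ * z) + ⟨_, h.add_conj_mem (ζ ^ 3 * W)⟩, by
        push_cast; rw [map_mul, ← hωσ, map_pow]⟩
    have hs : 9 * ρ * (⟨g * σ g, h.mul_conj_mem g⟩ : realSubring σ) ^ 3 ≠ 0 :=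
      mul_ne_zero (mul_ne_zero (by
        have := h.isCubicUniformizer.three_ne_zero'
        convert mul_ne_zero this this using 1; norm_num) hρ) (pow_ne_zero 3 hN)
    have h9 : ((9 : realSubring σ) : O) = 9 := rfl
    have hsum : a + b + c = -3 * (ρ * z) := by
      apply Subtype.ext
      push_cast
      rw [coe_three, ha, hb, hc]
      linear_combination (W + σ W) * hω
    have hprd : a * b * c = 2 * (ρ * z) ^ 3 := by
      apply Subtype.ext
      push_cast
      rw [coe_two, ha, hb, hc, h2]
      linear_combination -key - (-(ρ * z) + W + σ W) * (W - σ W) ^ 2 * hω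
    have hx : 9 * ρ * ⟨g * σ g, h.mul_conj_mem g⟩ ^ 3 * x =
        a ^ 2 * b + b ^ 2 * c + c ^ 2 * a - 3 * a * b * c := by
      apply Subtype.ext
      push_cast
      rw [coe_three, h9, ha, hb, hc, h2]
      rw [← hL₁] at hW₁
      rw [← hL₂] at hW₂
      have e₁ : (g * σ g) ^ 3 * (ρ * x + ζ ^ 3 * (ρ * y) - (ζ ^ 3) ^ 2 * (ρ * z)) =
          (ζ ^ 3) ^ 2 * W ^ 3 := by
        linear_combination -(ζ ^ 3) ^ 2 * hW₁ - (ζ ^ 3 - 1) *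
          ((g * σ g) ^ 3 * (ρ * x + ζ ^ 3 * (ρ * y) - (ζ ^ 3) ^ 2 * (ρ * z))) * hω
      have e₂ : (g * σ g) ^ 3 * (ρ * x + (ζ ^ 3) ^ 2 * (ρ * y) - ((ζ ^ 3) ^ 2) ^ 2 * (ρ * z)) =
          ζ ^ 3 * σ W ^ 3 := by
        linear_combination -ζ ^ 3 * hW₂ - (ζ ^ 3 - 1) * ((g * σ g) ^ 3 *
          (ρ * x + (ζ ^ 3) ^ 2 * (ρ * y) - ((ζ ^ 3) ^ 2) ^ 2 * (ρ * z))) * hω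
      rw [h2] at e₁
      rw [h4, h2] at e₂
      rw [← hWW] at e₁ e₂ ⊢
      generalize ζ ^ 3 = ω at *
      linear_combination 3 * (1 - ω) * e₁ + 3 * (2 + ω) * e₂ + (6 * (W * σ W) * (ρ * y) +
        3 * (ρ * z) * (W ^ 2 + σ W ^ 2) - (σ W - W) ^ 2 * (6 * W + 3 * σ W) +
        (σ W - W) ^ 3 * (ω - 1) + 3 * W ^ 3 + 3 * σ W ^ 3) * hω
    have hz : 9 * ρ * ⟨g * σ g, h.mul_conj_mem g⟩ ^ 3 * z =
        ρ * z * (a ^ 2 + b ^ 2 + c ^ 2 - a * b - b * c - c * a) := by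
      apply Subtype.ext
      push_cast
      rw [h9, ha, hb, hc, h2]
      linear_combination -9 * ρ * z * hWW - 3 * ρ * z * (σ W - W) ^ 2 * hω
    have hT := isCubeTriple_of_cubic (a := (a : O)) (b := b) (c := c) h.prime_two
      (fun h0 => h.isCubicUniformizer.three_ne_zero' (Subtype.ext h0))
      (fun h0 => by
        have e : 2 * (ρ * z) ^ 3 = 0 := by rw [← hprd]; exact Subtype.ext h0
        exact mul_ne_zero (fun h0 => h.prime_two.ne_zero (congrArg Subtype.val h0))
          (pow_ne_zero 3 hH) e)
      (by
        have e : 2 * (a + b + c) ^ 3 + 27 * (a * b * c) = 0 := by rw [hsum, hprd]; ring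
        exact congrArg Subtype.val e)
    rcases hT with hT | hT | hT
    · exact h.descent_of_isCubeTriple hH hs hsum hprd hx hz hT
    · refine h.descent_of_isCubeTriple hH hs ?_ ?_ ?_ ?_ hT
      · rw [← hsum]; ring
      · rw [← hprd]; ring
      · rw [hx]; ring
      · rw [hz]; ring
    · refine h.descent_of_isCubeTriple hH hs ?_ ?_ ?_ ?_ hT
      · rw [← hsum]; ring
      · rw [← hprd]; ring
      · rw [hx]; ring
      · rw [hz]; ring
  · refine absurd (h.eq_zero_of_twisted (w := W) (H := ρ * z) ?_) hH
    push_cast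
    simp only [map_mul, map_pow]
    linear_combination key
  · refine absurd (h.eq_zero_of_twisted (w := σ ζ * σ W) (H := ρ * z) ?_) hH
    push_cast
    simp only [map_mul, map_pow, h.conj_conj]
    linear_combination key - (3 * (ρ * z) * (W * σ W) + σ ζ ^ 2 * σ W ^ 3 + ζ ^ 2 * W ^ 3) *
      h.mul_conj

end NonagonRing

/-- `(a, b, c)` is proportional to `(1, -θ³, -2)`, with `θ` one of the conjugates of `ζ + ζ⁻¹`. -/
def IsConjTriple {R : Type*} [CommRing R] (l a b c : R) : Prop :=
  ∃ θ, IsCubicUniformizer.IsConj l θ ∧ b = -θ ^ 3 * a ∧ c = -2 * a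

namespace NonagonRing

variable {O : Type*} [CommRing O] {σ : O →+* O} {ζ : O}

theorem charZero_fractionRing [IsDomain O] [CharZero O] : CharZero (FractionRing (realSubring σ)) := by
  have : CharZero (realSubring σ) := ⟨fun m n hmn => by
    have := congrArg Subtype.val hmn
    push_cast at this
    exact_mod_cast this⟩
  exact charZero_of_injective_algebraMap (IsFractionRing.injective (realSubring σ) _)

variable [IsDomain O] [IsPrincipalIdealRing O]

theorem isConjTriple_of_isCubeTriple (h : NonagonRing σ ζ) {a b c : realSubring σ}
    (habc : a * b * c ≠ 0) (hE : 2 * (a + b + c) ^ 3 + 27 * (a * b * c) = 0)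
    (hT : IsCubeTriple (a : O) b c) :
    IsConjTriple h.uniformizer a b c ∨ IsConjTriple h.uniformizer b a c := by
  obtain ⟨K, K', x, y, z, hK, hK', ha, hb, hc, hE', hz⟩ := h.exists_real_cubes habc hE hT
  rcases h.isCubicUniformizer.classify h.hasDescent hE' with ⟨h0, -⟩ | ⟨hx, θ, hθ, hy⟩ |
    ⟨hy, θ, hθ, hx⟩
  · exact absurd h0 hz
  · refine .inl ⟨θ, hθ, mul_left_cancel₀ hK ?_, mul_left_cancel₀ hK ?_⟩
    · rw [hb, hy]; rw [hx] at ha; linear_combination θ ^ 3 * ha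
    · rw [hc]; rw [hx] at ha; linear_combination 2 * ha
  · refine .inr ⟨θ, hθ, mul_left_cancel₀ hK ?_, mul_left_cancel₀ hK ?_⟩
    · rw [ha, hx]; rw [hy] at hb; linear_combination θ ^ 3 * hb
    · rw [hc]; rw [hy] at hb; linear_combination 2 * hb

theorem isConjTriple_of_cubic (h : NonagonRing σ ζ) {a b c : realSubring σ}
    (habc : a * b * c ≠ 0) (hE : 2 * (a + b + c) ^ 3 + 27 * (a * b * c) = 0) :
    (IsConjTriple h.uniformizer a b c ∨ IsConjTriple h.uniformizer b a c) ∨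
    (IsConjTriple h.uniformizer b c a ∨ IsConjTriple h.uniformizer c b a) ∨
    (IsConjTriple h.uniformizer c a b ∨ IsConjTriple h.uniformizer a c b) := by
  rcases isCubeTriple_of_cubic (a := (a : O)) (b := b) (c := c) h.prime_two
      (fun h0 => h.isCubicUniformizer.three_ne_zero' (Subtype.ext h0))
      (fun h0 => habc (Subtype.ext h0)) (congrArg Subtype.val hE) with hT | hT | hT
  · exact .inl (h.isConjTriple_of_isCubeTriple habc hE hT)
  · exact .inr (.inl (h.isConjTriple_of_isCubeTriple (by convert habc using 1; ring)
      (by rw [← hE]; ring) hT))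
  · exact .inr (.inr (h.isConjTriple_of_isCubeTriple (by convert habc using 1; ring)
      (by rw [← hE]; ring) hT))

end NonagonRing

/-- A field with an element `θ` satisfying `θ³ = 3θ - 1` over which the curve
`8E³ + (U² - 9V²)(U + 3E) = 0` has only the obvious points. -/
structure IsNonagonField (F : Type*) [Field F] [CharZero F] (θ : F) : Prop where
  rel : θ ^ 3 = 3 * θ - 1
  points : ∀ U V E : F, 8 * E ^ 3 + (U ^ 2 - 9 * V ^ 2) * (U + 3 * E) = 0 →
    E = 0 ∧ (U = 0 ∨ U = 3 * V ∨ U = -3 * V) ∨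
    ∃ (τ ε : F), (τ = θ ∨ τ = θ ^ 2 - 2 ∨ τ = 2 - θ - θ ^ 2) ∧ (ε = 1 ∨ ε = -1) ∧
      (V = ε * U ∧ E = -τ * U ∨ E = ε * V ∧ U = -E * (1 + 2 * τ) ∨
        ε * V = τ * E ∧ U = ε * V - 4 * E)

theorem isNonagonField_of_cubic {F : Type*} [Field F] [CharZero F] {l : F}
    (hl : l ^ 3 = 3 * (l ^ 2 - 1))
    (hpts : ∀ a b c : F, 2 * (a + b + c) ^ 3 + 27 * (a * b * c) = 0 → a * b * c ≠ 0 →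
      (IsConjTriple l a b c ∨ IsConjTriple l b a c) ∨ (IsConjTriple l b c a ∨ IsConjTriple l c b a) ∨
      (IsConjTriple l c a b ∨ IsConjTriple l a c b)) : IsNonagonField F (l - 1) := by
  have hθ : (l - 1) ^ 3 = 3 * (l - 1) - 1 := by linear_combination hl
  refine ⟨hθ, fun U V E hE => ?_⟩
  by_cases h0 : (U + 3 * V) * (U - 3 * V) * (-2 * (U + 3 * E)) = 0
  · have hE0 : E = 0 := by
      have : E ^ 3 = 0 := by linear_combination hE / 8 + h0 / 16
      exact pow_eq_zero_iff three_ne_zero |>.1 this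
    subst hE0
    refine .inl ⟨rfl, ?_⟩
    rcases mul_eq_zero.1 h0 with h0 | h0
    · rcases mul_eq_zero.1 h0 with h0 | h0
      · exact .inr (.inr (by linear_combination h0))
      · exact .inr (.inl (by linear_combination h0))
    · exact .inl (by linear_combination -h0 / 2)
  right
  have hdouble : ∀ {τ}, IsCubicUniformizer.IsConj l τ →
      ((τ ^ 2 - 2 = l - 1 ∨ τ ^ 2 - 2 = (l - 1) ^ 2 - 2 ∨ τ ^ 2 - 2 = 2 - (l - 1) - (l - 1) ^ 2) ∧
      (τ = l - 1 ∨ τ = (l - 1) ^ 2 - 2 ∨ τ = 2 - (l - 1) - (l - 1) ^ 2)) ∧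
      τ ^ 3 = 3 * τ - 1 := by
    rintro τ (rfl | rfl | rfl)
    · exact ⟨⟨.inr (.inl rfl), .inl rfl⟩, hθ⟩
    · exact ⟨⟨.inr (.inr (by linear_combination (l - 1) * hl)), .inr (.inl (by ring))⟩,
        by linear_combination (l ^ 3 - 3 * l ^ 2 + 1) * hl⟩
    · exact ⟨⟨.inl (by linear_combination (l + 1) * hl), .inr (.inr (by ring))⟩,
        by linear_combination (-l ^ 3 + 3 * l + 1) * hl⟩
  have caseA : ∀ {V}, IsConjTriple l (U + 3 * V) (U - 3 * V) (-2 * (U + 3 * E)) →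
      ∃ τ, (τ = l - 1 ∨ τ = (l - 1) ^ 2 - 2 ∨ τ = 2 - (l - 1) - (l - 1) ^ 2) ∧
        E = V ∧ U = -E * (1 + 2 * τ) := by
    rintro V ⟨τ, hτ, h1, h2⟩
    obtain ⟨⟨h3, -⟩, h4⟩ := hdouble hτ
    have h5 : E = V := by linear_combination -h2 / 6
    refine ⟨_, h3, h5, ?_⟩
    rw [h5]
    linear_combination (3 - τ ^ 2) / 3 * (h1 - (U + 3 * V) * h4) + (U + 3 * V) * h4
  have caseB : ∀ {V}, IsConjTriple l (U - 3 * V) (-2 * (U + 3 * E)) (U + 3 * V) →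
      ∃ τ, (τ = l - 1 ∨ τ = (l - 1) ^ 2 - 2 ∨ τ = 2 - (l - 1) - (l - 1) ^ 2) ∧
        V = U ∧ E = -τ * U := by
    rintro V ⟨τ, hτ, h1, h2⟩
    obtain ⟨⟨-, h3⟩, h4⟩ := hdouble hτ
    obtain rfl : V = U := by linear_combination -h2 / 3
    exact ⟨_, h3, rfl, by linear_combination -h1 / 6 - V / 3 * h4⟩
  have caseC : ∀ {V}, IsConjTriple l (-2 * (U + 3 * E)) (U - 3 * V) (U + 3 * V) →
      ∃ τ, (τ = l - 1 ∨ τ = (l - 1) ^ 2 - 2 ∨ τ = 2 - (l - 1) - (l - 1) ^ 2) ∧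
        V = τ * E ∧ U = V - 4 * E := by
    rintro V ⟨τ, hτ, h1, h2⟩
    obtain ⟨⟨h3, -⟩, h4⟩ := hdouble hτ
    have h5 : U = V - 4 * E := by linear_combination -h2 / 3
    refine ⟨_, h3, ?_, h5⟩
    rw [h5] at h1
    linear_combination -(3 - τ ^ 2) / 6 * (h1 + 2 * (V - E) * h4) + (V - E) * h4
  have eplus : U + 3 * V = U - 3 * (-V) := by ring
  have eminus : U - 3 * V = U + 3 * (-V) := by ring
  rcases hpts _ _ _ (by linear_combination -54 * hE) h0 with (h | h) | (h | h) | (h | h)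
  · obtain ⟨τ, hτ, h1, h2⟩ := caseA h
    exact ⟨τ, 1, hτ, .inl rfl, .inr (.inl ⟨by rw [one_mul, h1], h2⟩)⟩
  · rw [eplus, eminus] at h
    obtain ⟨τ, hτ, h1, h2⟩ := caseA h
    exact ⟨τ, -1, hτ, .inr rfl, .inr (.inl ⟨by rw [h1]; ring, h2⟩)⟩
  · obtain ⟨τ, hτ, h1, h2⟩ := caseB h
    exact ⟨τ, 1, hτ, .inl rfl, .inl ⟨by rw [one_mul, h1], h2⟩⟩
  · obtain ⟨τ, hτ, h1, h2⟩ := caseC h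
    exact ⟨τ, 1, hτ, .inl rfl, .inr (.inr ⟨by rw [one_mul, h1], by rw [one_mul, h2]⟩)⟩
  · rw [eplus, eminus] at h
    obtain ⟨τ, hτ, h1, h2⟩ := caseC h
    exact ⟨τ, -1, hτ, .inr rfl, .inr (.inr ⟨by linear_combination h1, by linear_combination h2⟩)⟩
  · rw [eplus, eminus] at h
    obtain ⟨τ, hτ, h1, h2⟩ := caseB h
    exact ⟨τ, -1, hτ, .inr rfl, .inl ⟨by linear_combination -h1, h2⟩⟩

namespace NonagonRing

variable {O : Type*} [CommRing O] {σ : O →+* O} {ζ : O}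

variable [IsDomain O] [IsPrincipalIdealRing O]

/-- The points on the cubic, in the fraction field. -/
theorem cubic_points (h : NonagonRing σ ζ) (a b c : FractionRing (realSubring σ))
    (hE : 2 * (a + b + c) ^ 3 + 27 * (a * b * c) = 0) (habc : a * b * c ≠ 0) :
    let l := algebraMap _ (FractionRing (realSubring σ)) h.uniformizer
    (IsConjTriple l a b c ∨ IsConjTriple l b a c) ∨ (IsConjTriple l b c a ∨ IsConjTriple l c b a) ∨
    (IsConjTriple l c a b ∨ IsConjTriple l a c b) := by
  intro l
  classical
  obtain ⟨⟨d, hd⟩, hmult⟩ := IsLocalization.exist_integer_multiples_of_finset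
    (nonZeroDivisors (realSubring σ)) {a, b, c}
  obtain ⟨a', ha⟩ := hmult a (by simp)
  obtain ⟨b', hb⟩ := hmult b (by simp)
  obtain ⟨c', hc⟩ := hmult c (by simp)
  simp only [Algebra.smul_def] at ha hb hc
  have hinj := IsFractionRing.injective (realSubring σ) (FractionRing (realSubring σ))
  set φ := algebraMap (realSubring σ) (FractionRing (realSubring σ))
  have hd0 : φ d ≠ 0 := (map_ne_zero_iff φ hinj).2 (nonZeroDivisors.ne_zero hd)
  have key : ∀ {x y z : FractionRing (realSubring σ)} {x' y' z' : realSubring σ},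
      φ x' = φ d * x → φ y' = φ d * y → φ z' = φ d * z →
      IsConjTriple h.uniformizer x' y' z' → IsConjTriple l x y z := by
    rintro x y z x' y' z' hx hy hz ⟨θ, hθ, hθy, hθz⟩
    refine ⟨φ θ, ?_, mul_left_cancel₀ hd0 ?_, mul_left_cancel₀ hd0 ?_⟩
    · rcases hθ with rfl | rfl | rfl
      · exact .inl (by simp only [φ, l, map_sub, map_one])
      · exact .inr (.inl (by simp only [φ, l, map_sub, map_mul, map_pow, map_ofNat, map_one]))
      · exact .inr (.inr (by simp only [φ, l, map_sub, map_add, map_pow, map_ofNat]))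
    · rw [← hy, hθy, map_mul, hx, map_neg, map_pow]; ring
    · rw [← hz, hθz, map_mul, hx, map_neg, map_ofNat]; ring
  refine (h.isConjTriple_of_cubic (a := a') (b := b') (c := c') ?_ ?_).imp
    (Or.imp (key ha hb hc) (key hb ha hc)) (Or.imp (Or.imp (key hb hc ha) (key hc hb ha))
      (Or.imp (key hc ha hb) (key ha hc hb)))
  · refine fun h0 => mul_ne_zero (pow_ne_zero 3 hd0) habc ?_
    have := congrArg φ h0
    rw [map_mul, map_mul, ha, hb, hc, map_zero] at this
    rw [← this]; ring
  · apply hinj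
    simp only [map_add, map_mul, map_pow, map_ofNat, map_zero]
    rw [ha, hb, hc]
    linear_combination (φ d) ^ 3 * hE

theorem exists_isNonagonField [CharZero (FractionRing (realSubring σ))] (h : NonagonRing σ ζ) :
    ∃ θ : FractionRing (realSubring σ), IsNonagonField (FractionRing (realSubring σ)) θ := by
  obtain ⟨l, hl⟩ : ∃ l, l = algebraMap _ (FractionRing (realSubring σ)) h.uniformizer := ⟨_, rfl⟩
  have hrel : l ^ 3 = 3 * (l ^ 2 - 1) := by
    have := congrArg (algebraMap _ (FractionRing (realSubring σ))) h.uniformizer_rel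
    rw [map_pow, map_mul, map_sub, map_pow, map_ofNat, map_one, ← hl] at this
    exact this
  exact ⟨l - 1, isNonagonField_of_cubic hrel (by rw [hl]; exact h.cubic_points)⟩

end NonagonRing

namespace NonagonField

open NumberField Ideal

variable (K : Type*) [Field K] [NumberField K]

theorem exists_liesOver (p : ℕ) (hp : p.Prime) :
    ∃ P : Ideal (𝓞 K), P.IsPrime ∧ P.LiesOver (span {(p : ℤ)}) := by
  have : Fact p.Prime := ⟨hp⟩
  have : (span {(p : ℤ)}).IsMaximal := Int.ideal_span_isMaximal_of_prime p
  obtain ⟨P, hP, hPp⟩ :=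
    exists_maximal_ideal_liesOver_of_isIntegral (span {(p : ℤ)}) (S := 𝓞 K)
  exact ⟨P, hP.isPrime, hPp⟩

variable [hK : IsCyclotomicExtension {9} ℚ K]

theorem isCyclotomicExtension_prime_pow : IsCyclotomicExtension {3 ^ (1 + 1)} ℚ K := hK

theorem finrank_eq_six : Module.finrank ℚ K = 6 := by
  rw [IsCyclotomicExtension.finrank (n := 9) K
    (Polynomial.cyclotomic.irreducible_rat (by simp))]
  decide

theorem nrComplexPlaces_eq_three : InfinitePlace.nrComplexPlaces K = 3 := by
  rw [IsCyclotomicExtension.Rat.nrComplexPlaces_eq_totient_div_two 9]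
  decide

theorem discr_eq : discr K = -3 ^ 9 := by
  have := isCyclotomicExtension_prime_pow K
  rw [IsCyclotomicExtension.Rat.discr_prime_pow_succ 3 1 K]
  norm_num

variable {K} in
theorem prime_toInteger_sub_one {ζ : K} (hζ : IsPrimitiveRoot ζ 9) : Prime (hζ.toInteger - 1) :=
  have := isCyclotomicExtension_prime_pow K
  IsPrimitiveRoot.zeta_sub_one_prime (p := 3) (k := 1) hζ

variable {K} in
theorem inertiaDeg_two (P : Ideal (𝓞 K)) [P.IsPrime] [P.LiesOver (span {((2 : ℕ) : ℤ)})] :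
    P.inertiaDeg ℤ = 6 := by
  have : Fact (Nat.Prime 2) := ⟨Nat.prime_two⟩
  rw [IsCyclotomicExtension.Rat.inertiaDeg_eq_of_not_dvd (m := 9) 2 K P (by norm_num)]
  rw [orderOf_eq_iff (by norm_num)]
  decide

theorem minkowski_bound_lt :
    (4 / Real.pi) ^ InfinitePlace.nrComplexPlaces K * ((Module.finrank ℚ K).factorial /
      (Module.finrank ℚ K : ℝ) ^ (Module.finrank ℚ K) * √|(discr K : ℝ)|) < 5 := by
  rw [nrComplexPlaces_eq_three, finrank_eq_six, discr_eq]
  have h1 : √|(((-3 ^ 9 : ℤ)) : ℝ)| < 141 := by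
    rw [Real.sqrt_lt' (by norm_num)]
    norm_num
  have h2 : 4 / Real.pi < 4 / (3.14 : ℝ) := by
    gcongr; exact Real.pi_gt_d2
  calc _ < (4 / 3.14 : ℝ) ^ 3 * ((Nat.factorial 6) / ((6 : ℕ) : ℝ) ^ 6 * 141) := by gcongr
    _ < 5 := by norm_num [Nat.factorial]

theorem isPrincipalIdealRing : IsPrincipalIdealRing (𝓞 K) := by
  have := IsCyclotomicExtension.isGalois {9} ℚ K
  apply
    RingOfIntegers.isPrincipalIdealRing_of_isPrincipal_of_lt_or_isPrincipal_of_mem_primesOver_of_mem_Icc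
  have hlt := (Nat.floor_lt' (n := 5) (by norm_num)).2 (minkowski_bound_lt K)
  intro p hp hprime
  have hp5 := (Finset.mem_Icc.1 hp).2.trans_lt hlt
  obtain ⟨P, hP, hPp⟩ := exists_liesOver K p hprime
  refine ⟨P, ⟨hP, hPp⟩, ?_⟩
  obtain rfl | rfl : p = 2 ∨ p = 3 := by
    interval_cases p <;> revert hprime <;> decide
  · left
    rw [inertiaDeg_two]
    omega
  · right
    have := isCyclotomicExtension_prime_pow K
    have : Fact (Nat.Prime 3) := ⟨Nat.prime_three⟩
    rw [IsCyclotomicExtension.Rat.eq_span_zeta_sub_one_of_liesOver 3 1 K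
      (IsCyclotomicExtension.zeta_spec _ ℚ K) P]
    exact ⟨_, rfl⟩

theorem prime_two : Prime (2 : 𝓞 K) := by
  obtain ⟨P, hP, hPp⟩ := exists_liesOver K 2 Nat.prime_two
  have hle : span {(2 : 𝓞 K)} ≤ P := by
    rw [span_singleton_le_iff_mem]
    have : ((2 : ℕ) : ℤ) ∈ P.under ℤ := by
      rw [← LiesOver.over (P := P) (p := span {((2 : ℕ) : ℤ)})]
      exact mem_span_singleton_self _
    simpa using this
  have hnorm : absNorm P = 2 ^ 6 := by
    rw [← inertiaDeg_two P]
    exact (natAbs_pow_inertiaDeg 2 P).symm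
  have hnorm' : absNorm (span {(2 : 𝓞 K)}) = 2 ^ 6 := by
    have := Algebra.norm_algebraMap (S := 𝓞 K) (2 : ℤ)
    rw [RingOfIntegers.rank, finrank_eq_six, map_ofNat] at this
    rw [absNorm_span_singleton, this]
    rfl
  obtain ⟨Q, hQ⟩ := dvd_iff_le.2 hle
  rw [hQ, map_mul, hnorm] at hnorm'
  have hQ1 : Q = ⊤ := absNorm_eq_one_iff.1 (by omega)
  rw [hQ1, mul_top] at hQ
  rw [← span_singleton_prime two_ne_zero, hQ]
  exact hP

end NonagonField

namespace NonagonField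

open NumberField Ideal Polynomial

theorem aeval_cyclotomic_nine {R : Type*} [CommRing R] (r : R) :
    aeval r (cyclotomic 9 ℤ) = r ^ 6 + r ^ 3 + 1 := by
  have : Fact (Nat.Prime 3) := ⟨Nat.prime_three⟩
  have h : cyclotomic (3 ^ (1 + 1)) ℤ = ∑ i ∈ Finset.range 3, (X ^ 3 ^ 1) ^ i :=
    cyclotomic_prime_pow_eq_geom_sum Nat.prime_three
  rw [show (9 : ℕ) = 3 ^ (1 + 1) by norm_num, h]
  simp [Finset.sum_range_succ]
  ring

/-- A residue character computation modulo `19`. -/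
theorem exponents_eq_zero {i j : ℕ} (hi : i < 3) (hj : j < 3)
    (h₁ : ((9 : ZMod 19) ^ i * 3 ^ j) ^ 12 = 1) (h₂ : ((3 : ZMod 19) ^ i * 7 ^ j) ^ 12 = 1) :
    i = 0 ∧ j = 0 := by
  revert h₁ h₂
  interval_cases i <;> interval_cases j <;> decide

variable {K : Type*} [Field K] [NumberField K] {ζ : K} (hζ : IsPrimitiveRoot ζ 9)

theorem minpoly_toInteger : minpoly ℤ hζ.toInteger = cyclotomic 9 ℤ := by
  rw [cyclotomic_eq_minpoly hζ (by norm_num),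
    ← minpoly.algebraMap_eq (B := 𝓞 K) (B' := K) RingOfIntegers.coe_injective]
  rfl

theorem toInteger_rel : hζ.toInteger ^ 6 + hζ.toInteger ^ 3 + 1 = 0 := by
  rw [← aeval_cyclotomic_nine, ← minpoly_toInteger hζ, minpoly.aeval]

variable [hK : IsCyclotomicExtension {9} ℚ K]

theorem exists_ringHom {R : Type*} [CommRing R] (r : R) (hr : r ^ 6 + r ^ 3 + 1 = 0) :
    ∃ φ : 𝓞 K →+* R, φ hζ.toInteger = r := by
  have hr' : aeval r (minpoly ℤ hζ.integralPowerBasis.gen) = 0 := by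
    rw [IsPrimitiveRoot.integralPowerBasis_gen, minpoly_toInteger, aeval_cyclotomic_nine, hr]
  exact ⟨(hζ.integralPowerBasis.lift r hr').toRingHom,
    (congrArg _ hζ.integralPowerBasis_gen.symm).trans (hζ.integralPowerBasis.lift_gen r hr')⟩

theorem exists_rep (x : 𝓞 K) :
    ∃ a : Fin 6 → ℤ, x = ∑ i, (a i : 𝓞 K) * hζ.toInteger ^ (i : ℕ) := by
  have hdim : hζ.integralPowerBasis.dim = 6 := by
    rw [IsPrimitiveRoot.integralPowerBasis_dim]; decide
  let B := hζ.integralPowerBasis.basis.reindex (finCongr hdim)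
  refine ⟨B.repr x, ?_⟩
  conv_lhs => rw [← B.sum_repr x]
  refine Finset.sum_congr rfl fun i _ => ?_
  simp [B, zsmul_eq_mul]

theorem exists_conj : ∃ σ : 𝓞 K →+* 𝓞 K, hζ.toInteger * σ hζ.toInteger = 1 ∧
    ∀ x, σ (σ x) = x := by
  have hrel := toInteger_rel hζ
  set z := hζ.toInteger
  have h9 : z ^ 9 = 1 := by linear_combination (z ^ 3 - 1) * hrel
  obtain ⟨σ, hσ⟩ := exists_ringHom hζ (z ^ 8)
    (by linear_combination ((z ^ 9) ^ 4 + (z ^ 9) ^ 3 + (z ^ 9) ^ 2 + z ^ 9 + 1) * z ^ 3 * h9 +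
      ((z ^ 9) + 1) * z ^ 6 * h9 + hrel)
  refine ⟨σ, by rw [hσ, ← h9]; ring, fun x => ?_⟩
  have hσσ : σ (σ z) = z := by
    rw [hσ, map_pow, hσ]
    calc (z ^ 8) ^ 8 = (z ^ 9) ^ 7 * z := by ring
      _ = z := by rw [h9]; ring
  obtain ⟨a, rfl⟩ := exists_rep hζ x
  simp only [map_sum, map_mul, map_intCast, map_pow]
  rw [hσσ]

theorem unit_exponents_eq_zero {η μ : 𝓞 K} {i j k : ℕ} (hη : hζ.toInteger * η = 1)
    (hi : i < 3) (hj : j < 3)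
    (h : (hζ.toInteger + η) ^ i * ((hζ.toInteger + η) ^ 2 - 2) ^ j = hζ.toInteger ^ k * μ ^ 3)
    (hμ : IsUnit μ) : i = 0 ∧ j = 0 := by
  have key : ∀ (r s : ZMod 19), r * s = 1 → r ^ 6 + r ^ 3 + 1 = 0 →
      ((r + s) ^ i * ((r + s) ^ 2 - 2) ^ j) ^ 6 = r ^ (6 * k) := by
    intro r s hrs hr
    obtain ⟨φ, hφ⟩ := exists_ringHom hζ r hr
    have hφη : φ η = s := by
      have h1 := congrArg φ hη
      rw [map_mul, map_one, hφ] at h1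
      linear_combination s * h1 - φ η * hrs
    have h2 := congrArg φ h
    simp only [map_mul, map_pow, map_add, map_sub, map_ofNat, hφ, hφη] at h2
    have : Fact (Nat.Prime 19) := ⟨by norm_num⟩
    have h3 : φ μ ^ 18 = 1 := ZMod.pow_card_sub_one_eq_one (hμ.map φ).ne_zero
    rw [h2, mul_pow, ← pow_mul, ← pow_mul, h3, mul_one, mul_comm k]
  have combine : ∀ (r s : ZMod 19), r * s = 1 → r ^ 6 + r ^ 3 + 1 = 0 → s ^ 6 + s ^ 3 + 1 = 0 →
      ((r + s) ^ i * ((r + s) ^ 2 - 2) ^ j) ^ 12 = 1 := by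
    intro r s hrs hr hs
    have h1 := key r s hrs hr
    have h2 := key s r (by rw [mul_comm, hrs]) hs
    rw [add_comm s r] at h2
    rw [show 12 = 6 + 6 by norm_num, pow_add]
    nth_rw 1 [h1]
    rw [h2, ← mul_pow, hrs, one_pow]
  exact exponents_eq_zero hi hj (combine 4 5 (by decide) (by decide) (by decide))
    (combine 16 6 (by decide) (by decide) (by decide))

end NonagonField

namespace NonagonField

open NumberField NumberField.Units

section

variable (K : Type*) [Field K] [NumberField K]

set_option maxSynthPendingDepth 3 in
/-- The exponents modulo `3` of a unit with respect to a fundamental system. -/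
noncomputable def exponentMod : Additive (𝓞 K)ˣ →+ (Fin (rank K) → ZMod 3) where
  toFun u := fun i =>
    (((basisModTorsion K).repr (Additive.ofMul (QuotientGroup.mk u.toMul)) i : ℤ) : ZMod 3)
  map_zero' := by
    ext i
    simp
  map_add' u v := by
    ext i
    simp

variable {K}

theorem eq_torsion_mul_cube {u : (𝓞 K)ˣ} (hu : exponentMod K (Additive.ofMul u) = 0) :
    ∃ ω μ : (𝓞 K)ˣ, ω ∈ torsion K ∧ u = ω * μ ^ 3 := by
  obtain ⟨⟨ω, f⟩, h, -⟩ := exist_unique_eq_mul_prod K u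
  dsimp only at h
  have hf := fun_eq_repr K ω.2 h
  have hdvd : ∀ i, ∃ g : ℤ, f i = 3 * g := fun i => by
    have h1 := congrFun hu i
    rw [hf]
    exact (ZMod.intCast_zmod_eq_zero_iff_dvd _ 3).1 h1
  choose g hg using hdvd
  refine ⟨ω, ∏ i, fundSystem K i ^ g i, ω.2, ?_⟩
  rw [h, ← Finset.prod_pow]
  congr 1
  refine Finset.prod_congr rfl fun i _ => ?_
  rw [hg, mul_comm, zpow_mul]
  rfl

theorem exists_eq_mul_cube (hrank : rank K = 2) {u₁ u₂ : (𝓞 K)ˣ}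
    (hindep : ∀ i j : ℕ, i < 3 → j < 3 → ∀ ω μ : (𝓞 K)ˣ, ω ∈ torsion K →
      u₁ ^ i * u₂ ^ j = ω * μ ^ 3 → i = 0 ∧ j = 0) (u : (𝓞 K)ˣ) :
    ∃ (i j : ℕ) (ω μ : (𝓞 K)ˣ), i < 3 ∧ j < 3 ∧ ω ∈ torsion K ∧
      u = ω * (u₁ ^ i * u₂ ^ j) * μ ^ 3 := by
  have : Fact (Nat.Prime 3) := ⟨Nat.prime_three⟩
  let e := exponentMod K
  let f : (ZMod 3 × ZMod 3) →ₗ[ZMod 3] (Fin (rank K) → ZMod 3) :=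
    (LinearMap.toSpanSingleton _ _ (e (Additive.ofMul u₁))).coprod
      (LinearMap.toSpanSingleton _ _ (e (Additive.ofMul u₂)))
  have hf : ∀ x, f x = e (Additive.ofMul (u₁ ^ x.1.val * u₂ ^ x.2.val)) := by
    intro x
    rw [ofMul_mul, ofMul_pow, ofMul_pow, map_add, map_nsmul, map_nsmul,
      ← Nat.cast_smul_eq_nsmul (ZMod 3), ← Nat.cast_smul_eq_nsmul (ZMod 3), ZMod.natCast_zmod_val,
      ZMod.natCast_zmod_val]
    rfl
  have hinj : Function.Injective f := by
    rw [injective_iff_map_eq_zero]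
    intro x hx
    rw [hf] at hx
    obtain ⟨ω, μ, hω, hμ⟩ := eq_torsion_mul_cube hx
    obtain ⟨h1, h2⟩ := hindep _ _ (ZMod.val_lt _) (ZMod.val_lt _) ω μ hω hμ
    exact Prod.ext ((ZMod.val_eq_zero _).1 h1) ((ZMod.val_eq_zero _).1 h2)
  have hsurj : Function.Surjective f :=
    (LinearMap.injective_iff_surjective_of_finrank_eq_finrank (by simp [hrank])).1 hinj
  obtain ⟨x, hx⟩ := hsurj (e (Additive.ofMul u))
  have h0 : e (Additive.ofMul (u * (u₁ ^ x.1.val * u₂ ^ x.2.val)⁻¹)) = 0 := by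
    rw [ofMul_mul, ofMul_inv, map_add, map_neg, ← hf, hx, add_neg_cancel]
  obtain ⟨ω, μ, hω, hμ⟩ := eq_torsion_mul_cube h0
  refine ⟨_, _, ω, μ, ZMod.val_lt x.1, ZMod.val_lt x.2, hω, ?_⟩
  rw [mul_inv_eq_iff_eq_mul] at hμ
  rw [hμ, mul_right_comm]

end

variable {K : Type*} [Field K] [NumberField K] [hK : IsCyclotomicExtension {9} ℚ K]
  {ζ : K} (hζ : IsPrimitiveRoot ζ 9)

variable (K) in
theorem rank_eq_two : rank K = 2 := by
  have h := InfinitePlace.card_add_two_mul_card_eq_rank K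
  rw [nrComplexPlaces_eq_three, finrank_eq_six] at h
  rw [rank, InfinitePlace.card_eq_nrRealPlaces_add_nrComplexPlaces, nrComplexPlaces_eq_three]
  omega

theorem eq_pow_mul_cube_of_mem_torsion {ω : (𝓞 K)ˣ} (hω : ω ∈ torsion K) :
    ∃ (k : ℕ) (ε : 𝓞 K), IsUnit ε ∧ (ω : 𝓞 K) = hζ.toInteger ^ k * ε ^ 3 := by
  have hfin : IsOfFinOrder ((ω : 𝓞 K) : K) := by
    have h1 : IsOfFinOrder ω := hω
    exact MonoidHom.isOfFinOrder ((algebraMap (𝓞 K) K : 𝓞 K →* K).comp (Units.coeHom (𝓞 K))) h1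
  obtain ⟨r, -, hr | hr⟩ := hζ.exists_pow_or_neg_mul_pow_of_isOfFinOrder (by decide) hfin
  · refine ⟨r, 1, isUnit_one, RingOfIntegers.coe_injective ?_⟩
    rw [one_pow, mul_one]
    exact hr
  · refine ⟨r, -1, isUnit_one.neg, RingOfIntegers.coe_injective ?_⟩
    refine hr.trans ?_
    rw [map_mul, map_pow, map_pow, map_neg, map_one]
    change _ = ζ ^ r * _
    ring

theorem exists_nonagonRing : ∃ σ : 𝓞 K →+* 𝓞 K, NonagonRing σ hζ.toInteger := by
  obtain ⟨σ, hσ, hσσ⟩ := exists_conj hζ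
  refine ⟨σ, hσσ, toInteger_rel hζ, hσ, exists_rep hζ, ?_, prime_two K, fun u => ?_⟩
  · rw [← neg_sub]
    exact (prime_toInteger_sub_one hζ).neg
  have hrel := toInteger_rel hζ
  have hindep {i j k : ℕ} {μ : 𝓞 K} := unit_exponents_eq_zero hζ (i := i) (j := j) (k := k)
    (μ := μ) hσ
  set z := hζ.toInteger
  have hθ : (z + σ z) ^ 3 = 3 * (z + σ z) - 1 := by
    linear_combination (σ z) ^ 3 * hrel + (3 * (z + σ z) -
      (z ^ 3 + 1) * ((z * σ z) ^ 2 + z * σ z + 1)) * hσ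
  obtain ⟨u₁, hu₁⟩ : IsUnit (z + σ z) :=
    IsUnit.of_mul_eq_one (3 - (z + σ z) ^ 2) (by linear_combination -hθ)
  obtain ⟨u₂, hu₂⟩ : IsUnit ((z + σ z) ^ 2 - 2) :=
    IsUnit.of_mul_eq_one ((z + σ z) ^ 2 + (z + σ z) - 1)
      (by linear_combination (z + σ z + 1) * hθ)
  obtain ⟨i, j, ω, μ, hi, hj, hω, h⟩ := exists_eq_mul_cube (rank_eq_two K) (u₁ := u₁) (u₂ := u₂)
    (fun i j hi hj ω μ hω h => by
      obtain ⟨k, ε, hε, hk⟩ := eq_pow_mul_cube_of_mem_torsion hζ hω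
      refine hindep (k := k) (μ := ε * μ) hi hj ?_ (hε.mul μ.isUnit)
      have := congrArg Units.val h
      push_cast at this
      rw [hu₁, hu₂, hk] at this
      rw [this]; ring) u
  obtain ⟨k, ε, -, hk⟩ := eq_pow_mul_cube_of_mem_torsion hζ hω
  refine ⟨k, i, j, ε * μ, hi, hj, ?_⟩
  rw [h]
  push_cast
  rw [hu₁, hu₂, hk]
  ring

end NonagonField

/-- The real cubic field on the nonagon. -/
theorem exists_nonagonField :
    ∃ (F : Type) (_ : Field F) (_ : CharZero F) (θ : F), IsNonagonField F θ := by
  have : IsCyclotomicExtension {9} ℚ (CyclotomicField 9 ℚ) :=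
    CyclotomicField.isCyclotomicExtension 9 ℚ
  have := NonagonField.isPrincipalIdealRing (CyclotomicField 9 ℚ)
  obtain ⟨σ, h⟩ := NonagonField.exists_nonagonRing
    (IsCyclotomicExtension.zeta_spec 9 ℚ (CyclotomicField 9 ℚ))
  have := NonagonRing.charZero_fractionRing (σ := σ)
  exact ⟨_, inferInstance, this, h.exists_isNonagonField⟩

/-- Coprime factors of a square are squares up to a common sign. -/
theorem Int.exists_sq_of_isCoprime_mul_eq_sq {a b c : ℤ} (h : IsCoprime a b) (hab : a * b = c ^ 2) :
    ∃ ε p q : ℤ, (ε = 1 ∨ ε = -1) ∧ a = ε * p ^ 2 ∧ b = ε * q ^ 2 := by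
  obtain ⟨p, hp⟩ := Int.sq_of_isCoprime h hab
  obtain ⟨q, hq⟩ := Int.sq_of_isCoprime h.symm (by rw [mul_comm, hab])
  have hpos : 0 ≤ a * b := hab ▸ sq_nonneg c
  by_cases hp0 : p = 0
  · rcases hq with hq | hq
    · exact ⟨1, p, q, .inl rfl, by rcases hp with hp | hp <;> simp [hp, hp0], by rw [hq, one_mul]⟩
    · exact ⟨-1, p, q, .inr rfl, by rcases hp with hp | hp <;> simp [hp, hp0], by rw [hq]; ring⟩
  have hp1 : 0 < p ^ 2 := by positivity
  rcases hp with hp | hp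
  · refine ⟨1, p, q, .inl rfl, by rw [hp, one_mul], ?_⟩
    rcases hq with hq | hq
    · rw [hq, one_mul]
    · have : q ^ 2 = 0 := by rw [hp, hq] at hpos; nlinarith [sq_nonneg q]
      rw [hq, this]; ring
  · refine ⟨-1, p, q, .inr rfl, by rw [hp]; ring, ?_⟩
    rcases hq with hq | hq
    · have : q ^ 2 = 0 := by rw [hp, hq] at hpos; nlinarith [sq_nonneg q]
      rw [hq, this]; ring
    · rw [hq]; ring

/-- Coprime factors of twice a square. -/
theorem Int.exists_sq_of_isCoprime_mul_eq_two_mul_sq {a b c : ℤ} (h : IsCoprime a b)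
    (hab : a * b = 2 * c ^ 2) :
    ∃ ε p q : ℤ, (ε = 1 ∨ ε = -1) ∧ IsCoprime p q ∧ c ^ 2 = (p * q) ^ 2 ∧
      (a = 2 * (ε * p ^ 2) ∧ b = ε * q ^ 2 ∨ a = ε * q ^ 2 ∧ b = 2 * (ε * p ^ 2)) := by
  have key : ∀ {a b : ℤ}, IsCoprime a b → a * b = 2 * c ^ 2 → 2 ∣ a →
      ∃ ε p q : ℤ, (ε = 1 ∨ ε = -1) ∧ IsCoprime p q ∧ c ^ 2 = (p * q) ^ 2 ∧
        a = 2 * (ε * p ^ 2) ∧ b = ε * q ^ 2 := by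
    rintro a b h hab ⟨a', rfl⟩
    have h' : IsCoprime a' b := h.of_mul_left_right
    have hc : a' * b = c ^ 2 := by linarith
    obtain ⟨ε, p, q, hε, rfl, rfl⟩ := Int.exists_sq_of_isCoprime_mul_eq_sq h' hc
    refine ⟨ε, p, q, hε, (IsCoprime.pow_iff two_pos two_pos).1
      h'.of_mul_left_right.of_mul_right_right, ?_, rfl, rfl⟩
    rw [← hc]
    rcases hε with rfl | rfl <;> ring
  rcases Int.prime_two.dvd_or_dvd (Dvd.intro _ hab.symm) with h2 | h2
  · obtain ⟨ε, p, q, hε, hpq, hc, ha, hb⟩ := key h hab h2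
    exact ⟨ε, p, q, hε, hpq, hc, .inl ⟨ha, hb⟩⟩
  · obtain ⟨ε, p, q, hε, hpq, hc, ha, hb⟩ := key h.symm (by rw [mul_comm, hab]) h2
    exact ⟨ε, p, q, hε, hpq, hc, .inr ⟨hb, ha⟩⟩

theorem seven_dvd_of_sq_add_sq {a b : ℤ} (h : 7 ∣ a ^ 2 + b ^ 2) : 7 ∣ a ∧ 7 ∣ b := by
  have h7 : ∀ a b : ZMod 7, a ^ 2 + b ^ 2 = 0 → a = 0 ∧ b = 0 := by decide
  have := h7 a b (by exact_mod_cast (ZMod.intCast_zmod_eq_zero_iff_dvd _ 7).2 h)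
  exact ⟨(ZMod.intCast_zmod_eq_zero_iff_dvd _ 7).1 this.1,
    (ZMod.intCast_zmod_eq_zero_iff_dvd _ 7).1 this.2⟩

/-- The descent step from a Pythagorean parametrisation. -/
theorem quartic_descent_factor {s₁ s₂ r₁ r₂ : ℤ} (h₁ : IsCoprime s₁ r₂) (h₂ : IsCoprime s₂ r₁)
    (hr₁ : r₁ ≠ 0) (hr₂ : r₂ ≠ 0)
    (h : s₁ ^ 2 * (s₂ ^ 2 - r₁ ^ 2) = r₂ ^ 2 * (8 * r₁ ^ 2 - s₂ ^ 2)) :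
    r₁ ^ 2 = r₂ ^ 2 + s₁ ^ 2 ∧ s₂ ^ 2 = s₁ ^ 2 + 8 * r₂ ^ 2 := by
  obtain ⟨k, hk⟩ : r₂ ^ 2 ∣ s₂ ^ 2 - r₁ ^ 2 :=
    (h₁.pow (m := 2) (n := 2)).symm.dvd_of_dvd_mul_left (Dvd.intro _ h.symm)
  have hr₂' : r₂ ^ 2 ≠ 0 := pow_ne_zero 2 hr₂
  have hk' : 8 * r₁ ^ 2 - s₂ ^ 2 = k * s₁ ^ 2 := by
    apply mul_left_cancel₀ hr₂'
    rw [← h, hk]; ring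
  have e₁ : 7 * r₁ ^ 2 = k * (r₂ ^ 2 + s₁ ^ 2) := by linear_combination hk' + hk
  have e₂ : 7 * s₂ ^ 2 = k * (s₁ ^ 2 + 8 * r₂ ^ 2) := by linear_combination hk' + 8 * hk
  have hk7 : k ∣ 7 := by
    obtain ⟨u, v, huv⟩ := h₂.pow (m := 2) (n := 2)
    refine ⟨u * (s₁ ^ 2 + 8 * r₂ ^ 2) + v * (r₂ ^ 2 + s₁ ^ 2), ?_⟩
    linear_combination -7 * huv + u * e₂ + v * e₁
  have hkpos : 0 < k := by
    by_contra! hk0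
    have h1 : 0 < r₁ ^ 2 := by positivity
    nlinarith [sq_nonneg s₁, sq_nonneg r₂]
  have hk1 : k = 1 ∨ k = 7 := by
    have := Int.le_of_dvd (by norm_num) hk7
    interval_cases k <;> revert hk7 <;> decide
  rcases hk1 with rfl | rfl
  · obtain ⟨ha, hb⟩ := seven_dvd_of_sq_add_sq (a := r₂) (b := s₁) ⟨r₁ ^ 2, by linarith⟩
    exact absurd (h₁.isUnit_of_dvd' hb ha) (by decide)
  · exact ⟨by linarith, by linarith⟩

/-- The curve `v² = s⁴ - 3 s² r² + 4 r⁴` has no points with `s` odd and `r` even nonzero. -/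
theorem quartic_no_points {s r v : ℤ} (hsr : IsCoprime s r) (hs : Odd s) (hr : Even r)
    (h : v ^ 2 = s ^ 4 - 3 * s ^ 2 * r ^ 2 + 4 * r ^ 4) : r = 0 := by
  by_contra hr0
  induction hn : r.natAbs using Nat.strong_induction_on generalizing s r v with
  | _ n ih =>
  subst hn
  obtain ⟨r', rfl⟩ := hr
  have hodd : Odd (s ^ 2 - 2 * (r' + r') ^ 2) := by
    rw [Int.odd_sub]
    exact iff_of_true hs.pow ⟨_, two_mul _⟩
  have hcop : IsCoprime (s ^ 2 - 2 * (r' + r') ^ 2) (s * (r' + r')) := by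
    have h2s : IsCoprime s 2 := Int.isCoprime_two_right.2 hs
    refine IsCoprime.mul_right ?_ ?_
    · have : IsCoprime (-(2 * (r' + r') ^ 2)) s := (h2s.symm.mul_left hsr.symm.pow_left).neg_left
      simpa [sq, sub_eq_add_neg, mul_comm, mul_left_comm] using this.add_mul_left_left s
    · convert! (hsr.pow_left (m := 2)).add_mul_left_left (-2 * (r' + r')) using 1
      ring
  have hpy : PythagoreanTriple (s ^ 2 - 2 * (r' + r') ^ 2) (s * (r' + r')) |v| := by
    rw [PythagoreanTriple, abs_mul_abs_self]
    linear_combination -h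
  have hv0 : 0 < |v| := by
    rw [abs_pos]
    rintro rfl
    have h0 : (s ^ 2 - 2 * (r' + r') ^ 2) ^ 2 = 0 := by
      nlinarith [sq_nonneg (s ^ 2 - 2 * (r' + r') ^ 2), sq_nonneg (s * (r' + r'))]
    rw [pow_eq_zero_iff two_ne_zero |>.1 h0] at hodd
    simp at hodd
  obtain ⟨x, y, hx, hxy, -, hxyc, -, -⟩ :=
    hpy.coprime_classification' (Int.isCoprime_iff_gcd_eq_one.1 hcop) (Int.odd_iff.1 hodd) hv0
  have hxyc := Int.isCoprime_iff_gcd_eq_one.2 hxyc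
  have hprod : s * r' = x * y := by linarith
  obtain ⟨s₁, s₂, ⟨r₁, rfl⟩, ⟨r₂, rfl⟩, rfl⟩ := exists_dvd_and_dvd_of_dvd_mul (Dvd.intro _ hprod)
  have hs0 : s₁ * s₂ ≠ 0 := by
    rintro h0
    rw [h0] at hs
    simp at hs
  obtain rfl : r' = r₁ * r₂ := mul_left_cancel₀ hs0 (by rw [hprod]; ring)
  have hr₁ : r₁ ≠ 0 := by rintro rfl; simp at hr0
  have hr₂ : r₂ ≠ 0 := by rintro rfl; simp at hr0
  have hc1 : IsCoprime s₁ r₂ := hxyc.of_mul_left_left.of_mul_right_right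
  have hc2 : IsCoprime s₂ r₁ := hxyc.symm.of_mul_left_left.of_mul_right_right
  have hc3 : IsCoprime s₁ s₂ := hxyc.of_mul_left_left.of_mul_right_left
  obtain ⟨e₁, e₂⟩ := quartic_descent_factor hc1 hc2 hr₁ hr₂ (by linear_combination hx)
  obtain ⟨hs₁, hs₂⟩ := Int.odd_mul.1 hs
  have hr₂e : Even r₂ := by
    by_contra hr₂o
    obtain ⟨k, hk⟩ := Int.not_even_iff_odd.1 hr₂o
    obtain ⟨l, hl⟩ := hs₁
    rw [hk, hl] at e₁
    obtain ⟨m, rfl | rfl⟩ := Int.even_or_odd' r₁ <;> ring_nf at e₁ <;> omega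
  obtain ⟨a, ha⟩ : Even (s₂ - s₁) := hs₂.sub_odd hs₁
  obtain ⟨b, hb⟩ : Even (s₂ + s₁) := hs₂.add_odd hs₁
  have hab : a * b = 2 * r₂ ^ 2 := by
    have h1 : s₂ = a + b := by linarith
    have h2 : s₁ = b - a := by linarith
    rw [h1, h2] at e₂
    linarith
  have habc : IsCoprime a b := by
    obtain ⟨u, v, huv⟩ := hc3
    refine ⟨v - u, u + v, ?_⟩
    have h1 : s₂ = a + b := by linarith
    have h2 : s₁ = b - a := by linarith
    rw [h1, h2] at huv
    linear_combination huv
  obtain ⟨ε, p, q, hε, hpq, hr, hab'⟩ := Int.exists_sq_of_isCoprime_mul_eq_two_mul_sq habc hab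
  have hε2 : ε ^ 2 = 1 := by rcases hε with rfl | rfl <;> norm_num
  have hs₁sq : s₁ ^ 2 = (q ^ 2 - 2 * p ^ 2) ^ 2 := by
    have h2 : s₁ = b - a := by linarith
    rcases hab' with ⟨h1, h3⟩ | ⟨h1, h3⟩ <;> rw [h2, h1, h3] <;>
      linear_combination (q ^ 2 - 2 * p ^ 2) ^ 2 * hε2
  have hq : Odd q := by
    have hodd' := hs₁.pow (n := 2)
    rw [hs₁sq, Int.odd_pow' two_ne_zero] at hodd'
    by_contra hqe
    obtain ⟨k, rfl⟩ := Int.not_odd_iff_even.1 hqe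
    exact Int.not_odd_iff_even.2 ⟨2 * k ^ 2 - p ^ 2, by ring⟩ hodd'
  have hp : Even p := by
    have heven : Even ((p * q) ^ 2) := hr ▸ hr₂e.pow_of_ne_zero two_ne_zero
    rw [Int.even_pow' two_ne_zero, Int.even_mul] at heven
    exact heven.resolve_right (Int.not_even_iff_odd.2 hq)
  have hp0 : p ≠ 0 := by
    rintro rfl
    simp [hr₂] at hr
  refine ih p.natAbs ?_ (s := q) (r := p) (v := r₁) hpq.symm hq hp ?_ hp0 rfl
  · have hdvd : p ∣ r₁ * r₂ := by
      rcases sq_eq_sq_iff_eq_or_eq_neg.1 hr with h1 | h1 <;> rw [h1]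
      · exact ⟨r₁ * q, by ring⟩
      · exact ⟨-(r₁ * q), by ring⟩
    have := Nat.le_of_dvd (Int.natAbs_pos.2 (mul_ne_zero hr₁ hr₂)) (Int.natAbs_dvd_natAbs.2 hdvd)
    omega
  · rw [e₁, hr, hs₁sq]; ring

theorem sq_form_ne_sq {C D e : ℤ} (hcop : IsCoprime C D) (hC : Odd C) (hD : Even D) (hD0 : D ≠ 0) :
    C * (C + D) * (C ^ 2 + C * D + 2 * D ^ 2) ≠ e ^ 2 := by
  intro h
  have hC2 : IsCoprime C 2 := Int.isCoprime_two_right.2 hC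
  have hCD2 : IsCoprime (C + D) 2 := Int.isCoprime_two_right.2 (hC.add_even hD)
  have hCD : IsCoprime (C + D) D := by simpa using hcop.add_mul_left_left 1
  have hCCD : IsCoprime C (C + D) := by simpa [add_comm] using hcop.add_mul_left_right 1
  have hQ : IsCoprime (C * (C + D)) (C ^ 2 + C * D + 2 * D ^ 2) := by
    have h1 : IsCoprime (C * (C + D)) (2 * D ^ 2) :=
      IsCoprime.mul_left (hC2.mul_right hcop.pow_right) (hCD2.mul_right hCD.pow_right)
    convert! h1.add_mul_left_right 1 using 1
    ring
  have hQpos : 0 < C ^ 2 + C * D + 2 * D ^ 2 := by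
    have : 0 < D ^ 2 := by positivity
    nlinarith [sq_nonneg (2 * C + D)]
  obtain ⟨ε, g, w, hε, hg, hw⟩ := Int.exists_sq_of_isCoprime_mul_eq_sq hQ h
  obtain rfl : ε = 1 := by
    refine hε.resolve_right ?_
    rintro rfl
    nlinarith [sq_nonneg w]
  rw [one_mul] at hg hw
  obtain ⟨ε, a, b, hε, ha, hb⟩ := Int.exists_sq_of_isCoprime_mul_eq_sq hCCD hg
  have hε2 : ε ^ 2 = 1 := by rcases hε with rfl | rfl <;> norm_num
  have hcopw : IsCoprime w (a * b) := by
    rw [← IsCoprime.pow_iff two_pos two_pos, ← hw]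
    convert! hQ.symm using 1
    rw [hb, ha]
    linear_combination -(a * b) ^ 2 * hε2
  have hao : Odd a := by
    rw [ha] at hC
    exact (Int.odd_pow' two_ne_zero).1 (Int.odd_mul.1 hC).2
  have hbo : Odd b := by
    have := hC.add_even hD
    rw [hb] at this
    exact (Int.odd_pow' two_ne_zero).1 (Int.odd_mul.1 this).2
  have hDab : D = ε * (b ^ 2 - a ^ 2) := by linear_combination hb - ha
  have hwsq : w ^ 2 = (a * b) ^ 2 + 2 * D ^ 2 := by
    linear_combination -hw + (C + D) * ha + ε * a ^ 2 * hb + (a * b) ^ 2 * hε2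
  have hwo : Odd w := by
    rw [← Int.odd_pow' two_ne_zero, hwsq]
    exact (hao.mul hbo).pow.add_even ⟨D ^ 2, two_mul _⟩
  obtain ⟨x, hx⟩ : Even (w - a * b) := hwo.sub_odd (hao.mul hbo)
  obtain ⟨y, hy⟩ : Even (w + a * b) := hwo.add_odd (hao.mul hbo)
  obtain ⟨D', hD'⟩ : ∃ D', D = 2 * (2 * D') := by
    obtain ⟨k, rfl⟩ := hao
    obtain ⟨l, rfl⟩ := hbo
    exact ⟨ε * (l ^ 2 + l - k ^ 2 - k), by rw [hDab]; ring⟩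
  have hxy : x * y = 2 * (2 * D') ^ 2 := by
    have h1 : w = x + y := by linarith
    have h2 : a * b = y - x := by linarith
    rw [h1, h2, hD'] at hwsq
    linarith
  have hxyc : IsCoprime x y := by
    obtain ⟨u, v, huv⟩ := hcopw
    refine ⟨u - v, u + v, ?_⟩
    have h1 : w = x + y := by linarith
    have h2 : a * b = y - x := by linarith
    rw [h1, h2] at huv
    linear_combination huv
  obtain ⟨δ, p, q, hδ, hpq, hpqD, hxy'⟩ := Int.exists_sq_of_isCoprime_mul_eq_two_mul_sq hxyc hxy
  have hδ2 : δ ^ 2 = 1 := by rcases hδ with rfl | rfl <;> norm_num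
  have habsq : (a * b) ^ 2 = (q ^ 2 - 2 * p ^ 2) ^ 2 := by
    have h2 : a * b = y - x := by linarith
    rcases hxy' with ⟨h1, h3⟩ | ⟨h1, h3⟩ <;> rw [h2, h1, h3] <;>
      linear_combination (q ^ 2 - 2 * p ^ 2) ^ 2 * hδ2
  have hq : Odd q := by
    have hodd' := (hao.mul hbo).pow (n := 2)
    rw [habsq, Int.odd_pow' two_ne_zero] at hodd'
    by_contra hqe
    obtain ⟨k, rfl⟩ := Int.not_odd_iff_even.1 hqe
    exact Int.not_odd_iff_even.2 ⟨2 * k ^ 2 - p ^ 2, by ring⟩ hodd'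
  have hp : Even p := by
    have heven : Even ((p * q) ^ 2) := hpqD ▸ (even_two_mul D').pow_of_ne_zero two_ne_zero
    rw [Int.even_pow' two_ne_zero, Int.even_mul] at heven
    exact heven.resolve_right (Int.not_even_iff_odd.2 hq)
  obtain ⟨v, hv⟩ : ∃ v, a ^ 2 + b ^ 2 = 2 * v := by
    obtain ⟨k, rfl⟩ := hao
    obtain ⟨l, rfl⟩ := hbo
    exact ⟨2 * (k ^ 2 + k + l ^ 2 + l) + 1, by ring⟩
  have hp0 : p = 0 := by
    refine quartic_no_points (v := v) hpq.symm hq hp ?_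
    have h4 : (b ^ 2 - a ^ 2) ^ 2 = 4 * (p * q) ^ 2 := by
      linear_combination 4 * hpqD - (b ^ 2 - a ^ 2) ^ 2 * hε2
        - (D + ε * (b ^ 2 - a ^ 2)) * hDab + (D + 2 * (2 * D')) * hD'
    have h5 : 4 * v ^ 2 = 4 * (q ^ 4 - 3 * q ^ 2 * p ^ 2 + 4 * p ^ 4) := by
      linear_combination h4 - (a ^ 2 + b ^ 2 + 2 * v) * hv + 4 * habsq
    linarith
  rw [hp0] at hpqD
  have : D' = 0 := by simpa using hpqD
  exact hD0 (by rw [hD', this]; rfl)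

theorem period_three_norm_ne_sq {t ρ : ℚ} (ht : t ≠ 0) (ht1 : t + 1 ≠ 0) {C D : ℚ}
    (hC : C = t ^ 3 - 3 * t - 1) (hD : D = 2 * (t * (t + 1))) :
    C * (C + D) * (C ^ 2 + C * D + 2 * D ^ 2) ≠ ρ ^ 2 := by
  intro h
  obtain ⟨m, n, hn, hmn, hmn'⟩ : ∃ m n : ℤ, n ≠ 0 ∧ IsCoprime m n ∧ t = m / n :=
    ⟨t.num, t.den, by exact_mod_cast t.den_ne_zero, Rat.isCoprime_num_den t, (Rat.num_div_den t).symm⟩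
  have hnq : (n : ℚ) ≠ 0 := by exact_mod_cast hn
  obtain ⟨c, hc⟩ : ∃ c : ℤ, c = m ^ 3 - 3 * m * n ^ 2 - n ^ 3 := ⟨_, rfl⟩
  obtain ⟨d, hd⟩ : ∃ d : ℤ, d = 2 * (m * (n * (m + n))) := ⟨_, rfl⟩
  have hCc : (c : ℚ) = n ^ 3 * C := by
    rw [hC, hmn', hc]; push_cast; field_simp
  have hDd : (d : ℚ) = n ^ 3 * D := by
    rw [hD, hmn', hd]; push_cast; field_simp
  have hd0 : d ≠ 0 := by
    have : (d : ℚ) ≠ 0 := by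
      rw [hDd, hD]
      exact mul_ne_zero (pow_ne_zero 3 hnq) (mul_ne_zero two_ne_zero (mul_ne_zero ht ht1))
    exact_mod_cast this
  have hsq : IsSquare (c * (c + d) * (c ^ 2 + c * d + 2 * d ^ 2)) := by
    rw [← Rat.isSquare_intCast_iff]
    refine ⟨n ^ 6 * ρ, ?_⟩
    push_cast
    rw [hCc, hDd]
    linear_combination (n : ℚ) ^ 12 * h
  obtain ⟨e, he⟩ := hsq
  have hodd : Odd c := by
    by_contra hce
    rw [Int.not_odd_iff_even, hc] at hce
    have hm2 : ¬ (Even m ∧ Even n) := fun ⟨h1, h2⟩ => by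
      have := hmn.isUnit_of_dvd' h1.two_dvd h2.two_dvd
      exact absurd this (by decide)
    simp only [Int.even_sub, Int.even_pow, Int.even_mul] at hce
    have h3 : ¬ Even (3 : ℤ) := by decide
    tauto
  have hcm : IsCoprime c m := by
    convert! (hmn.symm.pow_left (m := 3)).neg_left.add_mul_left_left (m ^ 2 - 3 * n ^ 2) using 1
    rw [hc]; ring
  have hcn : IsCoprime c n := by
    convert! (hmn.pow_left (m := 3)).add_mul_left_left (-3 * m * n - n ^ 2) using 1
    rw [hc]; ring
  have hcmn : IsCoprime c (m + n) := by
    have h1 : IsCoprime m (m + n) := by simpa [add_comm] using hmn.add_mul_left_right 1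
    convert! (h1.pow_left (m := 3)).neg_left.add_mul_left_left (2 * m ^ 2 - 2 * m * n - n ^ 2) using 1
    rw [hc]; ring
  refine sq_form_ne_sq (e := e) (C := c) (D := d) ?_ hodd (hd ▸ even_two_mul _) hd0 (by rw [he, sq])
  rw [hd]
  exact (Int.isCoprime_two_right.2 hodd).mul_right (hcm.mul_right (hcn.mul_right hcmn))

/-- The rational roots of a monic integral cubic with constant term `±1` are `±1`. -/
theorem Rat.sq_eq_one_of_cubic {x : ℚ} (p q : ℤ) {ε : ℤ} (hε : IsUnit ε)
    (h : x ^ 3 + p * x ^ 2 + q * x + ε = 0) : x = 1 ∨ x = -1 := by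
  obtain ⟨m, n, hn, hmn, rfl⟩ : ∃ m n : ℤ, n ≠ 0 ∧ IsCoprime m n ∧ x = m / n :=
    ⟨x.num, x.den, by exact_mod_cast x.den_ne_zero, Rat.isCoprime_num_den x,
      (Rat.num_div_den x).symm⟩
  have hnq : (n : ℚ) ≠ 0 := by exact_mod_cast hn
  have hz : m ^ 3 + p * m ^ 2 * n + q * m * n ^ 2 + ε * n ^ 3 = 0 := by
    field_simp at h
    have : ((m ^ 3 + p * m ^ 2 * n + q * m * n ^ 2 + ε * n ^ 3 : ℤ) : ℚ) = 0 := by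
      push_cast; linear_combination h
    exact_mod_cast this
  have hnu : IsUnit n := (hmn.symm.pow_right (n := 3)).isUnit_of_dvd
    ⟨-(p * m ^ 2 + q * m * n + ε * n ^ 2), by linear_combination hz⟩
  have hmu : IsUnit m := by
    refine (hmn.pow_right (n := 3)).isUnit_of_dvd ((hε.dvd_mul_left).1 ?_)
    exact ⟨-(m ^ 2 + p * m * n + q * n ^ 2), by linear_combination hz⟩
  rcases Int.isUnit_iff.1 hnu with rfl | rfl <;> rcases Int.isUnit_iff.1 hmu with rfl | rfl <;>
    norm_num

theorem Rat.cube_ne_three_mul_sub_one (x : ℚ) : x ^ 3 ≠ 3 * x - 1 := by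
  intro h
  rcases Rat.sq_eq_one_of_cubic 0 (-3) isUnit_one (x := x) (by push_cast; linear_combination h) with
    rfl | rfl <;> norm_num at h

section CubicRelation

variable {F : Type*} [Field F] [CharZero F] {θ : F}

theorem ratCast_quadratic_eq_zero (hθ : θ ^ 3 = 3 * θ - 1) {p q r : ℚ}
    (h : (p : F) + q * θ + r * θ ^ 2 = 0) : p = 0 ∧ q = 0 ∧ r = 0 := by
  have hirr : ∀ x : ℚ, θ ≠ x := by
    rintro x rfl
    exact Rat.cube_ne_three_mul_sub_one x (by exact_mod_cast hθ)
  have hlin : ∀ {p q : ℚ}, (p : F) + q * θ = 0 → p = 0 ∧ q = 0 := by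
    intro p q h
    have hq : q = 0 := by
      by_contra hq
      have hqF : (q : F) ≠ 0 := by exact_mod_cast hq
      refine hirr (-p / q) ?_
      push_cast
      field_simp
      linear_combination h
    rw [hq, Rat.cast_zero, zero_mul, add_zero] at h
    exact ⟨by exact_mod_cast h, hq⟩
  have hr : r = 0 := by
    by_contra hr
    have hrF : (r : F) ≠ 0 := by exact_mod_cast hr
    obtain ⟨h1, h2⟩ := hlin (p := p * q + r ^ 2) (q := q ^ 2 - p * r - 3 * r ^ 2) (by
      push_cast
      linear_combination (q - r * θ) * h + r ^ 2 * hθ)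
    refine Rat.cube_ne_three_mul_sub_one (q / r) ?_
    field_simp
    linear_combination q * h2 + r * h1
  rw [hr, Rat.cast_zero, zero_mul, add_zero] at h
  exact ⟨(hlin h).1, (hlin h).2, hr⟩

end CubicRelation

namespace IsNonagonField

variable {F : Type*} [Field F] [CharZero F] {θ : F}

theorem coords_eq_zero (hF : IsNonagonField F θ) {p q r : ℚ}
    (h : (p : F) + q * θ + r * (2 - θ - θ ^ 2) = 0) : p = 0 ∧ q = 0 ∧ r = 0 := by
  obtain ⟨h1, h2, h3⟩ := ratCast_quadratic_eq_zero hF.rel (p := p + 2 * r) (q := q - r) (r := -r)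
    (by push_cast; linear_combination h)
  exact ⟨by linear_combination h1 + 2 * h3, by linear_combination h2 - h3, by linear_combination -h3⟩

theorem linear_form_cube (hF : IsNonagonField F θ) (X Y : F) :
    (θ * Y - (2 - θ - θ ^ 2) * X) ^ 3 = X ^ 3 + 6 * X ^ 2 * Y + 3 * X * Y ^ 2 - Y ^ 3
      + 3 * (X ^ 2 + X * Y + Y ^ 2) * (θ * Y - (2 - θ - θ ^ 2) * X) := by
  have h1 : θ ^ 4 = 3 * θ ^ 2 - θ := by linear_combination θ * hF.rel
  have h2 : θ ^ 5 = 3 * (3 * θ - 1) - θ ^ 2 := by linear_combination θ * h1 + 3 * hF.rel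
  have h3 : θ ^ 6 = 9 * θ ^ 2 - 6 * θ + 1 := by linear_combination θ * h2 - hF.rel
  ring_nf
  simp only [h1, h2, h3, hF.rel]
  ring

end IsNonagonField

theorem eq_one_of_cubic_pair {a b : ℚ} (h₁ : a ^ 3 - 1 = 3 * b * (a ^ 2 - 1))
    (h₂ : b * (1 + 2 * a) = a ^ 2 + 2 * a) : a = 1 ∧ b = 1 := by
  obtain rfl : a = 1 := by
    by_contra ha
    have h3 : (a - 1) * (a ^ 3 + 6 * a ^ 2 + 3 * a + -1) = 0 := by
      linear_combination -(1 + 2 * a) * h₁ - 3 * (a ^ 2 - 1) * h₂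
    have h4 := (mul_eq_zero.1 h3).resolve_left (sub_ne_zero.2 ha)
    rcases Rat.sq_eq_one_of_cubic 6 3 isUnit_one.neg (x := a) (by push_cast; exact h4) with
      rfl | rfl <;> norm_num at h4
  exact ⟨rfl, by linarith⟩

theorem eq_neg_one_of_cubic_pair {a b : ℚ} (h₁ : b ^ 3 + 1 = 3 * a * (b ^ 2 - 1))
    (h₂ : a + b = 2 * a * b - b ^ 2) : a = 0 ∧ b = -1 := by
  obtain rfl : b = -1 := by
    by_contra hb
    have h3 : (b + 1) * (b ^ 3 + 3 * b ^ 2 + -6 * b + 1) = 0 := by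
      linear_combination (1 - 2 * b) * h₁ + 3 * (b ^ 2 - 1) * h₂
    have h4 := (mul_eq_zero.1 h3).resolve_left (fun h => hb (eq_neg_of_add_eq_zero_left h))
    rcases Rat.sq_eq_one_of_cubic 3 (-6) isUnit_one (x := b) (by push_cast; exact h4) with
      rfl | rfl <;> norm_num at h4
  exact ⟨by linarith, rfl⟩

/-- Coordinates of a point over the quadratic field `ℚ(t)`, `t ^ 2 = T * t - N`: the elements
`A + B * t` and `a + b * t` are `u / n` and `y / n`. -/
structure QuadraticPoint (A B a b T N l₀ l₁ : ℚ) : Prop where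
  irred : ∀ r : ℚ, r ^ 2 - T * r + N ≠ 0
  const_eq : A ^ 2 - 9 * a ^ 2 + 8 = N * (B ^ 2 - 9 * b ^ 2 + 8)
  lin_eq : 2 * A * B - 18 * a * b + 8 = -T * (B ^ 2 - 9 * b ^ 2 + 8)
  cubic_three : l₁ = -(1 + B)
  cubic_two : l₀ - T * l₁ = 3 - A - B
  cubic_one : N * l₁ - T * l₀ = 6 - A - B
  cubic_zero : N * l₀ = 1 - A
  ne : ¬ (a = A ∧ b = B)
  ne_neg : ¬ (a = -A ∧ b = -B)

namespace QuadraticPoint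

variable {A B a b T N l₀ l₁ ξ η : ℚ}

theorem N_ne_zero (d : QuadraticPoint A B a b T N l₀ l₁) : N ≠ 0 := fun h =>
  d.irred 0 (by rw [h]; ring)

theorem neg (d : QuadraticPoint A B a b T N l₀ l₁) : QuadraticPoint A B (-a) (-b) T N l₀ l₁ where
  irred := d.irred
  const_eq := by linear_combination d.const_eq
  lin_eq := by linear_combination d.lin_eq
  cubic_three := d.cubic_three
  cubic_two := d.cubic_two
  cubic_one := d.cubic_one
  cubic_zero := d.cubic_zero
  ne h := d.ne_neg ⟨neg_eq_iff_eq_neg.1 h.1, neg_eq_iff_eq_neg.1 h.2⟩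
  ne_neg h := d.ne ⟨neg_injective h.1, neg_injective h.2⟩

theorem const_ne_zero (d : QuadraticPoint A B a b T N l₀ l₁) (he : B ^ 2 - 9 * b ^ 2 + 8 ≠ 0) :
    A ^ 2 - 9 * a ^ 2 + 8 ≠ 0 := by
  rw [d.const_eq]; exact mul_ne_zero d.N_ne_zero he

end QuadraticPoint

section RationalCases

variable {A B a b ξ η : ℚ}

theorem typeA_one (hs : (B ^ 2 - 9 * b ^ 2 + 8) * (3 * ξ + B) = 8 * (1 + B))
    (he : B ^ 2 - 9 * b ^ 2 + 8 ≠ 0)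
    (hξ : b = ξ) (hη : a = η)
    (h0 : B * η - A * ξ = -2 * (2 * a - b)) (hA : a = A) (hB : B = 2 * a - 3 * b) : False := by
  subst hξ hη hA hB
  obtain ⟨rfl, rfl⟩ := eq_one_of_cubic_pair (a := a) (b := b) (by linear_combination hs / 8)
    (by linear_combination -h0 / 2)
  norm_num at he

theorem typeA_four (hs : (B ^ 2 - 9 * b ^ 2 + 8) * (3 * ξ + B) = 8 * (1 + B))
    (hc : (A ^ 2 - 9 * a ^ 2 + 8) * (3 * η + A) = 8 * (A - 1))
    (hf : A ^ 2 - 9 * a ^ 2 + 8 ≠ 0)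
    (hξ : b = ξ) (hη : a = η)
    (h0 : B * η - A * ξ = -2 * (2 * b - a)) (hA : A = -a - 2 * b) (hB : B = -b - 2 * a) :
    False := by
  subst hξ hη hA hB
  have h1 : ((b - a) - 1) * ((b - a) + 1) * (a + b) = 0 := by
    linear_combination -(hc + hs) / 24
  rcases mul_eq_zero.1 h1 with h1 | h1
  · rcases mul_eq_zero.1 h1 with h1 | h1
    · obtain rfl : b = a + 1 := by linarith
      obtain rfl : a = -1 := by linarith
      norm_num at hf
    · obtain rfl : b = a - 1 := by linarith
      obtain rfl : a = -1 := by linarith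
      norm_num at hs
  · obtain rfl : b = -a := by linarith
    obtain rfl : a = 0 := by linarith
    norm_num at hs

theorem typeA_two (hc : (A ^ 2 - 9 * a ^ 2 + 8) * (3 * η + A) = 8 * (A - 1))
    (he : B ^ 2 - 9 * b ^ 2 + 8 ≠ 0)
    (hξ : b = ξ) (hη : a = η)
    (h0 : B * η - A * ξ = 2 * (a + b)) (hA : A = -3 * a + 2 * b) (hB : b = B) : False := by
  subst hξ hη hA hB
  obtain ⟨rfl, rfl⟩ := eq_neg_one_of_cubic_pair (a := a) (b := b) (by linear_combination hc / 8)
    (by linear_combination -h0 / 2)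
  norm_num at he

theorem typeC_one (hs : (B ^ 2 - 9 * b ^ 2 + 8) * (3 * ξ + B) = 8 * (1 + B))
    (hA : A = a - 4 * η) (hB : B = b - 4 * ξ)
    (h0 : b * η - a * ξ = 2 * η - ξ) (ha : a = -η) (hb : b = ξ - η) : η = 1 ∧ ξ = 1 := by
  subst ha hb hA hB
  exact eq_one_of_cubic_pair (by linear_combination hs / 8) (by linear_combination h0)

theorem typeC_four (hs : (B ^ 2 - 9 * b ^ 2 + 8) * (3 * ξ + B) = 8 * (1 + B))
    (hc : (A ^ 2 - 9 * a ^ 2 + 8) * (3 * η + A) = 8 * (A - 1))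
    (he : B ^ 2 - 9 * b ^ 2 + 8 ≠ 0)
    (hA : A = a - 4 * η) (hB : B = b - 4 * ξ)
    (h0 : b * η - a * ξ = 2 * ξ - η) (ha : a = ξ) (hb : b = η) : False := by
  subst ha hb hA hB
  have h1 : ((a - b) - 1) * ((a - b) + 1) * (a + b) = 0 := by
    linear_combination -(hc + hs) / 24
  rcases mul_eq_zero.1 h1 with h1 | h1
  · rcases mul_eq_zero.1 h1 with h1 | h1
    · obtain rfl : a = b + 1 := by linarith
      obtain rfl : b = -1 := by linarith
      norm_num at he
    · obtain rfl : a = b - 1 := by linarith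
      obtain rfl : b = -1 := by linarith
      norm_num at hs
  · obtain rfl : b = -a := by linarith
    obtain rfl : a = 0 := by linarith
    norm_num at hs

theorem typeC_two (hc : (A ^ 2 - 9 * a ^ 2 + 8) * (3 * η + A) = 8 * (A - 1))
    (hf : A ^ 2 - 9 * a ^ 2 + 8 ≠ 0)
    (hA : A = a - 4 * η) (hB : B = b - 4 * ξ)
    (h0 : b * η - a * ξ = -η - ξ) (ha : a = η - ξ) (hb : b = -ξ) : False := by
  subst ha hb hA hB
  obtain ⟨rfl, rfl⟩ := eq_neg_one_of_cubic_pair (a := η) (b := ξ) (by linear_combination hc / 8)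
    (by linear_combination h0)
  norm_num at hf

end RationalCases

namespace QuadraticPoint

variable {F : Type*} [Field F] [CharZero F] {θ : F} {A B a b T N l₀ l₁ ξ η : ℚ}

theorem cubic_form_eq_zero (hF : IsNonagonField F θ) (d : QuadraticPoint A B a b T N l₀ l₁)
    {X Y : F} (hXY : (8 * l₀ + (B ^ 2 - 9 * b ^ 2 + 8) * (A - 3 * (2 - θ - θ ^ 2))) * X
      + (8 * l₁ + (B ^ 2 - 9 * b ^ 2 + 8) * (B + 3 * θ)) * Y = 0) :
    8 * (θ * Y - (2 - θ - θ ^ 2) * X) ^ 3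
      + ((A * X + B * Y) ^ 2 - 9 * (a * X + b * Y) ^ 2)
        * ((A * X + B * Y) + 3 * (θ * Y - (2 - θ - θ ^ 2) * X)) = 0 := by
  have h1 : (A : F) ^ 2 - 9 * a ^ 2 + 8 = N * (B ^ 2 - 9 * b ^ 2 + 8) := mod_cast d.const_eq
  have h2 : 2 * (A : F) * B - 18 * a * b + 8 = -T * (B ^ 2 - 9 * b ^ 2 + 8) := mod_cast d.lin_eq
  have h3 : (l₁ : F) = -(1 + B) := mod_cast d.cubic_three
  have h4 : (l₀ : F) - T * l₁ = 3 - A - B := mod_cast d.cubic_two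
  have h5 : (N : F) * l₁ - T * l₀ = 6 - A - B := mod_cast d.cubic_one
  have h6 : (N : F) * l₀ = 1 - A := mod_cast d.cubic_zero
  rw [hF.linear_form_cube]
  generalize hE : θ * Y - (2 - θ - θ ^ 2) * X = E
  have hquad : (A * X + B * Y) ^ 2 - 9 * (a * X + b * Y) ^ 2 =
      (B ^ 2 - 9 * b ^ 2 + 8) * (Y ^ 2 - T * X * Y + N * X ^ 2) - 8 * (X ^ 2 + X * Y + Y ^ 2) := by
    linear_combination X ^ 2 * h1 + X * Y * h2
  have hcub : X ^ 3 + 6 * X ^ 2 * Y + 3 * X * Y ^ 2 - Y ^ 3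
      - (X ^ 2 + X * Y + Y ^ 2) * (A * X + B * Y) =
      (Y ^ 2 - T * X * Y + N * X ^ 2) * (l₀ * X + l₁ * Y) := by
    linear_combination -Y ^ 3 * h3 - X * Y ^ 2 * h4 - X ^ 2 * Y * h5 - X ^ 3 * h6
  rw [hquad]
  linear_combination (Y ^ 2 - T * X * Y + N * X ^ 2) * hXY + 8 * hcub
    - 3 * (B ^ 2 - 9 * b ^ 2 + 8) * (Y ^ 2 - T * X * Y + N * X ^ 2) * hE

theorem e_ne_zero (hF : IsNonagonField F θ) (d : QuadraticPoint A B a b T N l₀ l₁) :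
    B ^ 2 - 9 * b ^ 2 + 8 ≠ 0 := by
  intro he
  have heF : (B : F) ^ 2 - 9 * b ^ 2 + 8 = 0 := mod_cast he
  have h0 : A ^ 2 - 9 * a ^ 2 + 8 = 0 := by rw [d.const_eq, he, mul_zero]
  have h1 : 2 * A * B - 18 * a * b + 8 = 0 := by rw [d.lin_eq, he, mul_zero]
  have hl : ¬ (l₁ = 0 ∧ l₀ = 0) := fun ⟨h3, h4⟩ => by
    have := d.cubic_two
    have := d.cubic_three
    have := d.cubic_zero
    simp only [h3, h4, mul_zero] at *
    linarith
  have hno : ∀ x : ℚ, 3 * x ^ 2 + 3 * x + 1 ≠ 0 := fun x => by nlinarith [sq_nonneg (2 * x + 1)]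
  -- `E` is irrational
  have hE : ∀ q : ℚ, θ * (-l₀ : F) - (2 - θ - θ ^ 2) * l₁ ≠ q := fun q hq => by
    obtain ⟨-, h3, h4⟩ := hF.coords_eq_zero (p := -q) (q := -l₀) (r := -l₁)
      (by push_cast; linear_combination hq)
    exact hl ⟨neg_eq_zero.1 h4, neg_eq_zero.1 h3⟩
  rcases hF.points _ _ _ (d.cubic_form_eq_zero hF (X := l₁) (Y := -l₀) (by rw [heF]; ring)) with
    ⟨h, -⟩ | ⟨τ, ε, hτ, hε, ⟨hV, hU⟩ | ⟨hV, -⟩ | ⟨hV, hU⟩⟩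
  · exact hE 0 (by rw [h, Rat.cast_zero])
  · obtain ⟨δ, rfl, hδ⟩ : ∃ δ : ℚ, (δ : F) = ε ∧ δ ^ 2 = 1 := by
      rcases hε with rfl | rfl
      · exact ⟨1, by norm_num⟩
      · exact ⟨-1, by norm_num⟩
    have hV' : a * l₁ - b * l₀ = δ * (A * l₁ - B * l₀) := by
      have : ((a * l₁ - b * l₀ : ℚ) : F) = (δ * (A * l₁ - B * l₀) : ℚ) := by
        push_cast; linear_combination hV
      exact_mod_cast this
    rcases hτ with rfl | rfl | rfl
    · obtain ⟨-, h3, h4⟩ := hF.coords_eq_zero (p := 0) (q := -l₀ + (A * l₁ - B * l₀)) (r := -l₁)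
        (by push_cast; linear_combination hU)
      have hl1 : l₁ = 0 := neg_eq_zero.1 h4
      have hl0 : l₀ ≠ 0 := fun h => hl ⟨hl1, h⟩
      have hB : B = -1 := by linear_combination d.cubic_three - hl1
      have hb : b = -δ := by
        rw [hl1, hB] at hV'
        refine mul_right_cancel₀ hl0 ?_
        linear_combination -hV'
      rw [hB, hb] at h1
      have hA : A = 4 + 9 * (δ * a) := by linear_combination -h1 / 2
      exact hno (δ * a) (by rw [hA] at h0; linear_combination h0 / 24 - 3 * a ^ 2 / 8 * hδ)
    · obtain ⟨-, h3, h4⟩ := hF.coords_eq_zero (p := 0) (q := -l₀ - (A * l₁ - B * l₀))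
        (r := -l₁ - (A * l₁ - B * l₀)) (by push_cast; linear_combination hU)
      have hl01 : l₁ = l₀ := by linear_combination h3 - h4
      have hl0 : l₀ ≠ 0 := fun h => hl ⟨hl01.trans h, h⟩
      have hB : B = A + 1 := by
        rw [hl01] at h3
        refine mul_right_cancel₀ hl0 ?_
        linear_combination h3
      have hb : b = a + δ := by
        rw [hl01, hB] at hV'
        refine mul_right_cancel₀ hl0 ?_
        linear_combination -hV'
      rw [hB, hb] at he
      have hA : A = 4 + 9 * (δ * a) := by linear_combination (he - h0) / 2 + 9 / 2 * hδ
      exact hno (δ * a) (by rw [hA] at h0; linear_combination h0 / 24 - 3 * a ^ 2 / 8 * hδ)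
    · obtain ⟨-, h3, h4⟩ := hF.coords_eq_zero (p := 0) (q := -l₀)
        (r := -l₁ + (A * l₁ - B * l₀)) (by push_cast; linear_combination hU)
      have hl0 : l₀ = 0 := neg_eq_zero.1 h3
      have hl1 : l₁ ≠ 0 := fun h => hl ⟨h, hl0⟩
      have hA : A = 1 := by linear_combination d.cubic_zero - N * hl0
      have ha : a = δ := by
        rw [hl0, hA] at hV'
        refine mul_right_cancel₀ hl1 ?_
        linear_combination hV'
      rw [hA, ha] at h1
      have hB : B = -4 + 9 * (δ * b) := by linear_combination h1 / 2
      exact hno (-δ * b) (by rw [hB] at he; linear_combination he / 24 - 3 * b ^ 2 / 8 * hδ)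
  · rcases hε with rfl | rfl
    · exact hE (a * l₁ - b * l₀) (by push_cast; linear_combination hV)
    · exact hE (-(a * l₁ - b * l₀)) (by push_cast; linear_combination hV)
  · rcases hε with rfl | rfl
    · exact hE (((a * l₁ - b * l₀) - (A * l₁ - B * l₀)) / 4)
        (by push_cast; linear_combination hU / 4)
    · exact hE ((-(a * l₁ - b * l₀) - (A * l₁ - B * l₀)) / 4)
        (by push_cast; linear_combination hU / 4)

theorem false_of_typeA (hF : IsNonagonField F θ) (d : QuadraticPoint A B a b T N l₀ l₁)
    (he : B ^ 2 - 9 * b ^ 2 + 8 ≠ 0)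
    (hs : (B ^ 2 - 9 * b ^ 2 + 8) * (3 * ξ + B) = 8 * (1 + B))
    (hc : (A ^ 2 - 9 * a ^ 2 + 8) * (3 * η + A) = 8 * (A - 1)) {τ : F}
    (hτ : τ = θ ∨ τ = θ ^ 2 - 2 ∨ τ = 2 - θ - θ ^ 2)
    (hV : η * θ + ξ * (2 - θ - θ ^ 2) = (b * η - a * ξ) + a * θ + b * (2 - θ - θ ^ 2))
    (hU : (B * η - A * ξ) + A * θ + B * (2 - θ - θ ^ 2) =
      -(η * θ + ξ * (2 - θ - θ ^ 2)) * (1 + 2 * τ)) : False := by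
  obtain ⟨-, h1, h2⟩ := hF.coords_eq_zero (p := -(b * η - a * ξ)) (q := η - a) (r := ξ - b)
    (by push_cast; linear_combination hV)
  have hη : a = η := by linear_combination -h1
  have hξ : b = ξ := by linear_combination -h2
  have hrel := hF.rel
  rcases hτ with rfl | rfl | rfl
  · obtain ⟨h3, h4, h5⟩ := hF.coords_eq_zero (p := B * η - A * ξ + 2 * (2 * η - ξ))
      (q := A - η) (r := B + 3 * ξ - 2 * η)
      (by push_cast; linear_combination hU + 2 * ξ * hrel)
    exact typeA_one (A := A) hs he hξ hη (by rw [hη, hξ]; linear_combination h3)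
      (by rw [hη]; linear_combination -h4)
      (by rw [hη, hξ]; linear_combination h5)
  · obtain ⟨h3, h4, h5⟩ := hF.coords_eq_zero (p := B * η - A * ξ - 2 * (η + ξ))
      (q := A + 3 * η - 2 * ξ) (r := B - ξ)
      (by push_cast; linear_combination hU + (2 * ξ - 2 * η + 2 * ξ * θ) * hrel)
    exact typeA_two hc he hξ hη (by rw [hη, hξ]; linear_combination h3)
      (by rw [hη, hξ]; linear_combination h4) (by rw [hξ]; linear_combination -h5)
  · obtain ⟨h3, h4, h5⟩ := hF.coords_eq_zero (p := B * η - A * ξ + 2 * (2 * ξ - η))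
      (q := A + η + 2 * ξ) (r := B + ξ + 2 * η)
      (by push_cast; linear_combination hU + (2 * η - 4 * ξ - 2 * ξ * θ) * hrel)
    exact typeA_four hs hc (d.const_ne_zero he) hξ hη (by rw [hη, hξ]; linear_combination h3)
      (by rw [hη, hξ]; linear_combination h4) (by rw [hη, hξ]; linear_combination h5)

theorem false_of_typeC (hF : IsNonagonField F θ) (d : QuadraticPoint A B a b T N l₀ l₁)
    (he : B ^ 2 - 9 * b ^ 2 + 8 ≠ 0)
    (hs : (B ^ 2 - 9 * b ^ 2 + 8) * (3 * ξ + B) = 8 * (1 + B))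
    (hc : (A ^ 2 - 9 * a ^ 2 + 8) * (3 * η + A) = 8 * (A - 1)) {τ : F}
    (hτ : τ = θ ∨ τ = θ ^ 2 - 2 ∨ τ = 2 - θ - θ ^ 2)
    (hV : (b * η - a * ξ) + a * θ + b * (2 - θ - θ ^ 2) = τ * (η * θ + ξ * (2 - θ - θ ^ 2)))
    (hU : (B * η - A * ξ) + A * θ + B * (2 - θ - θ ^ 2) =
      ((b * η - a * ξ) + a * θ + b * (2 - θ - θ ^ 2)) - 4 * (η * θ + ξ * (2 - θ - θ ^ 2))) :
    False := by
  obtain ⟨-, h1, h2⟩ := hF.coords_eq_zero (p := (B * η - A * ξ) - (b * η - a * ξ))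
    (q := A - a + 4 * η) (r := B - b + 4 * ξ) (by push_cast; linear_combination hU)
  have hA : A = a - 4 * η := by linear_combination h1
  have hB : B = b - 4 * ξ := by linear_combination h2
  have hrel := hF.rel
  rcases hτ with rfl | rfl | rfl
  · obtain ⟨h3, h4, h5⟩ := hF.coords_eq_zero (p := (b * η - a * ξ) - (2 * η - ξ))
      (q := a + η) (r := b - (ξ - η)) (by push_cast; linear_combination hV - ξ * hrel)
    obtain ⟨rfl, rfl⟩ := typeC_one hs hA hB (by linear_combination h3) (by linear_combination h4)
      (by linear_combination h5)
    have ha : a = -1 := by linear_combination h4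
    have hb : b = 0 := by linear_combination h5
    have hN := d.const_eq
    have hT := d.lin_eq
    rw [hA, hB, ha, hb] at hN hT
    exact d.irred (-1) (by linear_combination (hT - hN) / 24)
  · obtain ⟨h3, h4, h5⟩ := hF.coords_eq_zero (p := (b * η - a * ξ) - (-η - ξ))
      (q := a - (η - ξ)) (r := b + ξ)
      (by push_cast; linear_combination hV + (η - ξ - ξ * θ) * hrel)
    exact typeC_two hc (d.const_ne_zero he) hA hB (by linear_combination h3)
      (by linear_combination h4) (by linear_combination h5)
  · obtain ⟨h3, h4, h5⟩ := hF.coords_eq_zero (p := (b * η - a * ξ) - (2 * ξ - η))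
      (q := a - ξ) (r := b - η)
      (by push_cast; linear_combination hV + (2 * ξ - η + ξ * θ) * hrel)
    exact typeC_four hs hc he hA hB (by linear_combination h3)
      (by linear_combination h4) (by linear_combination h5)

theorem not_nonagon (hF : IsNonagonField F θ) (d : QuadraticPoint A B a b T N l₀ l₁) : False := by
  have he := d.e_ne_zero hF
  have hrel := hF.rel
  obtain ⟨ξ, hξ⟩ : ∃ ξ, (B ^ 2 - 9 * b ^ 2 + 8) * (3 * ξ + B) = -8 * l₁ :=
    ⟨(-8 * l₁ / (B ^ 2 - 9 * b ^ 2 + 8) - B) / 3, by field_simp; ring⟩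
  obtain ⟨η, hη⟩ : ∃ η, (B ^ 2 - 9 * b ^ 2 + 8) * (3 * η + A) = -8 * l₀ :=
    ⟨(-8 * l₀ / (B ^ 2 - 9 * b ^ 2 + 8) - A) / 3, by field_simp; ring⟩
  have hs : (B ^ 2 - 9 * b ^ 2 + 8) * (3 * ξ + B) = 8 * (1 + B) := by
    linear_combination hξ - 8 * d.cubic_three
  have hc : (A ^ 2 - 9 * a ^ 2 + 8) * (3 * η + A) = 8 * (A - 1) := by
    linear_combination (3 * η + A) * d.const_eq + N * hη - 8 * d.cubic_zero
  have hξF : ((B : F) ^ 2 - 9 * b ^ 2 + 8) * (3 * ξ + B) = -8 * l₁ := mod_cast hξ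
  have hηF : ((B : F) ^ 2 - 9 * b ^ 2 + 8) * (3 * η + A) = -8 * l₀ := mod_cast hη
  have hcub := d.cubic_form_eq_zero hF (X := θ - ξ) (Y := η + (2 - θ - θ ^ 2)) (by
    linear_combination (θ - ξ) * hηF + (η + (2 - θ - θ ^ 2)) * hξF)
  have hE : θ * (η + (2 - θ - θ ^ 2)) - (2 - θ - θ ^ 2) * (θ - ξ) =
      η * θ + ξ * (2 - θ - θ ^ 2) := by ring
  have hlin : ∀ p q : ℚ, (p : F) * (θ - ξ) + q * (η + (2 - θ - θ ^ 2)) =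
      (q * η - p * ξ) + p * θ + q * (2 - θ - θ ^ 2) := fun p q => by ring
  rw [hE, hlin, hlin] at hcub
  rcases hF.points _ _ _ hcub with ⟨h, hU⟩ | ⟨τ, ε, hτ, hε, ⟨hV, -⟩ | ⟨hV, hU⟩ | ⟨hV, hU⟩⟩
  · obtain ⟨-, rfl, rfl⟩ := hF.coords_eq_zero (p := 0) (q := η) (r := ξ)
      (by push_cast; linear_combination h)
    obtain hB | hB : B = 0 ∨ B ^ 2 - 9 * b ^ 2 = 0 := by
      rcases hU with hU | hU | hU
      · exact .inl (hF.coords_eq_zero (p := 0) (q := A) (r := B)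
          (by push_cast at hU ⊢; linear_combination hU)).2.2
      · have := (hF.coords_eq_zero (p := 0) (q := A - 3 * a) (r := B - 3 * b)
          (by push_cast at hU ⊢; linear_combination hU)).2.2
        exact .inr (by linear_combination (B + 3 * b) * this)
      · have := (hF.coords_eq_zero (p := 0) (q := A + 3 * a) (r := B + 3 * b)
          (by push_cast at hU ⊢; linear_combination hU)).2.2
        exact .inr (by linear_combination (B - 3 * b) * this)
    · rw [hB] at hs
      norm_num at hs
    · rw [hB] at hs
      linarith
  · rcases hε with rfl | rfl
    · obtain ⟨-, h1, h2⟩ := hF.coords_eq_zero (p := (b * η - a * ξ) - (B * η - A * ξ))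
        (q := a - A) (r := b - B) (by push_cast; linear_combination hV)
      exact d.ne ⟨by linear_combination h1, by linear_combination h2⟩
    · obtain ⟨-, h1, h2⟩ := hF.coords_eq_zero (p := (b * η - a * ξ) + (B * η - A * ξ))
        (q := a + A) (r := b + B) (by push_cast; linear_combination hV)
      exact d.ne_neg ⟨by linear_combination h1, by linear_combination h2⟩
  · rcases hε with rfl | rfl
    · exact d.false_of_typeA hF he hs hc hτ (by linear_combination hV) hU
    · exact d.neg.false_of_typeA hF (by rwa [neg_sq]) (by rwa [neg_sq]) (by rwa [neg_sq]) hτ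
        (by push_cast; linear_combination hV) hU
  · rcases hε with rfl | rfl
    · exact d.false_of_typeC hF he hs hc hτ (by linear_combination hV)
        (by linear_combination hU)
    · exact d.neg.false_of_typeC hF (by rwa [neg_sq]) (by rwa [neg_sq]) (by rwa [neg_sq]) hτ
        (by push_cast; linear_combination hV) (by push_cast; linear_combination hU)

end QuadraticPoint

/-- There are no rational points on the curve parametrising a fixed point together with a `3`-cycle. -/
theorem IsNonagonField.no_rational_points {F : Type*} [Field F] [CharZero F] {θ : F}
    (hF : IsNonagonField F θ) {t y : ℚ} (ht : t * (t + 1) ≠ 0)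
    (hy : y ^ 2 = (t ^ 2 + t + 1) ^ 3 - (t ^ 3 - 3 * t - 1) * (t * (t + 1))) : False := by
  have hn : t ^ 2 + t + 1 ≠ 0 := by nlinarith [sq_nonneg (2 * t + 1)]
  have hC : t ^ 3 - 3 * t - 1 ≠ 0 := fun h =>
    Rat.cube_ne_three_mul_sub_one (-t) (by linear_combination -h)
  obtain ⟨U, hU⟩ : ∃ U, (t ^ 2 + t + 1) * U = 1 + 6 * t + 3 * t ^ 2 - t ^ 3 :=
    ⟨_, mul_div_cancel₀ _ hn⟩
  obtain ⟨V, hV⟩ : ∃ V, (t ^ 2 + t + 1) * V = y := ⟨_, mul_div_cancel₀ _ hn⟩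
  have hUV : U ^ 2 - 9 * V ^ 2 = -8 * (t ^ 2 + t + 1) := by
    refine mul_left_cancel₀ (pow_ne_zero 2 hn) ?_
    linear_combination ((t ^ 2 + t + 1) * U + (1 + 6 * t + 3 * t ^ 2 - t ^ 3)) * hU
      - 9 * ((t ^ 2 + t + 1) * V + y) * hV - 9 * hy
  have hUV' : V ^ 2 ≠ U ^ 2 := fun h => mul_ne_zero hC ht (by
    linear_combination (1 / 8) * ((t ^ 2 + t + 1) ^ 2 * h
      + ((t ^ 2 + t + 1) * U + (1 + 6 * t + 3 * t ^ 2 - t ^ 3)) * hU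
      - ((t ^ 2 + t + 1) * V + y) * hV - hy))
  have hE : ∀ q : ℚ, θ * t - (2 - θ - θ ^ 2) ≠ q := fun q hq => by
    have := (hF.coords_eq_zero (p := -q) (q := t) (r := -1)
      (by push_cast; linear_combination hq)).2.2
    norm_num at this
  have hUF : ((t : F) ^ 2 + t + 1) * U = 1 + 6 * t + 3 * t ^ 2 - t ^ 3 := mod_cast hU
  have hUVF : (U : F) ^ 2 - 9 * V ^ 2 = -8 * (t ^ 2 + t + 1) := mod_cast hUV
  have hcube := hF.linear_form_cube 1 t
  rcases hF.points U V (θ * t - (2 - θ - θ ^ 2)) (by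
      rw [hUVF]; linear_combination 8 * hcube - 8 * hUF) with
    ⟨h, -⟩ | ⟨τ, ε, -, hε, ⟨h, -⟩ | ⟨h, -⟩ | ⟨-, h⟩⟩
  · exact hE 0 (by rw [h, Rat.cast_zero])
  · refine hUV' ?_
    have : (V : F) ^ 2 = U ^ 2 := by
      rcases hε with rfl | rfl <;> rw [h] <;> ring
    exact_mod_cast this
  · rcases hε with rfl | rfl
    · exact hE V (by rw [h, one_mul])
    · exact hE (-V) (by rw [h]; push_cast; ring)
  · rcases hε with rfl | rfl
    · exact hE ((V - U) / 4) (by push_cast; linear_combination h / 4)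
    · exact hE ((-V - U) / 4) (by push_cast; linear_combination h / 4)

theorem no_square_in_fixed_point_field {t a₀ a₁ c : ℚ} (ht : t ≠ 0) (ht1 : t + 1 ≠ 0)
    (hc : 4 * c * (t * (t + 1)) ^ 2 = -((t ^ 3 - 3 * t - 1) ^ 2
      + 2 * (t ^ 3 - 3 * t - 1) * (t * (t + 1)) + 8 * (t * (t + 1)) ^ 2))
    (h₀ : a₀ ^ 2 + a₁ ^ 2 * ((1 - 4 * c) * (t * (t + 1)) ^ 2) = -c - 1 / 2)
    (h₁ : 4 * (t * (t + 1)) * (a₀ * a₁) = -1) : False := by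
  generalize hb : t * (t + 1) = b at *
  generalize hk : t ^ 3 - 3 * t - 1 = k at *
  have hsq : (a₀ ^ 2 - a₁ ^ 2 * ((1 - 4 * c) * b ^ 2)) ^ 2 = c * (c + 2) := by
    linear_combination (a₀ ^ 2 + a₁ ^ 2 * ((1 - 4 * c) * b ^ 2) - c - 1 / 2) * h₀
      - (1 - 4 * c) / 4 * (4 * b * (a₀ * a₁) - 1) * h₁
  refine period_three_norm_ne_sq (ρ := 4 * b ^ 2 * (a₀ ^ 2 - a₁ ^ 2 * ((1 - 4 * c) * b ^ 2)))
    ht ht1 hk.symm (D := 2 * b) (by rw [hb]) ?_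
  linear_combination -16 * b ^ 4 * hsq - (4 * c * b ^ 2 - (k ^ 2 + 2 * k * b)) * hc

section QuadraticField

variable {K : Type*} [Field K] [CharZero K] {s : K}

theorem ratCast_linear_eq_zero (hs : ∀ q : ℚ, s ≠ q) {a b : ℚ} (h : (a : K) + b * s = 0) :
    a = 0 ∧ b = 0 := by
  have hb : b = 0 := by
    by_contra hb
    have hbK : (b : K) ≠ 0 := by exact_mod_cast hb
    refine hs (-a / b) ?_
    push_cast
    field_simp
    linear_combination h
  rw [hb, Rat.cast_zero, zero_mul, add_zero] at h
  exact ⟨by exact_mod_cast h, hb⟩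

theorem exists_ratCast_add_mul (hdeg : Module.finrank ℚ K = 2) (hs : ∀ q : ℚ, s ≠ q) (z : K) :
    ∃ a b : ℚ, z = a + b * s := by
  have hli : LinearIndependent ℚ ![1, s] := by
    rw [LinearIndependent.pair_iff]
    intro a b h
    rw [Rat.smul_def, Rat.smul_def, mul_one] at h
    exact ratCast_linear_eq_zero hs h
  have : Module.Finite ℚ K := Module.finite_of_finrank_pos (by omega)
  have hspan := hli.span_eq_top_of_card_eq_finrank' (by simp [hdeg])
  have hz : z ∈ Submodule.span ℚ (Set.range ![(1 : K), s]) := hspan ▸ Submodule.mem_top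
  rw [Matrix.range_cons, Matrix.range_cons, Matrix.range_empty, Set.union_empty,
    Set.singleton_union, Submodule.mem_span_pair] at hz
  obtain ⟨a, b, h⟩ := hz
  exact ⟨a, b, by rw [← h, Rat.smul_def, Rat.smul_def, mul_one]⟩

end QuadraticField

/-- The curve of `no_rational_points` has no points over a quadratic field with irrational
parameter `t`. -/
theorem IsNonagonField.no_quadratic_points {F : Type*} [Field F] [CharZero F] {θ : F}
    (hF : IsNonagonField F θ) {K : Type*} [Field K] [CharZero K]
    (hdeg : Module.finrank ℚ K = 2) {t y : K} (htq : ∀ q : ℚ, t ≠ q)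
    (hn : t ^ 2 + t + 1 ≠ 0)
    (hy : y ^ 2 = (t ^ 2 + t + 1) ^ 3 - (t ^ 3 - 3 * t - 1) * (t * (t + 1))) : False := by
  obtain ⟨N', T, hT⟩ := exists_ratCast_add_mul hdeg htq (t ^ 2)
  obtain ⟨N, rfl⟩ : ∃ N, N' = -N := ⟨_, (neg_neg N').symm⟩
  rw [Rat.cast_neg] at hT
  obtain ⟨A, B, hU⟩ := exists_ratCast_add_mul hdeg htq
    ((1 + 6 * t + 3 * t ^ 2 - t ^ 3) / (t ^ 2 + t + 1))
  obtain ⟨a, b, hV⟩ := exists_ratCast_add_mul hdeg htq (y / (t ^ 2 + t + 1))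
  rw [div_eq_iff hn] at hU hV
  have hUV : (A + B * t) ^ 2 - 9 * (a + b * t) ^ 2 = -8 * (t ^ 2 + t + 1) := by
    refine mul_left_cancel₀ (pow_ne_zero 2 hn) ?_
    linear_combination
      -((A + B * t) * (t ^ 2 + t + 1) + (1 + 6 * t + 3 * t ^ 2 - t ^ 3)) * hU
      + 9 * ((a + b * t) * (t ^ 2 + t + 1) + y) * hV - 9 * hy
  obtain ⟨h0, h1⟩ := ratCast_linear_eq_zero htq
    (a := A ^ 2 - 9 * a ^ 2 + 8 - N * (B ^ 2 - 9 * b ^ 2 + 8))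
    (b := 2 * A * B - 18 * a * b + 8 + T * (B ^ 2 - 9 * b ^ 2 + 8))
    (by push_cast; linear_combination hUV - (B ^ 2 - 9 * b ^ 2 + 8 : K) * hT)
  obtain ⟨l, hl⟩ : ∃ l : ℚ, l = 3 - A - B - T * (1 + B) := ⟨_, rfl⟩
  have hlK : (l : K) = 3 - A - B - T * (1 + B) := mod_cast hl
  obtain ⟨h2, h3⟩ := ratCast_linear_eq_zero htq (a := 1 - A - N * l)
    (b := 6 - A - B + N * (1 + B) + T * l)
    (by push_cast; linear_combination hU + ((1 + B) * t - l : K) * hT + t ^ 2 * hlK)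
  have hne : ∀ ε : K, ε ^ 2 = 1 → (a + b * t : K) ≠ ε * (A + B * t) := by
    intro ε hε h
    have hCB : (t ^ 3 - 3 * t - 1) * (t * (t + 1)) = 0 := by
      refine mul_left_cancel₀ (show (8 : K) ≠ 0 by norm_num) ?_
      rw [h] at hV
      linear_combination -hy
        - ((A + B * t) * (t ^ 2 + t + 1) + (1 + 6 * t + 3 * t ^ 2 - t ^ 3)) * hU
        + (y + ε * (A + B * t) * (t ^ 2 + t + 1)) * hV
        + (A + B * t) ^ 2 * (t ^ 2 + t + 1) ^ 2 * hε
    rcases mul_eq_zero.1 hCB with h | h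
    · have := (ratCast_quadratic_eq_zero (θ := -t) (by linear_combination -h) (p := N) (q := T)
        (r := 1) (by push_cast; linear_combination hT)).2.2
      exact one_ne_zero this
    · rcases mul_eq_zero.1 h with h | h
      · exact htq 0 (by rw [h, Rat.cast_zero])
      · exact htq (-1) (by push_cast; linear_combination h)
  refine QuadraticPoint.not_nonagon hF (A := A) (B := B) (a := a) (b := b) (T := T) (N := N)
    (l₀ := l) (l₁ := -(1 + B)) ⟨fun r hr => ?_, by linear_combination h0, by linear_combination h1,
      rfl, by rw [hl]; ring, by linear_combination -h3, by linear_combination -h2,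
      fun h => hne 1 (one_pow 2) (by rw [h.1, h.2, one_mul]),
      fun h => hne (-1) (by ring) (by rw [h.1, h.2]; push_cast; ring)⟩
  have hrK : (r : K) ^ 2 - T * r + N = 0 := mod_cast hr
  have hfac : (t - r) * (t - (T - r)) = 0 := by linear_combination hT - hrK
  rcases mul_eq_zero.1 hfac with h | h
  · exact htq r (sub_eq_zero.1 h)
  · exact htq (T - r) (by push_cast; exact sub_eq_zero.1 h)

/-- A `3`-cycle `x₁ ↦ x₂ ↦ x₃` of `z ↦ z ^ 2 + c` is parametrised by `t = x₁ + x₂`. -/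
theorem three_cycle_parameter {K : Type*} [Field K] [CharZero K] {c x₁ x₂ x₃ t : K}
    (h₁ : x₂ = x₁ ^ 2 + c) (h₂ : x₃ = x₂ ^ 2 + c) (h₃ : x₁ = x₃ ^ 2 + c) (hne : x₂ ≠ x₁)
    (ht : t = x₁ + x₂) : t ≠ 0 ∧ t + 1 ≠ 0 ∧ t ^ 2 + t + 1 ≠ 0 ∧
    4 * c * (t * (t + 1)) ^ 2 = -((t ^ 3 - 3 * t - 1) ^ 2
      + 2 * (t ^ 3 - 3 * t - 1) * (t * (t + 1)) + 8 * (t * (t + 1)) ^ 2) := by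
  obtain rfl : x₂ = t - x₁ := by linear_combination -ht
  have hx3 : x₃ = t - x₁ - t * (2 * x₁ - t) := by linear_combination h₂ - h₁
  have hd : 2 * x₁ - t ≠ 0 := fun h => hne (by linear_combination -h)
  have hx1 : 2 * (t * (t + 1)) * x₁ = t ^ 3 + 2 * t ^ 2 + t + 1 := by
    refine mul_left_cancel₀ hd ?_
    rw [hx3] at h₂ h₃
    linear_combination h₂ - h₃
  have ht0 : t ≠ 0 := by
    rintro rfl
    norm_num at hx1
  have ht1 : t + 1 ≠ 0 := fun h => by
    obtain rfl : t = -1 := by linear_combination h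
    norm_num at hx1
  refine ⟨ht0, ht1, fun h => hd ?_, ?_⟩
  · refine mul_left_cancel₀ (mul_ne_zero ht0 ht1) ?_
    linear_combination hx1 + h
  · have hc : c = t - x₁ - x₁ ^ 2 := by linear_combination -h₁
    rw [hc]
    linear_combination -(2 * (t * (t + 1)) + 2 * (t * (t + 1)) * x₁
      + (t ^ 3 + 2 * t ^ 2 + t + 1)) * hx1

theorem fixed_point_of_hasPreperiodicType {K : Type*} [Field K] {c α : K}
    (h : HasPreperiodicType c 1 2 α) : ∃ p : K, c = p - p ^ 2 ∧ α ^ 2 = p ^ 2 - 2 * p := by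
  obtain ⟨⟨h1, -⟩, h2⟩ := h
  simp only [Function.iterate_succ, Function.iterate_zero, Function.comp_apply, id, fc] at h1 h2
  refine ⟨(α ^ 2 + c) ^ 2 + c, by linear_combination h1, ?_⟩
  have h3 : (α ^ 2 + c) ^ 2 + c = -(α ^ 2 + c) := by
    have : ((α ^ 2 + c) ^ 2 + c - (α ^ 2 + c)) * ((α ^ 2 + c) ^ 2 + c + (α ^ 2 + c)) = 0 := by
      linear_combination h1
    exact eq_neg_of_add_eq_zero_left ((mul_eq_zero.1 this).resolve_left (sub_ne_zero.2 h2))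
  rw [h3] at h1 ⊢
  linear_combination -h1

theorem no_type_1_2_with_period_3 {K : Type*} [Field K] [NumberField K]
    (hdeg : Module.finrank ℚ K = 2) (c : K) :
    ¬∃ α β : K, HasPreperiodicType c 1 2 α ∧ HasExactPeriod c 3 β := by
  rintro ⟨α, β, hα, hβ, hβ'⟩
  obtain ⟨p, hcp, hαp⟩ := fixed_point_of_hasPreperiodicType hα
  obtain ⟨ht0, ht1, hn, hc⟩ := three_cycle_parameter (x₁ := β) rfl rfl hβ.symm
    (hβ' 1 le_rfl (by norm_num)) rfl
  obtain ⟨F, _, _, θ, hF⟩ := exists_nonagonField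
  generalize β + (β ^ 2 + c) = t at ht0 ht1 hn hc
  obtain ⟨y, hyp⟩ : ∃ y, y = (2 * p - 1) * (t * (t + 1)) := ⟨_, rfl⟩
  have hyc : y ^ 2 = (1 - 4 * c) * (t * (t + 1)) ^ 2 := by rw [hyp, hcp]; ring
  have hy : y ^ 2 = (t ^ 2 + t + 1) ^ 3 - (t ^ 3 - 3 * t - 1) * (t * (t + 1)) := by
    linear_combination hyc - hc
  by_cases htq : ∀ q : ℚ, t ≠ q
  · exact hF.no_quadratic_points hdeg htq hn hy
  push Not at htq
  obtain ⟨t, rfl⟩ := htq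
  have ht0' : t ≠ 0 := by exact_mod_cast ht0
  have ht1' : t + 1 ≠ 0 := by exact_mod_cast ht1
  by_cases hyq : ∀ q : ℚ, y ≠ q
  · obtain ⟨a₀, a₁, ha⟩ := exists_ratCast_add_mul hdeg hyq α
    obtain ⟨c', hc'⟩ : ∃ c' : ℚ, 4 * c' * (t * (t + 1)) ^ 2 = -((t ^ 3 - 3 * t - 1) ^ 2
        + 2 * (t ^ 3 - 3 * t - 1) * (t * (t + 1)) + 8 * (t * (t + 1)) ^ 2) :=
      ⟨-((t ^ 3 - 3 * t - 1) ^ 2 + 2 * (t ^ 3 - 3 * t - 1) * (t * (t + 1))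
        + 8 * (t * (t + 1)) ^ 2) / (4 * (t * (t + 1)) ^ 2), by field_simp⟩
    obtain rfl : c = c' := by
      have hc'' : 4 * (c' : K) * (t * (t + 1)) ^ 2 = -((t ^ 3 - 3 * t - 1) ^ 2
        + 2 * (t ^ 3 - 3 * t - 1) * (t * (t + 1)) + 8 * (t * (t + 1)) ^ 2) := mod_cast hc'
      refine mul_left_cancel₀ (mul_ne_zero (show (4 : K) ≠ 0 by norm_num)
        (pow_ne_zero 2 (mul_ne_zero ht0 ht1))) ?_
      linear_combination hc - hc''
    obtain ⟨h0, h1⟩ := ratCast_linear_eq_zero hyq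
      (a := 2 * (t * (t + 1)) * (a₀ ^ 2 + a₁ ^ 2 * ((1 - 4 * c') * (t * (t + 1)) ^ 2)
        + c' + 1 / 2)) (b := 4 * (t * (t + 1)) * (a₀ * a₁) + 1) (by
          push_cast
          rw [← hyc]
          rw [ha] at hαp
          linear_combination 2 * (t * (t + 1) : K) * (hαp + hcp) + hyp)
    refine no_square_in_fixed_point_field ht0' ht1' hc' (a₀ := a₀) (a₁ := a₁) ?_
      (by linear_combination h1)
    linear_combination (mul_eq_zero.1 h0).resolve_left
      (mul_ne_zero two_ne_zero (mul_ne_zero ht0' ht1'))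
  · push Not at hyq
    obtain ⟨y, rfl⟩ := hyq
    exact hF.no_rational_points (mul_ne_zero ht0' ht1') (by exact_mod_cast hy)
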